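/- Let N > 3 be an odd integer. Then the dual billiard map f_{Π_N} outside the regular N-gon Π_N has an aperiodic point, and the dual billiard map f_{Π_{2N}} outside the regular 2N-gon Π_{2N} also has an aperiodic point. -/

import Mathlib

open Complex

noncomputable section

/-- `w` lies strictly on the right of the oriented line from `z` to `a`. -/
def StrictlyRight (z a w : ℂ) : Prop := ((starRingEnd ℂ) (a - z) * (w - z)).im < 0

/-- `z` is an aperiodic point of the (left) dual billiard map outside the regular `M`-gon
(the interior of the convex hull of the `M`-th roots of unity): there is an injective
bi-infinite orbit through `z`, where at each step the map reflects in the unique vertex `a`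
such that all other vertices lie strictly on the right of the oriented line from the current
point to `a`. -/
def IsAperiodicPt (M : ℕ) (z : ℂ) : Prop :=
  ∃ g : ℤ → ℂ, Function.Injective g ∧ g 0 = z ∧
    ∀ n : ℤ, ∃ a : ℂ, a ^ M = 1 ∧
      (∀ b : ℂ, b ^ M = 1 → b ≠ a → StrictlyRight (g n) a b) ∧
      g (n + 1) = 2 * a - g n

namespace DualBilliard

open Filter Topology MeasureTheory

set_option linter.unusedSectionVars false

/-- The standing assumption on the number of vertices: odd and larger than `3`. -/
class OddGtThree (N : ℕ) : Prop where
  gt : 3 < N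
  odd : Odd N

/-- A two-step induction principle on `ℤ`. -/
theorem int_pair_induction {P : ℤ → Prop} (h0 : P 0) (h1 : P 1)
    (hs : ∀ n, P n → P (n + 1) → P (n + 2)) (hp : ∀ n, P n → P (n + 1) → P (n - 1)) (n : ℤ) :
    P n := by
  have key : P n ∧ P (n + 1) := by
    induction n using Int.induction_on with
    | zero => exact ⟨h0, by simpa using h1⟩
    | succ i ih => exact ⟨ih.2, by have := hs _ ih.1 ih.2; rwa [add_assoc]⟩
    | pred i ih =>
      refine ⟨hp _ ih.1 ih.2, ?_⟩
      have := ih.1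
      rwa [sub_add_cancel]
  exact key.1

/-- The rotation angle. -/
def phi (N : ℕ) : ℝ := Real.pi * (N - 1) / N

/-- The trace of the rotation by `phi N`. -/
def tr (N : ℕ) : ℝ := 2 * Real.cos (phi N)

/-- The Chebyshev-like sequence `sin (n φ) / sin φ`. -/
def U (N : ℕ) (n : ℤ) : ℝ := Real.sin (n * phi N) / Real.sin (phi N)

section

variable (N : ℕ) [hN : OddGtThree N]

theorem natCast_pos : (0 : ℝ) < N := by
  have := hN.gt
  exact_mod_cast (by omega : 0 < N)

theorem sin_int_mul_phi_eq_zero_iff (n : ℤ) : Real.sin (n * phi N) = 0 ↔ (N : ℤ) ∣ n := by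
  have hNp := natCast_pos N
  rw [Real.sin_eq_zero_iff]
  constructor
  · rintro ⟨k, hk⟩
    have h1 : (k : ℝ) * N = n * (N - 1) := by
      unfold phi at hk
      have hpi := Real.pi_pos
      field_simp at hk
      linarith
    have h2 : k * (N : ℤ) = n * (N - 1) := by exact_mod_cast h1
    exact ⟨n - k, by linarith⟩
  · rintro ⟨k, rfl⟩
    refine ⟨k * (N - 1), ?_⟩
    unfold phi
    push_cast
    field_simp

theorem sin_phi_ne_zero : Real.sin (phi N) ≠ 0 := by
  have h := sin_int_mul_phi_eq_zero_iff N 1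
  have h3 := hN.gt
  intro h0
  have := h.1 (by simpa using h0)
  have := Int.le_of_dvd one_pos this
  omega

theorem U_eq_zero_iff (n : ℤ) : U N n = 0 ↔ (N : ℤ) ∣ n := by
  rw [← sin_int_mul_phi_eq_zero_iff, U, div_eq_zero_iff]
  simp [sin_phi_ne_zero N]

theorem U_zero : U N 0 = 0 := by simp [U]

theorem U_one : U N 1 = 1 := by simp [U, sin_phi_ne_zero N]

theorem U_neg (n : ℤ) : U N (-n) = -U N n := by
  simp [U, Real.sin_neg, neg_div]

theorem U_add_one (n : ℤ) : U N (n + 1) = tr N * U N n - U N (n - 1) := by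
  have h := sin_phi_ne_zero N
  have e1 : ((n + 1 : ℤ) : ℝ) * phi N = n * phi N + phi N := by push_cast; ring
  have e2 : ((n - 1 : ℤ) : ℝ) * phi N = n * phi N - phi N := by push_cast; ring
  unfold U tr
  rw [e1, e2, Real.sin_add, Real.sin_sub]
  field_simp
  ring

theorem U_add_natCast (n : ℤ) : U N (n + N) = U N n := by
  obtain ⟨m, hm⟩ := hN.odd
  have hNp := natCast_pos N
  have h : ((n + N : ℤ) : ℝ) * phi N = n * phi N + (m : ℤ) * (2 * Real.pi) := by
    have : (N : ℝ) = 2 * m + 1 := by exact_mod_cast hm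
    have h2 : (N : ℝ) * phi N = Real.pi * (N - 1) := by unfold phi; field_simp
    push_cast
    rw [add_mul, h2, this]
    ring
  unfold U
  rw [h, Real.sin_add_int_mul_two_pi]

theorem U_add_of_dvd {k : ℤ} (hk : (N : ℤ) ∣ k) (n : ℤ) : U N (n + k) = U N n := by
  obtain ⟨c, rfl⟩ := hk
  induction c using Int.induction_on with
  | zero => simp
  | succ i ih => rw [← ih, mul_add, ← add_assoc, mul_one, U_add_natCast]
  | pred i ih =>
    rw [← ih, ← U_add_natCast]
    congr 1
    ring

theorem U_mul_sub (i j : ℤ) : U N j * U N (i - 1) - U N i * U N (j - 1) = U N (i - j) := by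
  have h := sin_phi_ne_zero N
  have e1 : ((i - 1 : ℤ) : ℝ) * phi N = i * phi N - phi N := by push_cast; ring
  have e2 : ((j - 1 : ℤ) : ℝ) * phi N = j * phi N - phi N := by push_cast; ring
  have e3 : ((i - j : ℤ) : ℝ) * phi N = i * phi N - j * phi N := by push_cast; ring
  unfold U
  rw [e1, e2, e3]
  simp only [Real.sin_sub]
  field_simp
  ring

theorem irrational_tr : Irrational (tr N) := by
  have h3 := hN.gt
  have hNp := natCast_pos N
  have hden : (((N : ℤ) - 1 : ℤ) / (N : ℤ) : ℚ).den = N := by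
    have := Rat.den_div_eq_of_coprime (a := (N : ℤ) - 1) (b := (N : ℤ)) (by omega) (by
      have : IsCoprime ((N : ℤ) - 1) (N : ℤ) := ⟨-1, 1, by ring⟩
      simpa [Int.isCoprime_iff_nat_coprime] using this)
    exact_mod_cast this
  have h := irrational_cos_rat_mul_pi (r := (((N : ℤ) - 1 : ℤ) / (N : ℤ) : ℚ)) (by
    rw [hden]; exact h3)
  have e : phi N = ((((N : ℤ) - 1 : ℤ) / (N : ℤ) : ℚ) : ℝ) * Real.pi := by
    unfold phi
    push_cast
    ring
  rw [tr, e]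
  exact_mod_cast h.natCast_mul (m := 2) two_ne_zero

theorem tr_sq_lt : tr N ^ 2 < 4 := by
  have h := sin_phi_ne_zero N
  have := Real.sin_sq_add_cos_sq (phi N)
  have := sq_pos_of_ne_zero h
  unfold tr
  nlinarith

theorem abs_tr_lt : |tr N| < 2 := by
  have h := tr_sq_lt N
  rw [show (4 : ℝ) = 2 ^ 2 by norm_num] at h
  simpa using sq_lt_sq.1 h

/-- A primitive root of unity with argument `phi N`. -/
def zet : ℂ := Complex.exp (phi N * I)

theorem zet_ne_zero : zet N ≠ 0 := Complex.exp_ne_zero _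

theorem zet_zpow (n : ℤ) :
    zet N ^ n = (Real.cos (n * phi N) : ℂ) + (Real.sin (n * phi N) : ℂ) * I := by
  rw [zet, ← Complex.exp_int_mul, ← mul_assoc, Complex.exp_mul_I]
  push_cast
  rfl

theorem zet_zpow_eq_one_iff_dvd {n : ℤ} (h : zet N ^ n = 1) : (N : ℤ) ∣ n := by
  rw [zet_zpow] at h
  rw [← sin_int_mul_phi_eq_zero_iff]
  have := congrArg Complex.im h
  simpa [-ofReal_cos, -ofReal_sin] using this

theorem zet_pow_natCast : zet N ^ N = 1 := by
  obtain ⟨m, hm⟩ := hN.odd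
  have hNp := natCast_pos N
  have h2 : (N : ℝ) * phi N = m * (2 * Real.pi) := by
    have : (N : ℝ) = 2 * m + 1 := by exact_mod_cast hm
    have : (N : ℝ) * phi N = Real.pi * (N - 1) := by unfold phi; field_simp
    rw [this, ‹(N : ℝ) = _›]; ring
  have h := zet_zpow N N
  have hs : Real.sin (m * (2 * Real.pi)) = 0 := by
    have := Real.sin_add_nat_mul_two_pi 0 m
    simpa using this
  rw [Int.cast_natCast, h2, Real.cos_nat_mul_two_pi, hs] at h
  simpa using h

theorem isIntegral_zet_zpow (n : ℤ) : IsIntegral ℤ (zet N ^ n) := by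
  have hpos : 0 < N := by have := hN.gt; omega
  refine IsIntegral.of_pow hpos ?_
  rw [← zpow_natCast, ← zpow_mul, mul_comm, zpow_mul, zpow_natCast, zet_pow_natCast, one_zpow]
  exact isIntegral_one

theorem ofReal_tr : (tr N : ℂ) = zet N ^ (1 : ℤ) + zet N ^ (-1 : ℤ) := by
  rw [zet_zpow, zet_zpow]
  simp [tr]
  ring

theorem isIntegral_tr : IsIntegral ℤ (tr N : ℂ) := by
  rw [ofReal_tr]
  exact (isIntegral_zet_zpow N 1).add (isIntegral_zet_zpow N (-1))

theorem isIntegral_U (n : ℤ) : IsIntegral ℤ (U N n : ℂ) := by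
  induction n using int_pair_induction with
  | h0 => rw [U_zero]; simpa using isIntegral_zero
  | h1 => rw [U_one]; simpa using isIntegral_one
  | hs n h h' =>
    have := U_add_one N (n + 1)
    rw [add_assoc, one_add_one_eq_two, add_sub_cancel_right] at this
    rw [this]
    push_cast
    exact ((isIntegral_tr N).mul h').sub h
  | hp n h h' =>
    have := U_add_one N n
    rw [show U N (n - 1) = tr N * U N n - U N (n + 1) by rw [this]; ring]
    push_cast
    exact ((isIntegral_tr N).mul h).sub h'

/-- `N` is a multiple of `1 - ξ` in the algebraic integers, `ξ` a nontrivial root of unity. -/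
theorem exists_isIntegral_one_sub_mul {x : ℤ} (hx : ¬ (N : ℤ) ∣ x) :
    ∃ c : ℂ, IsIntegral ℤ c ∧ (1 - zet N ^ x) * c = N := by
  set ξ := zet N ^ x with hξ
  have h1 : ξ ≠ 1 := fun h => hx (zet_zpow_eq_one_iff_dvd N h)
  have hpow : ξ ^ N = 1 := by
    rw [hξ, ← zpow_natCast, ← zpow_mul, mul_comm, zpow_mul, zpow_natCast, zet_pow_natCast,
      one_zpow]
  have hgen : ∀ n : ℕ, (1 - ξ) * (∑ k ∈ Finset.range n, (k : ℂ) * ξ ^ k) + n * ξ ^ n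
      = ∑ k ∈ Finset.range n, ξ ^ (k + 1) := by
    intro n
    induction n with
    | zero => simp
    | succ n ih =>
      rw [Finset.sum_range_succ, Finset.sum_range_succ, ← ih]
      push_cast
      ring
  have hgeo : ∑ k ∈ Finset.range N, ξ ^ (k + 1) = 0 := by
    have h := mul_geom_sum ξ N
    rw [hpow, sub_self] at h
    have h' := (mul_eq_zero.1 h).resolve_left (sub_ne_zero.2 h1)
    simp_rw [pow_succ, ← Finset.sum_mul, h', zero_mul]
  refine ⟨-∑ k ∈ Finset.range N, (k : ℂ) * ξ ^ k, ?_, ?_⟩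
  · refine (IsIntegral.sum _ fun k _ => ?_).neg
    refine IsIntegral.mul ?_ ((isIntegral_zet_zpow N x).pow k)
    simpa using isIntegral_algebraMap (R := ℤ) (A := ℂ) (x := (k : ℤ))
  · have := hgen N
    rw [hgeo, hpow] at this
    linear_combination -this

theorem not_isIntegral_half_sum {x y z : ℤ} (hx : ¬ (N : ℤ) ∣ x) (hy : ¬ (N : ℤ) ∣ y)
    (hz : ¬ (N : ℤ) ∣ z) (hxyz : x + y + z = 0) :
    ¬ IsIntegral ℤ (((U N x + U N y + U N z) / 2 : ℝ) : ℂ) := by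
  intro hint
  obtain ⟨cx, hcx, ex⟩ := exists_isIntegral_one_sub_mul N hx
  obtain ⟨cy, hcy, ey⟩ := exists_isIntegral_one_sub_mul N hy
  obtain ⟨cz, hcz, ez⟩ := exists_isIntegral_one_sub_mul N hz
  have hU : ∀ n : ℤ, (zet N ^ (1 : ℤ) - zet N ^ (-1 : ℤ)) * (U N n : ℂ)
      = zet N ^ n - zet N ^ (-n) := by
    intro n
    have h : (Real.sin (phi N) : ℂ) ≠ 0 := by exact_mod_cast sin_phi_ne_zero N
    simp only [zet_zpow, U]
    push_cast
    push_cast at h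
    field_simp
    simp
    ring
  have h0 := zet_ne_zero N
  have hprod : (1 - zet N ^ x) * (1 - zet N ^ y) * (1 - zet N ^ z) =
      -((zet N ^ (1 : ℤ) - zet N ^ (-1 : ℤ)) * ((U N x + U N y + U N z : ℝ) : ℂ)) := by
    push_cast
    rw [mul_add, mul_add, hU, hU, hU]
    obtain rfl : z = -x - y := by omega
    have e1 : zet N ^ (-x - y) = (zet N ^ x)⁻¹ * (zet N ^ y)⁻¹ := by
      rw [zpow_sub₀ h0, zpow_neg]; rfl
    have e2 : zet N ^ (-(-x - y)) = zet N ^ x * zet N ^ y := by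
      rw [← zpow_add₀ h0]; congr 1; ring
    have hx0 := zpow_ne_zero x h0
    have hy0 := zpow_ne_zero y h0
    rw [e1, e2, zpow_neg, zpow_neg]
    field_simp
    ring
  set β := (((U N x + U N y + U N z) / 2 : ℝ) : ℂ) with hβ
  have hβ2 : ((U N x + U N y + U N z : ℝ) : ℂ) = 2 * β := by
    rw [hβ]; push_cast; ring
  have hfin : IsIntegral ℤ ((N : ℂ) ^ 3 / 2) := by
    have e : (N : ℂ) ^ 3 / 2 =
        -((zet N ^ (1 : ℤ) - zet N ^ (-1 : ℤ)) * β) * (cx * cy * cz) := by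
      rw [hβ2] at hprod
      have : (N : ℂ) ^ 3 = ((1 - zet N ^ x) * (1 - zet N ^ y) * (1 - zet N ^ z)) *
          (cx * cy * cz) := by
        rw [pow_three]
        nth_rewrite 1 [← ex]
        nth_rewrite 1 [← ey]
        rw [← ez]
        ring
      rw [this, hprod]
      ring
    rw [e]
    exact ((((isIntegral_zet_zpow N 1).sub (isIntegral_zet_zpow N (-1))).mul hint).neg).mul
      ((hcx.mul hcy).mul hcz)
  have hq : IsIntegral ℤ ((N : ℚ) ^ 3 / 2) := by
    refine (isIntegral_algebraMap_iff (A := ℚ) (B := ℂ) (algebraMap ℚ ℂ).injective).1 ?_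
    simpa using hfin
  obtain ⟨m, hm⟩ := IsIntegrallyClosed.isIntegral_iff.1 hq
  have h2 : (N : ℚ) ^ 3 = 2 * m := by
    have : ((m : ℤ) : ℚ) = (N : ℚ) ^ 3 / 2 := by simpa using hm
    rw [this]; ring
  have h3 : (N : ℤ) ^ 3 = 2 * m := by exact_mod_cast h2
  have hodd : Odd ((N : ℤ) ^ 3) := (by exact_mod_cast hN.odd : Odd (N : ℤ)).pow
  rw [h3] at hodd
  exact (Int.not_odd_iff_even.2 (even_two_mul m)) hodd

end

/-- The shift of a sequence by `k`. -/
def shift (k : ℤ) (η : ℤ → ℝ) : ℤ → ℝ := fun n => η (n + k)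

/-- The time reversal of a sequence. -/
def rev (η : ℤ → ℝ) : ℤ → ℝ := fun n => η (-n)

@[simp] theorem shift_apply (k : ℤ) (η : ℤ → ℝ) (n : ℤ) : shift k η n = η (n + k) := rfl

@[simp] theorem rev_apply (η : ℤ → ℝ) (n : ℤ) : rev η n = η (-n) := rfl

theorem shift_shift (k l : ℤ) (η : ℤ → ℝ) : shift k (shift l η) = shift (k + l) η := by
  ext n
  simp [add_assoc]

@[simp] theorem shift_zero (η : ℤ → ℝ) : shift 0 η = η := by
  ext n
  simp

theorem continuous_shift (k : ℤ) : Continuous (shift k) :=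
  continuous_pi fun n => continuous_apply (n + k)

theorem continuous_rev : Continuous rev :=
  continuous_pi fun n => continuous_apply (-n)

/-- Bounded sequences whose second differences (twisted by `tr N`) are integral. -/
def preX (N : ℕ) : Set (ℤ → ℝ) :=
  {η | (∀ n, |η n| ≤ 1 / 2) ∧ ∀ n, ∃ s : ℤ, η (n + 1) - tr N * η n + η (n - 1) = s}

/-- The symbolic space: sequences in `preX` in which the values `1 / 2` and `-1 / 2` do not both
occur in one residue class modulo `N`. -/
def X (N : ℕ) : Set (ℤ → ℝ) :=
  {η | η ∈ preX N ∧ ∀ m n : ℤ, (N : ℤ) ∣ n - m → η m - η n ≠ 1}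

/-- The deviation of a sequence from the homogeneous solution with the same initial values. -/
def dev (N : ℕ) (η : ℤ → ℝ) (n : ℤ) : ℝ := η n - (U N n * η 1 - U N (n - 1) * η 0)

/-- Periodicity. -/
def Per (p : ℤ) (η : ℤ → ℝ) : Prop := ∀ k, η (k + p) = η k

/-- Absence of periods which are multiples of `N`. -/
def Aper (N : ℕ) (η : ℤ → ℝ) : Prop := ∀ p : ℤ, 0 < p → (N : ℤ) ∣ p → ¬ Per p η

section

variable {N : ℕ} [hN : OddGtThree N]

theorem X_abs_le {η : ℤ → ℝ} (h : η ∈ X N) (n : ℤ) : |η n| ≤ 1 / 2 := h.1.1 n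

theorem X_le {η : ℤ → ℝ} (h : η ∈ X N) (n : ℤ) : η n ≤ 1 / 2 := (abs_le.1 (h.1.1 n)).2

theorem X_ge {η : ℤ → ℝ} (h : η ∈ X N) (n : ℤ) : -(1 / 2) ≤ η n := (abs_le.1 (h.1.1 n)).1

theorem shift_mem_X {η : ℤ → ℝ} (h : η ∈ X N) (k : ℤ) : shift k η ∈ X N := by
  refine ⟨⟨fun n => h.1.1 _, fun n => ?_⟩, fun m n hmn => h.2 _ _ (by simpa using hmn)⟩
  obtain ⟨s, hs⟩ := h.1.2 (n + k)
  refine ⟨s, ?_⟩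
  rw [← hs]
  simp only [shift_apply]
  rw [show n + 1 + k = n + k + 1 by ring, show n - 1 + k = n + k - 1 by ring]

theorem rev_mem_X {η : ℤ → ℝ} (h : η ∈ X N) : rev η ∈ X N := by
  refine ⟨⟨fun n => h.1.1 _, fun n => ?_⟩, fun m n hmn => h.2 _ _ ?_⟩
  · obtain ⟨s, hs⟩ := h.1.2 (-n)
    refine ⟨s, ?_⟩
    rw [← hs]
    simp only [rev_apply]
    rw [show -(n + 1) = -n - 1 by ring, show -(n - 1) = -n + 1 by ring]
    ring
  · rw [show -n - -m = -(n - m) by ring]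
    exact (dvd_neg).2 hmn

theorem dev_zero (η : ℤ → ℝ) : dev N η 0 = 0 := by
  have : U N (-1) = -1 := by rw [U_neg, U_one]
  simp [dev, U_zero, this]

theorem dev_one (η : ℤ → ℝ) : dev N η 1 = 0 := by
  simp [dev, U_zero, U_one]

theorem eq_dev (η : ℤ → ℝ) (n : ℤ) : η n = U N n * η 1 - U N (n - 1) * η 0 + dev N η n := by
  simp [dev]

theorem eq_dev_shift (η : ℤ → ℝ) (k n : ℤ) :
    η (k + n) = U N n * η (k + 1) - U N (n - 1) * η k + dev N (shift k η) n := by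
  have := eq_dev (N := N) (shift k η) n
  simp only [shift_apply, zero_add] at this
  rw [add_comm k n, add_comm k 1]
  exact this

theorem dev_rec (η : ℤ → ℝ) (n : ℤ) :
    dev N η (n + 1) = tr N * dev N η n - dev N η (n - 1) +
      (η (n + 1) - tr N * η n + η (n - 1)) := by
  have h1 := U_add_one N n
  have h2 := U_add_one N (n - 1)
  rw [sub_add_cancel] at h2
  unfold dev
  rw [h1, add_sub_cancel_right]
  linear_combination η 0 * h2

theorem abs_code_le {η : ℤ → ℝ} (h : η ∈ preX N) {n s : ℤ}
    (hs : η (n + 1) - tr N * η n + η (n - 1) = s) : s ∈ Finset.Icc (-2 : ℤ) 2 := by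
  have h1 := h.1 (n + 1)
  have h2 := h.1 n
  have h3 := h.1 (n - 1)
  have hb := abs_tr_lt N
  have h4 : |tr N * η n| ≤ 1 := by
    rw [abs_mul]
    nlinarith [abs_nonneg (tr N), abs_nonneg (η n)]
  rw [abs_le] at *
  have l : (-2 : ℝ) ≤ s := by rw [← hs]; linarith [h1.1, h3.1, h4.2]
  have u : (s : ℝ) ≤ 2 := by rw [← hs]; linarith [h1.2, h3.2, h4.1]
  rw [Finset.mem_Icc]
  exact ⟨by exact_mod_cast l, by exact_mod_cast u⟩

theorem finite_dev_preX (n : ℤ) : ((fun η => dev N η n) '' preX N).Finite := by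
  induction n using int_pair_induction with
  | h0 => exact (Set.finite_singleton (0 : ℝ)).subset (by rintro _ ⟨η, -, rfl⟩; simp [dev_zero])
  | h1 => exact (Set.finite_singleton (0 : ℝ)).subset (by rintro _ ⟨η, -, rfl⟩; simp [dev_one])
  | hs n h h' =>
    have hF : ((fun q : (ℝ × ℝ) × ℤ => tr N * q.1.2 - q.1.1 + q.2) ''
        ((((fun η => dev N η n) '' preX N) ×ˢ ((fun η => dev N η (n + 1)) '' preX N)) ×ˢ
          ((Finset.Icc (-2 : ℤ) 2 : Finset ℤ) : Set ℤ))).Finite :=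
      (((h.prod h').prod (Finset.finite_toSet _)).image _)
    refine hF.subset ?_
    rintro _ ⟨η, hη, rfl⟩
    obtain ⟨s, hs⟩ := hη.2 (n + 1)
    refine ⟨((dev N η n, dev N η (n + 1)), s), ⟨⟨⟨η, hη, rfl⟩, ⟨η, hη, rfl⟩⟩,
      abs_code_le hη hs⟩, ?_⟩
    have := dev_rec (N := N) η (n + 1)
    rw [hs, add_sub_cancel_right, add_assoc, one_add_one_eq_two] at this
    exact this.symm
  | hp n h h' =>
    have hF : ((fun q : (ℝ × ℝ) × ℤ => tr N * q.1.1 - q.1.2 + q.2) ''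
        ((((fun η => dev N η n) '' preX N) ×ˢ ((fun η => dev N η (n + 1)) '' preX N)) ×ˢ
          ((Finset.Icc (-2 : ℤ) 2 : Finset ℤ) : Set ℤ))).Finite :=
      (((h.prod h').prod (Finset.finite_toSet _)).image _)
    refine hF.subset ?_
    rintro _ ⟨η, hη, rfl⟩
    obtain ⟨s, hs⟩ := hη.2 n
    refine ⟨((dev N η n, dev N η (n + 1)), s), ⟨⟨⟨η, hη, rfl⟩, ⟨η, hη, rfl⟩⟩,
      abs_code_le hη hs⟩, ?_⟩
    have := dev_rec (N := N) η n
    rw [hs] at this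
    show tr N * dev N η n - dev N η (n + 1) + s = dev N η (n - 1)
    linarith

theorem finite_dev (n : ℤ) : ((fun η => dev N η n) '' X N).Finite :=
  (finite_dev_preX n).subset (Set.image_mono fun _ h => h.1)

theorem isIntegral_dev {η : ℤ → ℝ} (h : η ∈ X N) (n : ℤ) : IsIntegral ℤ (dev N η n : ℂ) := by
  induction n using int_pair_induction with
  | h0 => rw [dev_zero]; simpa using isIntegral_zero
  | h1 => rw [dev_one]; simpa using isIntegral_zero
  | hs n h1 h2 =>
    obtain ⟨s, hs⟩ := h.1.2 (n + 1)
    have := dev_rec (N := N) η (n + 1)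
    rw [hs, add_sub_cancel_right, add_assoc, one_add_one_eq_two] at this
    rw [this]
    push_cast
    refine (((isIntegral_tr N).mul h2).sub h1).add ?_
    simpa using isIntegral_algebraMap (R := ℤ) (A := ℂ) (x := s)
  | hp n h1 h2 =>
    obtain ⟨s, hs⟩ := h.1.2 n
    have := dev_rec (N := N) η n
    rw [hs] at this
    rw [show dev N η (n - 1) = tr N * dev N η n - dev N η (n + 1) + s by linarith]
    push_cast
    refine (((isIntegral_tr N).mul h1).sub h2).add ?_
    simpa using isIntegral_algebraMap (R := ℤ) (A := ℂ) (x := s)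

theorem U_of_dvd {p : ℤ} (hp : (N : ℤ) ∣ p) : U N p = 0 := (U_eq_zero_iff N p).2 hp

theorem U_sub_one_of_dvd {p : ℤ} (hp : (N : ℤ) ∣ p) : U N (p - 1) = -1 := by
  rw [show p - 1 = -1 + p by ring, U_add_of_dvd N hp, U_neg, U_one]

theorem U_add_one_of_dvd {p : ℤ} (hp : (N : ℤ) ∣ p) : U N (p + 1) = 1 := by
  rw [add_comm, U_add_of_dvd N hp, U_one]

theorem dev_of_dvd (η : ℤ → ℝ) {p : ℤ} (hp : (N : ℤ) ∣ p) : dev N η p = η p - η 0 := by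
  simp [dev, U_of_dvd hp, U_sub_one_of_dvd hp]

theorem dev_add_one_of_dvd (η : ℤ → ℝ) {p : ℤ} (hp : (N : ℤ) ∣ p) :
    dev N η (p + 1) = η (p + 1) - η 1 := by
  simp [dev, U_of_dvd hp, U_add_one_of_dvd hp]

theorem continuous_dev (n : ℤ) : Continuous fun η : ℤ → ℝ => dev N η n := by
  unfold dev
  fun_prop

theorem isClosed_preX : IsClosed (preX N) := by
  have : preX N = (⋂ n : ℤ, {η : ℤ → ℝ | |η n| ≤ 1 / 2}) ∩
      ⋂ n : ℤ, (fun η : ℤ → ℝ => η (n + 1) - tr N * η n + η (n - 1)) ⁻¹'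
        Set.range ((↑) : ℤ → ℝ) := by
    ext η
    simp [preX, eq_comm]
  rw [this]
  refine IsClosed.inter (isClosed_iInter fun n => ?_) (isClosed_iInter fun n => ?_)
  · exact isClosed_le (by fun_prop) continuous_const
  · exact Int.isClosedEmbedding_coe_real.isClosed_range.preimage (by fun_prop)

theorem isClosed_X : IsClosed (X N) := by
  have : X N = ⋂ m : ℤ, ⋂ n : ℤ, ⋂ _ : (N : ℤ) ∣ n - m,
      (preX N ∩ (fun η : ℤ → ℝ => dev N (shift m η) (n - m)) ⁻¹'
        (((fun η => dev N η (n - m)) '' preX N) \ {-1})) := by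
    ext η
    simp only [Set.mem_iInter, Set.mem_inter_iff, Set.mem_preimage, Set.mem_sdiff,
      Set.mem_singleton_iff]
    have hval : ∀ m n : ℤ, (N : ℤ) ∣ n - m → dev N (shift m η) (n - m) = η n - η m := by
      intro m n h
      rw [dev_of_dvd _ h]
      simp
    have hshift : ∀ m : ℤ, η ∈ preX N → shift m η ∈ preX N := by
      intro k h
      refine ⟨fun n => h.1 _, fun n => ?_⟩
      obtain ⟨s, hs⟩ := h.2 (n + k)
      refine ⟨s, ?_⟩
      rw [← hs]
      simp only [shift_apply]
      rw [show n + 1 + k = n + k + 1 by ring, show n - 1 + k = n + k - 1 by ring]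
    constructor
    · intro h m n hmn
      refine ⟨h.1, ⟨_, hshift m h.1, rfl⟩, ?_⟩
      rw [hval m n hmn]
      have := h.2 m n hmn
      intro h'
      apply this
      linarith
    · intro h
      refine ⟨(h 0 0 (by simp)).1, fun m n hmn => ?_⟩
      have := (h m n hmn).2.2
      rw [hval m n hmn] at this
      intro h'
      apply this
      linarith
  rw [this]
  refine isClosed_iInter fun m => isClosed_iInter fun n => isClosed_iInter fun _ => ?_
  refine isClosed_preX.inter ?_
  exact ((finite_dev_preX (n - m)).subset Set.sdiff_subset).isClosed.preimage
    ((continuous_dev (n - m)).comp (continuous_shift m))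

theorem isCompact_X : IsCompact (X N) := by
  have h : IsCompact (Set.pi Set.univ fun _ : ℤ => Set.Icc (-(1 / 2) : ℝ) (1 / 2)) :=
    isCompact_univ_pi fun _ => isCompact_Icc
  exact h.of_isClosed_subset isClosed_X fun η hη n _ => abs_le.1 (hη.1.1 n)

theorem exists_subseq {u : ℕ → ℤ → ℝ} (hu : ∀ m, u m ∈ X N) :
    ∃ η ∈ X N, ∃ φ : ℕ → ℕ, StrictMono φ ∧ Tendsto (u ∘ φ) atTop (𝓝 η) :=
  isCompact_X.tendsto_subseq hu

theorem dev_eventually_eq {η : ℤ → ℝ} (n : ℤ) :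
    ∀ᶠ η' in 𝓝[X N] η, dev N η' n = dev N η n := by
  have hF : (((fun η => dev N η n) '' X N) \ {dev N η n}).Finite :=
    (finite_dev n).subset Set.sdiff_subset
  have hopen : IsOpen ((fun η => dev N η n) ⁻¹' (((fun η => dev N η n) '' X N) \ {dev N η n})ᶜ) :=
    hF.isClosed.isOpen_compl.preimage (continuous_dev n)
  have hmem : η ∈ (fun η => dev N η n) ⁻¹' (((fun η => dev N η n) '' X N) \ {dev N η n})ᶜ := by
    simp
  filter_upwards [mem_nhdsWithin_of_mem_nhds (hopen.mem_nhds hmem), self_mem_nhdsWithin]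
    with η' h h'
  by_contra hne
  exact h ⟨⟨η', h', rfl⟩, hne⟩

/-- Two-dimensional determinism: coincidence at two consecutive places in the same residue
class propagates. -/
theorem determinism {η : ℤ → ℝ} (hη : η ∈ X N) {m n : ℤ} (hmn : (N : ℤ) ∣ n - m)
    (h0 : η m = η n) (h1 : η (m + 1) = η (n + 1)) (k : ℤ) : η (m + k) = η (n + k) := by
  have key : ∀ i : ℤ, (∃ s : ℤ, η (m + i) - η (n + i) = s) → η (m + i) = η (n + i) := by
    rintro i ⟨s, hs⟩
    have a1 := X_le hη (m + i)
    have a2 := X_ge hη (m + i)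
    have a3 := X_le hη (n + i)
    have a4 := X_ge hη (n + i)
    have d1 := hη.2 (m + i) (n + i) (by simpa using hmn)
    have d2 := hη.2 (n + i) (m + i) (by
      rw [show m + i - (n + i) = -(n - m) by ring]; exact dvd_neg.2 hmn)
    have u1 : (s : ℝ) ≤ 1 := by rw [← hs]; linarith
    have u2 : (-1 : ℝ) ≤ s := by rw [← hs]; linarith
    have u1' : s ≤ 1 := by exact_mod_cast u1
    have u2' : -1 ≤ s := by exact_mod_cast u2
    have : s = -1 ∨ s = 0 ∨ s = 1 := by omega
    rcases this with rfl | rfl | rfl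
    · exact absurd (by push_cast at hs; linarith) d2
    · push_cast at hs; linarith
    · exact absurd (by push_cast at hs; linarith) d1
  induction k using int_pair_induction with
  | h0 => simpa using h0
  | h1 => exact h1
  | hs k e e' =>
    apply key
    obtain ⟨s, hs⟩ := hη.1.2 (m + (k + 1))
    obtain ⟨t, ht⟩ := hη.1.2 (n + (k + 1))
    rw [e', show m + (k + 1) + 1 = m + (k + 2) by ring, show m + (k + 1) - 1 = m + k by ring]
      at hs
    rw [show n + (k + 1) + 1 = n + (k + 2) by ring, show n + (k + 1) - 1 = n + k by ring] at ht
    refine ⟨s - t, ?_⟩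
    push_cast
    rw [← hs, ← ht, e]
    ring
  | hp k e e' =>
    apply key
    obtain ⟨s, hs⟩ := hη.1.2 (m + k)
    obtain ⟨t, ht⟩ := hη.1.2 (n + k)
    rw [e, show m + k + 1 = m + (k + 1) by ring, show m + k - 1 = m + (k - 1) by ring, e'] at hs
    rw [show n + k + 1 = n + (k + 1) by ring, show n + k - 1 = n + (k - 1) by ring] at ht
    refine ⟨s - t, ?_⟩
    push_cast
    rw [← hs, ← ht]
    ring

theorem per_of_eq {η : ℤ → ℝ} (hη : η ∈ X N) {m n : ℤ} (hmn : (N : ℤ) ∣ n - m)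
    (h0 : η m = η n) (h1 : η (m + 1) = η (n + 1)) : Per (n - m) η := by
  intro k
  have := determinism hη hmn h0 h1 (k - m)
  rw [show m + (k - m) = k by ring, show n + (k - m) = k + (n - m) by ring] at this
  exact this.symm

theorem Per.mul {p : ℤ} {η : ℤ → ℝ} (h : Per p η) (k : ℤ) : Per (k * p) η := by
  intro n
  induction k using Int.induction_on with
  | zero => simp
  | succ i ih => rw [← ih, add_mul, one_mul, ← add_assoc, h]
  | pred i ih => rw [← ih, sub_mul, one_mul, ← h]; congr 1; ring

theorem Per.of_dvd {p q : ℤ} {η : ℤ → ℝ} (h : Per p η) (hpq : p ∣ q) : Per q η := by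
  obtain ⟨c, rfl⟩ := hpq
  rw [mul_comm]
  exact h.mul c

theorem per_shift_iff {p : ℤ} {η : ℤ → ℝ} (k : ℤ) : Per p (shift k η) ↔ Per p η := by
  constructor
  · intro h n
    have := h (n - k)
    simp only [shift_apply] at this
    rw [show n - k + p + k = n + p by ring, sub_add_cancel] at this
    exact this
  · intro h n
    simp only [shift_apply]
    rw [← h (n + k)]
    congr 1
    ring

theorem aper_shift_iff {η : ℤ → ℝ} (k : ℤ) : Aper N (shift k η) ↔ Aper N η := by
  simp [Aper, per_shift_iff]

theorem per_iff_dev {η : ℤ → ℝ} (hη : η ∈ X N) {p : ℤ} (hp : (N : ℤ) ∣ p) :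
    Per p η ↔ dev N η p = 0 ∧ dev N η (p + 1) = 0 := by
  rw [dev_of_dvd η hp, dev_add_one_of_dvd η hp, sub_eq_zero, sub_eq_zero]
  constructor
  · intro h
    refine ⟨by simpa using h 0, ?_⟩
    rw [add_comm]
    exact h 1
  · rintro ⟨h0, h1⟩
    have := per_of_eq hη (m := 0) (n := p) (by simpa using hp) h0.symm (by simpa using h1.symm)
    simpa using this

theorem per_eventually_iff {η : ℤ → ℝ} (hη : η ∈ X N) {p : ℤ} (hp : (N : ℤ) ∣ p) :
    ∀ᶠ η' in 𝓝[X N] η, (Per p η' ↔ Per p η) := by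
  filter_upwards [dev_eventually_eq (N := N) (η := η) p,
    dev_eventually_eq (N := N) (η := η) (p + 1), self_mem_nhdsWithin] with η' h1 h2 h3
  rw [per_iff_dev h3 hp, per_iff_dev hη hp, h1, h2]

/-- The aperiodic part of the symbolic space. -/
def Xinf (N : ℕ) : Set (ℤ → ℝ) := {η | η ∈ X N ∧ Aper N η}

theorem isClosed_Xinf : IsClosed (Xinf N) := by
  rw [← isSeqClosed_iff_isClosed]
  intro u η hu hlim
  have hη : η ∈ X N := isClosed_X.mem_of_tendsto hlim (Eventually.of_forall fun m => (hu m).1)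
  refine ⟨hη, fun p hp hd hper => ?_⟩
  have hlim' : Tendsto u atTop (𝓝[X N] η) :=
    tendsto_nhdsWithin_iff.2 ⟨hlim, Eventually.of_forall fun m => (hu m).1⟩
  obtain ⟨m, hm⟩ := (hlim'.eventually (per_eventually_iff hη hd)).exists
  exact (hu m).2 p hp hd (hm.2 hper)

theorem isCompact_Xinf : IsCompact (Xinf N) :=
  isCompact_X.of_isClosed_subset isClosed_Xinf fun _ h => h.1

theorem isIntegral_combination {η : ℤ → ℝ} (hη : η ∈ X N) (k i j : ℤ) :
    IsIntegral ℤ ((U N j * η (k + i) - U N i * η (k + j) + U N (i - j) * η k : ℝ) : ℂ) := by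
  have h1 := eq_dev_shift (N := N) η k i
  have h2 := eq_dev_shift (N := N) η k j
  have h3 := U_mul_sub N i j
  have : U N j * η (k + i) - U N i * η (k + j) + U N (i - j) * η k =
      U N j * dev N (shift k η) i - U N i * dev N (shift k η) j := by
    rw [h1, h2]
    linear_combination (-η k) * h3
  rw [this]
  push_cast
  exact ((isIntegral_U N j).mul (isIntegral_dev (shift_mem_X hη k) i)).sub
    ((isIntegral_U N i).mul (isIntegral_dev (shift_mem_X hη k) j))

/-- The value `±1 / 2` cannot occur in three different residue classes. -/
theorem not_three_hits {η : ℤ → ℝ} (hη : η ∈ X N) {k i j : ℤ} (hi : ¬ (N : ℤ) ∣ i - k)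
    (hj : ¬ (N : ℤ) ∣ j - k) (hij : ¬ (N : ℤ) ∣ i - j) (h0 : |η k| = 1 / 2) (h1 : |η i| = 1 / 2)
    (h2 : |η j| = 1 / 2) : False := by
  have hint := isIntegral_combination hη k (i - k) (j - k)
  rw [add_sub_cancel, add_sub_cancel, show i - k - (j - k) = i - j by ring] at hint
  refine not_isIntegral_half_sum N (x := j - k) (y := -(i - k)) (z := i - j) hj
    (by rwa [dvd_neg]) hij (by ring) ?_
  have hU : ∀ n : ℤ, ∀ t : ℝ, |t| = 1 / 2 → ∃ c : ℝ, (c = 0 ∨ c = U N n) ∧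
      U N n * t = U N n / 2 - c := by
    intro n t ht
    rcases eq_or_eq_neg_of_abs_eq ht with rfl | rfl
    · exact ⟨0, Or.inl rfl, by ring⟩
    · exact ⟨U N n, Or.inr rfl, by ring⟩
  have hc : ∀ (n : ℤ) (c : ℝ), (c = 0 ∨ c = U N n) → IsIntegral ℤ (c : ℂ) := by
    rintro n c (rfl | rfl)
    · simpa using isIntegral_zero
    · exact isIntegral_U N n
  obtain ⟨c1, hc1, e1⟩ := hU (j - k) _ h1
  obtain ⟨c2, hc2, e2⟩ := hU (-(i - k)) _ h2
  obtain ⟨c3, hc3, e3⟩ := hU (i - j) _ h0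
  have : (U N (j - k) + U N (-(i - k)) + U N (i - j)) / 2 =
      (U N (j - k) * η i - U N (i - k) * η j + U N (i - j) * η k) + c1 + c2 + c3 := by
    rw [U_neg] at e2 ⊢
    linear_combination -e1 - e2 - e3
  rw [this]
  push_cast at hint ⊢
  exact ((hint.add (hc _ _ hc1)).add (hc _ _ hc2)).add (hc _ _ hc3)

end

section

variable {N : ℕ} [hN : OddGtThree N]

/-- `i` is a return: the residue class and the value are those at time `0`. -/
def Ret (N : ℕ) (η : ℤ → ℝ) (i : ℤ) : Prop := (N : ℤ) ∣ i ∧ η i = η 0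

theorem ret_zero (η : ℤ → ℝ) : Ret N η 0 := ⟨dvd_zero _, rfl⟩

theorem ret_rev {η : ℤ → ℝ} {i : ℤ} : Ret N (rev η) i ↔ Ret N η (-i) := by
  simp [Ret]

theorem ret_shift {η : ℤ → ℝ} {k i : ℤ} (hk : Ret N η k) :
    Ret N (shift k η) i ↔ Ret N η (i + k) := by
  simp [Ret, hk.2, Int.dvd_add_left hk.1]

theorem exists_greatest_lt {P : ℤ → Prop} {a b : ℤ} (hab : a < b) (ha : P a) :
    ∃ m, a ≤ m ∧ m < b ∧ P m ∧ ∀ i, i < b → P i → i ≤ m := by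
  obtain ⟨m, hm, hmax⟩ := Int.exists_greatest_of_bdd (P := fun i => i < b ∧ P i)
    ⟨b, fun z hz => hz.1.le⟩ ⟨a, hab, ha⟩
  exact ⟨m, hmax a ⟨hab, ha⟩, hm.1, hm.2, fun i h h' => hmax i ⟨h, h'⟩⟩

theorem exists_least_gt {P : ℤ → Prop} {a b : ℤ} (hab : a < b) (hb : P b) :
    ∃ m, a < m ∧ m ≤ b ∧ P m ∧ ∀ i, a < i → P i → m ≤ i := by
  obtain ⟨m, hm, hmin⟩ := Int.exists_least_of_bdd (P := fun i => a < i ∧ P i)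
    ⟨a, fun z hz => hz.1.le⟩ ⟨b, hab, hb⟩
  exact ⟨m, hm.1, hmin b ⟨hab, hb⟩, hm.2, fun i h h' => hmin i ⟨h, h'⟩⟩

/-- A direction in which all extremal values outside the residue class of `0` move inward. -/
theorem exists_inward_direction {η : ℤ → ℝ} (hη : η ∈ X N) (h0 : |η 0| = 1 / 2) :
    ∃ e : ℝ, (e = 1 ∨ e = -1) ∧
      ∀ i : ℤ, ¬ (N : ℤ) ∣ i → |η i| = 1 / 2 → e * U N i * η i < 0 := by
  by_cases h : ∃ j : ℤ, ¬ (N : ℤ) ∣ j ∧ |η j| = 1 / 2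
  · obtain ⟨j, hj, hj'⟩ := h
    have hsame : ∀ i : ℤ, ¬ (N : ℤ) ∣ i → |η i| = 1 / 2 → U N i = U N j ∧ η i = η j := by
      intro i hi hi'
      have hd : (N : ℤ) ∣ i - j := by
        by_contra hd
        exact not_three_hits hη (k := 0) (by simpa using hi) (by simpa using hj) hd h0 hi' hj'
      refine ⟨?_, ?_⟩
      · have := U_add_of_dvd N hd j
        rw [add_sub_cancel] at this
        exact this
      · have d1 := hη.2 j i hd
        have d2 := hη.2 i j (by rw [← neg_sub]; exact dvd_neg.2 hd)
        rcases eq_or_eq_neg_of_abs_eq hi' with e | e <;>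
          rcases eq_or_eq_neg_of_abs_eq hj' with e' | e'
        · rw [e, e']
        · exact absurd (by rw [e, e']; norm_num) d2
        · exact absurd (by rw [e, e']; norm_num) d1
        · rw [e, e']
    have hne : U N j * η j ≠ 0 := by
      refine mul_ne_zero (fun h => hj ((U_eq_zero_iff N j).1 h)) fun h => ?_
      rw [h] at hj'
      norm_num at hj'
    rcases lt_or_gt_of_ne hne with hlt | hgt
    · refine ⟨1, Or.inl rfl, fun i hi hi' => ?_⟩
      rw [(hsame i hi hi').1, (hsame i hi hi').2]
      linarith
    · refine ⟨-1, Or.inr rfl, fun i hi hi' => ?_⟩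
      rw [(hsame i hi hi').1, (hsame i hi hi').2]
      linarith
  · push Not at h
    exact ⟨1, Or.inl rfl, fun i hi hi' => absurd hi' (h i hi)⟩

theorem exists_next_return {η : ℤ → ℝ} {L : ℤ}
    (hback : ∀ i, i ≤ 0 → Ret N η i → ∃ i', i - L ≤ i' ∧ i' < i ∧ Ret N η i')
    {n : ℤ} (hn : n < 0) : ∃ n', n < n' ∧ n' ≤ 0 ∧ Ret N η n' ∧ (Ret N η n → n' ≤ n + L) := by
  obtain ⟨m, h1, h2, h3, h4⟩ := exists_least_gt hn (ret_zero (N := N) η)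
  refine ⟨m, h1, h2, h3, fun h => ?_⟩
  obtain ⟨i, hi1, hi2, hi3⟩ := hback m h2 h3
  by_contra hlt
  have := h4 i (by omega) hi3
  omega

/-- Perturbations of the orbit in the direction `e`, started at two different returns, never
meet. -/
theorem perturbation_ne {η : ℤ → ℝ} (hη : η ∈ X N) {L : ℤ}
    (hback : ∀ i, i ≤ 0 → Ret N η i → ∃ i', i - L ≤ i' ∧ i' < i ∧ Ret N η i')
    (hno : ∀ i, 0 < i → i ≤ L → ¬ Ret N η i) {k l : ℤ} (hkl : k < l) (hl : l ≤ 0)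
    (hk' : Ret N η k) (hl' : Ret N η l) {d d' : ℝ}
    (hd : ∀ i, k ≤ i → i ≤ L → ¬ (N : ℤ) ∣ i → |η i + d * U N i| < 1 / 2)
    (hd' : ∀ i, l ≤ i → i ≤ L → ¬ (N : ℤ) ∣ i → |η i + d' * U N i| < 1 / 2) :
    η (k + 1) + d ≠ η (l + 1) + d' := by
  intro heq
  have hUk : ∀ n : ℤ, U N (k + n) = U N n := fun n => by rw [add_comm, U_add_of_dvd N hk'.1]
  have hUl : ∀ n : ℤ, U N (l + n) = U N n := fun n => by rw [add_comm, U_add_of_dvd N hl'.1]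
  have key : ∀ i : ℕ, (l + i ≤ L →
      η (k + i) + d * U N (k + i) = η (l + i) + d' * U N (l + i)) ∧
      (l + (i + 1) ≤ L →
      η (k + (i + 1)) + d * U N (k + (i + 1)) = η (l + (i + 1)) + d' * U N (l + (i + 1))) := by
    intro i
    induction i with
    | zero =>
      refine ⟨fun _ => ?_, fun _ => ?_⟩
      · simp [U_of_dvd hk'.1, U_of_dvd hl'.1, hk'.2, hl'.2]
      · simpa [U_add_one_of_dvd hk'.1, U_add_one_of_dvd hl'.1] using heq
    | succ i ih =>
      push_cast
      refine ⟨ih.2, fun hi => ?_⟩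
      have e1 := ih.1 (by omega)
      have e2 := ih.2 (by omega)
      obtain ⟨s, hs⟩ := hη.1.2 (k + (i + 1))
      obtain ⟨t, ht⟩ := hη.1.2 (l + (i + 1))
      rw [show k + ((i : ℤ) + 1) + 1 = k + (i + 1 + 1) by ring,
        show k + ((i : ℤ) + 1) - 1 = k + i by ring] at hs
      rw [show l + ((i : ℤ) + 1) + 1 = l + (i + 1 + 1) by ring,
        show l + ((i : ℤ) + 1) - 1 = l + i by ring] at ht
      have u := U_add_one N ((i : ℤ) + 1)
      rw [add_sub_cancel_right] at u
      rw [hUk, hUl] at e1 e2 ⊢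
      have hdiff : (η (k + (i + 1 + 1)) + d * U N (i + 1 + 1)) -
          (η (l + (i + 1 + 1)) + d' * U N (i + 1 + 1)) = (s - t : ℤ) := by
        push_cast
        rw [← hs, ← ht, u]
        linear_combination tr N * e2 - e1
      by_cases hdiv : (N : ℤ) ∣ (i : ℤ) + 1 + 1
      · rw [U_of_dvd hdiv] at hdiff ⊢
        simp only [mul_zero, add_zero] at hdiff ⊢
        have hmem : (N : ℤ) ∣ (l + (i + 1 + 1)) - (k + (i + 1 + 1)) := by
          rw [add_sub_add_right_eq_sub]
          exact dvd_sub hl'.1 hk'.1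
        have n1 := hη.2 (k + (i + 1 + 1)) (l + (i + 1 + 1)) hmem
        have n2 := hη.2 (l + (i + 1 + 1)) (k + (i + 1 + 1))
          (by rw [← neg_sub]; exact dvd_neg.2 hmem)
        have a1 := X_le hη (k + (i + 1 + 1))
        have a2 := X_ge hη (k + (i + 1 + 1))
        have a3 := X_le hη (l + (i + 1 + 1))
        have a4 := X_ge hη (l + (i + 1 + 1))
        have u1 : ((s - t : ℤ) : ℝ) ≤ 1 := by rw [← hdiff]; linarith
        have u2 : ((-1 : ℤ) : ℝ) ≤ ((s - t : ℤ) : ℝ) := by rw [← hdiff]; push_cast; linarith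
        have u1' : s - t ≤ 1 := by exact_mod_cast u1
        have u2' : -1 ≤ s - t := by exact_mod_cast u2
        have : s - t = -1 ∨ s - t = 0 ∨ s - t = 1 := by omega
        rcases this with h | h | h <;> rw [h] at hdiff <;> push_cast at hdiff
        · exact absurd (by linarith) n2
        · linarith
        · exact absurd hdiff n1
      · have b1 := abs_lt.1 (hd (k + (i + 1 + 1)) (by omega) (by omega)
          (by rwa [Int.dvd_add_right hk'.1]))
        have b2 := abs_lt.1 (hd' (l + (i + 1 + 1)) (by omega) (by omega)
          (by rwa [Int.dvd_add_right hl'.1]))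
        rw [hUk] at b1
        rw [hUl] at b2
        have u1 : ((s - t : ℤ) : ℝ) < (1 : ℤ) := by rw [← hdiff]; push_cast; linarith
        have u2 : ((-1 : ℤ) : ℝ) < ((s - t : ℤ) : ℝ) := by rw [← hdiff]; push_cast; linarith
        have u1' : s - t < 1 := by exact_mod_cast u1
        have u2' : -1 < s - t := by exact_mod_cast u2
        have : s - t = 0 := by omega
        rw [this] at hdiff
        push_cast at hdiff
        linarith
  have key' : ∀ i : ℤ, 0 ≤ i → i ≤ L → (N : ℤ) ∣ i → η (k - l + i) = η i := by
    intro i hi hi' hdi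
    have h := (key (i - l).toNat).1
    rw [Int.toNat_of_nonneg (by omega)] at h
    have h2 := h (by omega)
    rw [U_of_dvd (by rw [Int.dvd_add_right hk'.1]; exact dvd_sub hdi hl'.1),
      U_of_dvd (by rw [Int.dvd_add_right hl'.1]; exact dvd_sub hdi hl'.1)] at h2
    rw [show k + (i - l) = k - l + i by ring, show l + (i - l) = i by ring] at h2
    linarith
  by_cases hL : 0 ≤ L
  · have hm : Ret N η (k - l) := by
      refine ⟨dvd_sub hk'.1 hl'.1, ?_⟩
      have := key' 0 le_rfl hL (dvd_zero _)
      rwa [add_zero] at this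
    obtain ⟨m, h1, h2, h3, h4⟩ := exists_next_return hback (n := k - l) (by omega)
    have h5 := h4 hm
    have hdv : (N : ℤ) ∣ m - (k - l) := dvd_sub h3.1 hm.1
    refine hno (m - (k - l)) (by omega) (by omega) ⟨hdv, ?_⟩
    rw [← key' (m - (k - l)) (by omega) (by omega) hdv]
    rw [add_sub_cancel]
    exact h3.2
  · obtain ⟨i, hi1, hi2, -⟩ := hback 0 le_rfl (ret_zero η)
    omega

/-- If the returns of an extremal value are syndetic in the past, there is one more return. -/
theorem exists_return_of_past {η : ℤ → ℝ} (hη : η ∈ X N) (h0 : |η 0| = 1 / 2) {L : ℤ}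
    (hback : ∀ i, i ≤ 0 → Ret N η i → ∃ i', i - L ≤ i' ∧ i' < i ∧ Ret N η i') :
    ∃ i, 0 < i ∧ i ≤ L ∧ Ret N η i := by
  by_contra hcon
  have hno : ∀ i, 0 < i → i ≤ L → ¬ Ret N η i := fun i h1 h2 h3 => hcon ⟨i, h1, h2, h3⟩
  clear hcon
  have hL : 0 < L := by
    obtain ⟨i, hi1, hi2, -⟩ := hback 0 le_rfl (ret_zero η)
    omega
  obtain ⟨e, he, hin⟩ := exists_inward_direction hη h0
  have hee : e * e = 1 := by rcases he with rfl | rfl <;> norm_num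
  set β : ℤ → ℝ := fun i => 1 / (2 * |U N i|) - η i / (e * U N i) with hβ
  have hUne : ∀ i : ℤ, ¬ (N : ℤ) ∣ i → U N i ≠ 0 := fun i hi h => hi ((U_eq_zero_iff N i).1 h)
  have hβpos : ∀ i : ℤ, ¬ (N : ℤ) ∣ i → 0 < β i ∧
      ∀ d, 0 < d → d < β i → |η i + e * d * U N i| < 1 / 2 := by
    intro i hi
    have hU := hUne i hi
    have a1 := X_le hη i
    have a2 := X_ge hη i
    have hneU : e * U N i ≠ 0 := mul_ne_zero (by rintro rfl; norm_num at hee) hU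
    have habs : |U N i| = |e * U N i| := by
      rcases he with rfl | rfl <;> simp
    have hin' := hin i hi
    have hb : β i = 1 / (2 * |e * U N i|) - η i / (e * U N i) := by rw [hβ, ← habs]
    have comm : ∀ d, e * d * U N i = d * (e * U N i) := fun d => by ring
    simp only [comm]
    rw [hb]
    generalize e * U N i = w at *
    rcases lt_or_gt_of_ne hneU with hw | hw
    · rw [abs_of_neg hw]
      have e1 : 1 / (2 * -w) - η i / w = (1 / 2 + η i) / (-w) := by field_simp; ring
      rw [e1]
      have hne : -(1 / 2) < η i := by
        rcases lt_or_eq_of_le a2 with h | h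
        · exact h
        · have := hin' (by rw [← h]; norm_num [abs_of_pos])
          rw [← h] at this
          nlinarith
      refine ⟨div_pos (by linarith) (by linarith), fun d hd1 hd2 => ?_⟩
      rw [lt_div_iff₀ (by linarith)] at hd2
      rw [abs_lt]
      constructor <;> nlinarith
    · rw [abs_of_pos hw]
      have e1 : 1 / (2 * w) - η i / w = (1 / 2 - η i) / w := by field_simp
      rw [e1]
      have hne : η i < 1 / 2 := by
        rcases lt_or_eq_of_le a1 with h | h
        · exact h
        · have := hin' (by rw [h]; norm_num [abs_of_pos])
          rw [h] at this
          nlinarith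
      refine ⟨div_pos (by linarith) hw, fun d hd1 hd2 => ?_⟩
      rw [lt_div_iff₀ hw] at hd2
      rw [abs_lt]
      constructor <;> nlinarith
  have hN3 := hN.gt
  have hmin : ∀ n : ℤ, ∃ δ : ℝ, (Ret N η n ∧ n ≤ 0) → 0 < δ ∧
      (∀ i, n ≤ i → i ≤ L → ¬ (N : ℤ) ∣ i → δ ≤ β i) ∧
      ∃ i, n ≤ i ∧ i ≤ L ∧ ¬ (N : ℤ) ∣ i ∧ δ = β i := by
    intro n
    by_cases hn : Ret N η n ∧ n ≤ 0
    · have hne : ((Finset.Icc n L).filter fun i => ¬ (N : ℤ) ∣ i).Nonempty := by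
        refine ⟨n + 1, ?_⟩
        rw [Finset.mem_filter, Finset.mem_Icc]
        refine ⟨⟨by omega, by omega⟩, fun h => ?_⟩
        have := (Int.dvd_add_right hn.1.1).1 h
        have := Int.le_of_dvd one_pos this
        omega
      obtain ⟨i, hi, himin⟩ := Finset.exists_min_image _ β hne
      rw [Finset.mem_filter, Finset.mem_Icc] at hi
      refine ⟨β i, fun _ => ⟨(hβpos i hi.2).1, fun j h1 h2 h3 => himin j ?_,
        i, hi.1.1, hi.1.2, hi.2, rfl⟩⟩
      rw [Finset.mem_filter, Finset.mem_Icc]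
      exact ⟨⟨h1, h2⟩, h3⟩
    · exact ⟨0, fun h => absurd h hn⟩
  choose δ hδ using hmin
  set R : Set ℤ := {n | Ret N η n ∧ n ≤ 0} with hR
  have hRinf : ∀ a : ℤ, ∃ n ∈ R, n < a := by
    intro a
    by_contra hcon
    push Not at hcon
    obtain ⟨m, hm, hmin⟩ := Int.exists_least_of_bdd (P := fun i => i ∈ R)
      ⟨a, fun z hz => hcon z hz⟩ ⟨0, ret_zero η, le_rfl⟩
    obtain ⟨i, hi1, hi2, hi3⟩ := hback m hm.2 hm.1
    have := hmin i ⟨hi3, by have := hm.2; omega⟩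
    omega
  have hRinfinite : R.Infinite := by
    intro hfin
    obtain ⟨b, hb⟩ := hfin.bddBelow
    obtain ⟨n, hn, hlt⟩ := hRinf b
    have := hb hn
    omega
  have hdisj : ∀ k ∈ R, ∀ l ∈ R, k < l → ∀ d d' : ℝ, 0 < d → d < δ k → 0 < d' → d' < δ l →
      η (k + 1) + e * d ≠ η (l + 1) + e * d' := by
    intro k hk l hl hkl d d' h1 h2 h3 h4
    refine perturbation_ne hη hback hno hkl hl.2 hk.1 hl.1 ?_ ?_
    · intro i hi hi' hd
      exact (hβpos i hd).2 d h1 (h2.trans_le ((hδ k hk).2.1 i hi hi' hd))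
    · intro i hi hi' hd
      exact (hβpos i hd).2 d' h3 (h4.trans_le ((hδ l hl).2.1 i hi hi' hd))
  by_cases hcase : ∃ δ0 > 0, ∀ n ∈ R, δ0 ≤ δ n
  · obtain ⟨δ0, hδ0, hδ0'⟩ := hcase
    have hmaps : Set.MapsTo (fun n : ℤ => ⌊(2 / δ0) * η (n + 1)⌋) R
        (Set.Icc (⌊(2 / δ0) * (-(1 / 2))⌋) ⌊(2 / δ0) * (1 / 2)⌋) := by
      intro n _
      have hp : 0 ≤ 2 / δ0 := by positivity
      exact ⟨Int.floor_le_floor (mul_le_mul_of_nonneg_left (X_ge hη _) hp),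
        Int.floor_le_floor (mul_le_mul_of_nonneg_left (X_le hη _) hp)⟩
    obtain ⟨k, hk, l, hl, hne, hfl⟩ :=
      hRinfinite.exists_ne_map_eq_of_mapsTo hmaps (Set.finite_Icc _ _)
    wlog hkl : k < l generalizing k l
    · exact this l hl k hk hne.symm hfl.symm (by omega)
    have hab : |η (k + 1) - η (l + 1)| < δ0 / 2 := by
      have := Int.abs_sub_lt_one_of_floor_eq_floor hfl
      rw [← mul_sub, abs_mul, abs_of_pos (by positivity : (0 : ℝ) < 2 / δ0)] at this
      rw [div_mul_eq_mul_div, div_lt_one hδ0] at this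
      linarith
    have hk2 := hδ0' k hk
    have hl2 := hδ0' l hl
    rw [abs_lt] at hab
    set t := e * (η (k + 1) - η (l + 1)) with ht
    have ht' : η (k + 1) - η (l + 1) = e * t := by
      rw [ht, ← mul_assoc, hee, one_mul]
    have htb : -(δ0 / 2) < t ∧ t < δ0 / 2 := by
      rcases he with rfl | rfl
      · constructor <;> linarith
      · constructor <;> linarith
    refine hdisj k hk l hl hkl (δ0 / 2 - t / 2) (δ0 / 2 + t / 2) ?_ ?_ ?_ ?_ ?_
    · linarith
    · linarith
    · linarith
    · linarith
    · linear_combination ht'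
  · push Not at hcase
    set R' : Set ℤ := {n | n ∈ R ∧ ∃ m : ℤ, m ∈ Set.Icc 0 L ∧ ¬ (N : ℤ) ∣ m ∧ δ n = β (n + m)}
      with hR'
    have hR'inf : R'.Infinite := by
      intro hfin
      obtain ⟨r, hr, hrmin⟩ := Set.exists_min_image (insert 0 R') δ (hfin.insert 0)
        (Set.insert_nonempty 0 R')
      have hrR : r ∈ R := by
        rcases hr with rfl | hr
        · exact ⟨ret_zero η, le_rfl⟩
        · exact hr.1
      obtain ⟨n0, hn0, hn0'⟩ := hcase (δ r) (hδ r hrR).1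
      obtain ⟨n, hn, hnmax⟩ := Int.exists_greatest_of_bdd (P := fun i => i ∈ R ∧ δ i < δ r)
        ⟨0, fun z hz => hz.1.2⟩ ⟨n0, hn0, hn0'⟩
      have hnneg : n < 0 := by
        rcases lt_or_eq_of_le hn.1.2 with h | h
        · exact h
        · have := hrmin 0 (Set.mem_insert 0 R')
          rw [h] at hn
          linarith [hn.2]
      obtain ⟨n', h1, h2, h3, h4⟩ := exists_next_return hback hnneg
      have h5 := h4 hn.1.1
      have hn'R : n' ∈ R := ⟨h3, h2⟩
      have hge : δ r ≤ δ n' := by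
        by_contra hlt
        have := hnmax n' ⟨hn'R, not_le.1 hlt⟩
        omega
      obtain ⟨i, hi1, hi2, hi3, hi4⟩ := (hδ n hn.1).2.2
      have hi5 : i < n' := by
        by_contra hlt
        have := (hδ n' hn'R).2.1 i (by omega) hi2 hi3
        linarith [hn.2]
      have hnR' : n ∈ R' := by
        refine ⟨hn.1, i - n, ⟨by omega, by omega⟩, fun h => hi3 ?_,
          by rw [add_sub_cancel]; exact hi4⟩
        have := dvd_add h hn.1.1.1
        rwa [sub_add_cancel] at this
      have := hrmin n (Set.mem_insert_of_mem _ hnR')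
      linarith [hn.2]
    have hfinT : (⋃ m ∈ Set.Icc (0 : ℤ) L, (fun v : ℝ => e / (2 * |U N m|) +
        (U N (m - 1) * η 0 - v) / U N m) '' ((fun ξ => dev N ξ m) '' X N)).Finite :=
      (Set.finite_Icc (0 : ℤ) L).biUnion fun m _ => (finite_dev m).image _
    have hmaps : Set.MapsTo (fun n : ℤ => η (n + 1) + e * δ n) R'
        (⋃ m ∈ Set.Icc (0 : ℤ) L, (fun v : ℝ => e / (2 * |U N m|) +
        (U N (m - 1) * η 0 - v) / U N m) '' ((fun ξ => dev N ξ m) '' X N)) := by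
      rintro n ⟨hn, m, hm, hmd, hδm⟩
      simp only [Set.mem_iUnion]
      refine ⟨m, hm, dev N (shift n η) m, ⟨_, shift_mem_X hη n, rfl⟩, ?_⟩
      have hU := hUne m hmd
      have hUn : U N (n + m) = U N m := by rw [add_comm, U_add_of_dvd N hn.1.1]
      have h1 := eq_dev_shift (N := N) η n m
      rw [hn.1.2] at h1
      have habs : |U N m| ≠ 0 := abs_ne_zero.2 hU
      have hβe : e * β (n + m) = e / (2 * |U N m|) - η (n + m) / U N m := by
        have hene : e ≠ 0 := by rintro rfl; norm_num at hee
        rw [hβ]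
        simp only
        rw [hUn]
        field_simp
      rw [hδm, hβe, h1]
      field_simp
      ring
    obtain ⟨k, hk, l, hl, hne, hfl⟩ := hR'inf.exists_ne_map_eq_of_mapsTo hmaps hfinT
    wlog hkl : k < l generalizing k l
    · exact this l hl k hk hne.symm hfl.symm (by omega)
    have hk2 := (hδ k hk.1).1
    have hl2 := (hδ l hl.1).1
    set s := min (δ k) (δ l) / 2 with hs
    have hs0 : 0 < s := by positivity
    have hs1 : s < δ k := by
      have := min_le_left (δ k) (δ l)
      have : 0 < min (δ k) (δ l) := lt_min hk2 hl2
      rw [hs]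
      linarith
    have hs2 : s < δ l := by
      have := min_le_right (δ k) (δ l)
      have : 0 < min (δ k) (δ l) := lt_min hk2 hl2
      rw [hs]
      linarith
    refine hdisj k hk.1 l hl.1 hkl (δ k - s) (δ l - s) (by linarith) (by linarith) (by linarith)
      (by linarith) ?_
    linear_combination hfl

/-- Returns occur in every window of length `L`. -/
def Rec (N : ℕ) (L : ℤ) (η : ℤ → ℝ) : Prop := ∀ k : ℤ, ∃ i, k < i ∧ i ≤ k + L ∧ Ret N η i

/-- Every return in the future is followed by another one within `L`. -/
def FwdRec (N : ℕ) (L : ℤ) (η : ℤ → ℝ) : Prop :=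
  ∀ i, 0 ≤ i → Ret N η i → ∃ i', i < i' ∧ i' ≤ i + L ∧ Ret N η i'

theorem Rec.rev {L : ℤ} {η : ℤ → ℝ} (h : Rec N L η) : Rec N L (rev η) := by
  intro k
  obtain ⟨i, h1, h2, h3⟩ := h (-k - L - 1)
  exact ⟨-i, by omega, by omega, by rwa [ret_rev, neg_neg]⟩

theorem rec_of_fwdRec {L : ℤ} {η : ℤ → ℝ} (h : FwdRec N L η) (h' : FwdRec N L (rev η)) :
    Rec N L η := by
  intro k
  rcases le_or_gt 0 k with hk | hk
  · obtain ⟨m, h1, h2, h3, h4⟩ := exists_greatest_lt (b := k + 1) (by omega) (ret_zero (N := N) η)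
    obtain ⟨i, hi1, hi2, hi3⟩ := h m h1 h3
    refine ⟨i, ?_, by omega, hi3⟩
    by_contra hlt
    have := h4 i (by omega) hi3
    omega
  · obtain ⟨m, h1, h2, h3, h4⟩ := exists_least_gt hk (ret_zero (N := N) η)
    refine ⟨m, h1, ?_, h3⟩
    obtain ⟨i, hi1, hi2, hi3⟩ := h' (-m) (by omega) (by rwa [ret_rev, neg_neg])
    rw [ret_rev] at hi3
    by_contra hlt
    have := h4 (-i) (by omega) hi3
    omega

theorem ret_eventually_iff (η : ℤ → ℝ) (a b : ℤ) :
    ∀ᶠ η' in 𝓝[X N] η, ∀ i, a ≤ i → i ≤ b → (Ret N η' i ↔ Ret N η i) := by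
  have h : ∀ᶠ η' in 𝓝[X N] η, ∀ i ∈ Set.Icc a b, dev N η' i = dev N η i :=
    (eventually_all_finite (Set.finite_Icc a b)).2 fun i _ => dev_eventually_eq i
  filter_upwards [h] with η' h' i hi1 hi2
  have := h' i ⟨hi1, hi2⟩
  unfold Ret
  refine and_congr_right fun hd => ?_
  rw [dev_of_dvd _ hd, dev_of_dvd _ hd] at this
  constructor <;> intro h0 <;> linarith

theorem fwdRec_eventually {g : ℤ → ℝ} {L : ℤ} (h0 : |g 0| = 1 / 2)
    (hrec : Rec N L g) : ∀ᶠ η in 𝓝[X N] g, FwdRec N L η := by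
  by_contra hcon
  rw [not_eventually] at hcon
  obtain ⟨u, hu1, hu2⟩ := exists_seq_forall_of_frequently (hcon.and_eventually self_mem_nhdsWithin)
  have hfail : ∀ m, ∃ i, 0 ≤ i ∧ Ret N (u m) i ∧ (∀ i', i < i' → i' ≤ i + L → ¬ Ret N (u m) i') ∧
      ∀ q, 0 ≤ q → q < i → Ret N (u m) q → ∃ i', q < i' ∧ i' ≤ q + L ∧ Ret N (u m) i' := by
    intro m
    have h := (hu2 m).1
    unfold FwdRec at h
    push Not at h
    obtain ⟨i0, hi0⟩ := h
    obtain ⟨i, hi, himin⟩ := Int.exists_least_of_bdd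
      (P := fun i => 0 ≤ i ∧ Ret N (u m) i ∧ ∀ i', i < i' → i' ≤ i + L → ¬ Ret N (u m) i')
      ⟨0, fun z hz => hz.1⟩ ⟨i0, hi0⟩
    refine ⟨i, hi.1, hi.2.1, hi.2.2, fun q hq hqi hret => ?_⟩
    by_contra hno
    push Not at hno
    have := himin q ⟨hq, hret, hno⟩
    omega
  choose i hi0 hiret hifail himin using hfail
  obtain ⟨w, hw, φ, hφ, hlim⟩ := exists_subseq (u := fun m => shift (i m) (u m))
    fun m => shift_mem_X (hu2 m).2 _
  have hlim' : Tendsto ((fun m => shift (i m) (u m)) ∘ φ) atTop (𝓝[X N] w) :=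
    tendsto_nhdsWithin_iff.2 ⟨hlim, Eventually.of_forall fun m => shift_mem_X (hu2 _).2 _⟩
  have hulim : Tendsto (u ∘ φ) atTop (𝓝[X N] g) := hu1.comp hφ.tendsto_atTop
  have hw0 : w 0 = g 0 := by
    have t1 : Tendsto (fun m => shift (i (φ m)) (u (φ m)) 0) atTop (𝓝 (w 0)) :=
      ((continuous_apply (0 : ℤ)).tendsto w).comp hlim
    have t2 : Tendsto (fun m => u (φ m) 0) atTop (𝓝 (g 0)) :=
      ((continuous_apply (0 : ℤ)).tendsto g).comp (hulim.mono_right nhdsWithin_le_nhds)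
    refine tendsto_nhds_unique t1 (t2.congr fun m => ?_)
    simp [(hiret (φ m)).2]
  obtain ⟨r, hr1, hr2, hr3⟩ := exists_return_of_past (L := L) hw (by rw [hw0]; exact h0) (by
    intro q hq hret
    have ev1 := hlim'.eventually (ret_eventually_iff (N := N) w (q - L) q)
    have ev2 := hulim.eventually (ret_eventually_iff (N := N) g (q - L) 0)
    obtain ⟨m, hm1, hm2⟩ := (ev1.and ev2).exists
    simp only [Function.comp_apply] at hm1 hm2
    have hLpos : 0 < L := by
      obtain ⟨j, hj1, hj2, -⟩ := hrec 0
      omega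
    have hq1 : Ret N (u (φ m)) (q + i (φ m)) :=
      (ret_shift (hiret _)).1 ((hm1 q (by omega) le_rfl).2 hret)
    suffices h : ∃ j, q + i (φ m) - L ≤ j ∧ j < q + i (φ m) ∧ Ret N (u (φ m)) j by
      obtain ⟨j, hj1, hj2, hj3⟩ := h
      refine ⟨j - i (φ m), by omega, by omega, ?_⟩
      rw [← hm1 _ (by omega) (by omega), ret_shift (hiret _), sub_add_cancel]
      exact hj3
    rcases le_or_gt (q + i (φ m)) 0 with hle | hgt
    · obtain ⟨j, hj1, hj2, hj3⟩ := hrec (q + i (φ m) - L - 1)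
      have := hi0 (φ m)
      exact ⟨j, by omega, by omega, (hm2 j (by omega) (by omega)).2 hj3⟩
    · obtain ⟨j, hj1, hj2, hj3, hj4⟩ := exists_greatest_lt hgt (ret_zero (N := N) (u (φ m)))
      refine ⟨j, ?_, hj2, hj3⟩
      obtain ⟨j', h1, h2, h3⟩ := himin (φ m) j hj1 (by omega) hj3
      by_contra hlt
      have := hj4 j' (by omega) h3
      omega)
  obtain ⟨m, hm⟩ := (hlim'.eventually (ret_eventually_iff (N := N) w 0 L)).exists
  refine hifail (φ m) (r + i (φ m)) (by omega) (by omega) ?_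
  exact (ret_shift (hiret _)).1 ((hm r (by omega) (by omega)).2 hr3)

/-- Near a point with a syndetically recurring extremal value, the value at time `0` recurs
syndetically. -/
theorem rec_eventually {g : ℤ → ℝ} {L : ℤ} (h0 : |g 0| = 1 / 2)
    (hrec : Rec N L g) : ∀ᶠ η in 𝓝[X N] g, Rec N L η := by
  have h1 := fwdRec_eventually h0 hrec
  have h2 := fwdRec_eventually (by simpa using h0) hrec.rev
  have ht : Tendsto rev (𝓝[X N] g) (𝓝[X N] (rev g)) := by
    refine tendsto_nhdsWithin_iff.2 ⟨(continuous_rev.tendsto g).mono_left nhdsWithin_le_nhds, ?_⟩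
    filter_upwards [self_mem_nhdsWithin] with η hη using rev_mem_X hη
  filter_upwards [h1, ht.eventually h2] with η e1 e2 using rec_of_fwdRec e1 e2

end

section

variable {N : ℕ} [hN : OddGtThree N]

/-- The value `c` occurs in the residue class of `j` in every window of length `L`. -/
def Recv (N : ℕ) (L j : ℤ) (c : ℝ) (η : ℤ → ℝ) : Prop :=
  ∀ k : ℤ, ∃ i, k < i ∧ i ≤ k + L ∧ (N : ℤ) ∣ i - j ∧ η i = c

theorem rec_iff_recv {L : ℤ} {η : ℤ → ℝ} : Rec N L η ↔ Recv N L 0 (η 0) η := by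
  simp [Rec, Recv, Ret]

theorem Recv.mono {L L' j : ℤ} {c : ℝ} {η : ℤ → ℝ} (h : Recv N L j c η) (hL : L ≤ L') :
    Recv N L' j c η := by
  intro k
  obtain ⟨i, h1, h2, h3⟩ := h k
  exact ⟨i, h1, by omega, h3⟩

theorem Rec.mono {L L' : ℤ} {η : ℤ → ℝ} (h : Rec N L η) (hL : L ≤ L') : Rec N L' η :=
  rec_iff_recv.2 ((rec_iff_recv.1 h).mono hL)

theorem recv_shift {L j k : ℤ} {c : ℝ} {η : ℤ → ℝ} :
    Recv N L j c (shift k η) ↔ Recv N L (j + k) c η := by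
  constructor
  · intro h q
    obtain ⟨i, h1, h2, h3, h4⟩ := h (q - k)
    exact ⟨i + k, by omega, by omega, by rwa [add_sub_add_right_eq_sub], h4⟩
  · intro h q
    obtain ⟨i, h1, h2, h3, h4⟩ := h (q + k)
    refine ⟨i - k, by omega, by omega, by rwa [sub_sub, add_comm k], ?_⟩
    simpa using h4

theorem Recv.congr {L j j' : ℤ} {c : ℝ} {η : ℤ → ℝ} (h : Recv N L j c η)
    (hj : (N : ℤ) ∣ j - j') : Recv N L j' c η := by
  intro q
  obtain ⟨i, h1, h2, h3, h4⟩ := h q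
  refine ⟨i, h1, h2, ?_, h4⟩
  have := dvd_add h3 hj
  rwa [sub_add_sub_cancel] at this

theorem Recv.pos {L j : ℤ} {c : ℝ} {η : ℤ → ℝ} (h : Recv N L j c η) : 0 < L := by
  obtain ⟨i, h1, h2, -⟩ := h 0
  omega

theorem Recv.abs_le {L j : ℤ} {c : ℝ} {η : ℤ → ℝ} (h : Recv N L j c η) (hη : η ∈ X N) :
    |c| ≤ 1 / 2 := by
  obtain ⟨i, -, -, -, h4⟩ := h 0
  rw [← h4]
  exact X_abs_le hη i

theorem isClosed_window (k L j : ℤ) (c : ℝ) :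
    IsClosed {η : ℤ → ℝ | ∃ i, k < i ∧ i ≤ k + L ∧ (N : ℤ) ∣ i - j ∧ η i = c} := by
  have : {η : ℤ → ℝ | ∃ i, k < i ∧ i ≤ k + L ∧ (N : ℤ) ∣ i - j ∧ η i = c} =
      ⋃ i ∈ {i : ℤ | (k < i ∧ i ≤ k + L) ∧ (N : ℤ) ∣ i - j}, {η : ℤ → ℝ | η i = c} := by
    ext η
    simp [and_assoc]
  rw [this]
  refine Set.Finite.isClosed_biUnion ((Set.finite_Ioc k (k + L)).subset fun i hi => hi.1)
    fun i _ => ?_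
  exact isClosed_eq (continuous_apply i) continuous_const

theorem isClosed_recv (L j : ℤ) (c : ℝ) : IsClosed {η : ℤ → ℝ | Recv N L j c η} := by
  have : {η : ℤ → ℝ | Recv N L j c η} = ⋂ k : ℤ,
      {η : ℤ → ℝ | ∃ i, k < i ∧ i ≤ k + L ∧ (N : ℤ) ∣ i - j ∧ η i = c} := by
    ext η
    simp [Recv]
  rw [this]
  exact isClosed_iInter fun k => isClosed_window k L j c

/-- Two values recurring with bounded gaps in two different residue classes force a bounded
period. -/
theorem exists_period_of_two (N : ℕ) [hN : OddGtThree N] (L : ℤ) :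
    ∃ T : ℤ, 0 < T ∧ ∀ η ∈ X N, ∀ j₁ j₂ : ℤ, ∀ c₁ c₂ : ℝ,
    ¬ (N : ℤ) ∣ j₂ - j₁ →
    (∀ k, 0 ≤ k → k ≤ T → ∃ i, k < i ∧ i ≤ k + L ∧ (N : ℤ) ∣ i - j₁ ∧ η i = c₁) →
    (∀ k, 0 ≤ k → k ≤ T → ∃ i, k < i ∧ i ≤ k + L ∧ (N : ℤ) ∣ i - j₂ ∧ η i = c₂) →
    ∃ p, 0 < p ∧ p ≤ T ∧ (N : ℤ) ∣ p ∧ Per p η := by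
  have hVfin : (⋃ m ∈ Set.Icc (0 : ℤ) L, (fun η => dev N η m) '' X N).Finite :=
    (Set.finite_Icc (0 : ℤ) L).biUnion fun m _ => finite_dev m
  obtain ⟨V, hV⟩ := hVfin.exists_finset_coe
  have hVmem : ∀ m ∈ Finset.Icc (0 : ℤ) L, ∀ η ∈ X N, dev N η m ∈ V := by
    intro m hm η hη
    rw [← Finset.mem_coe, hV]
    simp only [Set.mem_iUnion]
    exact ⟨m, by simpa using hm, η, hη, rfl⟩
  set F : Finset ((ℤ × ℤ) × (ℝ × ℝ)) :=
    (Finset.Icc 0 L ×ˢ Finset.Icc 0 L) ×ˢ (V ×ˢ V) with hF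
  have hNpos : (0 : ℤ) < N := by have := hN.gt; omega
  refine ⟨N * (F.card + 1), by positivity, ?_⟩
  intro η hη j₁ j₂ c₁ c₂ hj h₁ h₂
  have hk : ∀ t ∈ Finset.range (F.card + 1), (0 : ℤ) ≤ N * t ∧ (N : ℤ) * t ≤ N * (F.card + 1) := by
    intro t ht
    rw [Finset.mem_range] at ht
    refine ⟨by positivity, ?_⟩
    have : (t : ℤ) ≤ F.card + 1 := by omega
    nlinarith
  have g₁ : ∀ t : ℕ, ∃ m, t ∈ Finset.range (F.card + 1) →
      m ∈ Finset.Icc (0 : ℤ) L ∧ (N : ℤ) ∣ m - j₁ ∧ η (N * t + m) = c₁ := by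
    intro t
    by_cases ht : t ∈ Finset.range (F.card + 1)
    · obtain ⟨i, a1, a2, a3, a4⟩ := h₁ (N * t) (hk t ht).1 (hk t ht).2
      refine ⟨i - N * t, fun _ => ⟨Finset.mem_Icc.2 ⟨by omega, by omega⟩, ?_, ?_⟩⟩
      · have := dvd_sub a3 (Dvd.intro (t : ℤ) rfl)
        rwa [show i - j₁ - (N : ℤ) * t = i - N * t - j₁ by ring] at this
      · rw [add_sub_cancel]; exact a4
    · exact ⟨0, fun h => absurd h ht⟩
  have g₂ : ∀ t : ℕ, ∃ m, t ∈ Finset.range (F.card + 1) →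
      m ∈ Finset.Icc (0 : ℤ) L ∧ (N : ℤ) ∣ m - j₂ ∧ η (N * t + m) = c₂ := by
    intro t
    by_cases ht : t ∈ Finset.range (F.card + 1)
    · obtain ⟨i, a1, a2, a3, a4⟩ := h₂ (N * t) (hk t ht).1 (hk t ht).2
      refine ⟨i - N * t, fun _ => ⟨Finset.mem_Icc.2 ⟨by omega, by omega⟩, ?_, ?_⟩⟩
      · have := dvd_sub a3 (Dvd.intro (t : ℤ) rfl)
        rwa [show i - j₂ - (N : ℤ) * t = i - N * t - j₂ by ring] at this
      · rw [add_sub_cancel]; exact a4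
    · exact ⟨0, fun h => absurd h ht⟩
  choose m₁ hm₁ using g₁
  choose m₂ hm₂ using g₂
  obtain ⟨t, ht, t', ht', hne, heq⟩ := Finset.exists_ne_map_eq_of_card_lt_of_maps_to
    (s := Finset.range (F.card + 1)) (t := F)
    (f := fun t : ℕ => ((m₁ t, m₂ t), (dev N (shift (N * t) η) (m₁ t),
      dev N (shift (N * t) η) (m₂ t)))) (by simp) (by
      intro t ht
      have ht := Finset.mem_coe.1 ht
      simp only [hF, Finset.coe_product, Set.mem_prod, Finset.mem_coe]
      exact ⟨⟨(hm₁ t ht).1, (hm₂ t ht).1⟩, hVmem _ (hm₁ t ht).1 _ (shift_mem_X hη _),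
        hVmem _ (hm₂ t ht).1 _ (shift_mem_X hη _)⟩)
  wlog hlt : t < t' generalizing t t'
  · exact this t' ht' t ht hne.symm heq.symm (by omega)
  simp only [Prod.mk.injEq] at heq
  obtain ⟨⟨e1, e2⟩, e3, e4⟩ := heq
  obtain ⟨-, b1, b2⟩ := hm₁ t ht
  obtain ⟨-, b1', b2'⟩ := hm₁ t' ht'
  obtain ⟨-, d1, d2⟩ := hm₂ t ht
  obtain ⟨-, d1', d2'⟩ := hm₂ t' ht'
  have q1 := eq_dev_shift (N := N) η (N * t) (m₁ t)
  have q2 := eq_dev_shift (N := N) η (N * t') (m₁ t')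
  have q3 := eq_dev_shift (N := N) η (N * t) (m₂ t)
  have q4 := eq_dev_shift (N := N) η (N * t') (m₂ t')
  rw [b2, e3] at q1
  rw [b2', ← e1] at q2
  rw [d2, e4] at q3
  rw [d2', ← e2] at q4
  rw [← e1] at q1
  rw [← e2] at q3
  have hdet : U N (m₂ t) * U N (m₁ t - 1) - U N (m₁ t) * U N (m₂ t - 1) ≠ 0 := by
    rw [U_mul_sub, Ne, U_eq_zero_iff]
    intro h
    apply hj
    have := dvd_sub (dvd_sub b1 h) d1
    rwa [show m₁ t - j₁ - (m₁ t - m₂ t) - (m₂ t - j₂) = j₂ - j₁ by ring] at this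
  have x0 : η (N * t) = η (N * t') := by
    apply mul_left_cancel₀ hdet
    linear_combination (-U N (m₂ t)) * (q1 - q2) * (-1) + (U N (m₁ t)) * (q3 - q4) * (-1)
  have x1 : η (N * t + 1) = η (N * t' + 1) := by
    apply mul_left_cancel₀ hdet
    linear_combination U N (m₂ t - 1) * (q1 - q2) - U N (m₁ t - 1) * (q3 - q4)
  have hd : (N : ℤ) ∣ N * t' - N * t := dvd_sub (Dvd.intro _ rfl) (Dvd.intro _ rfl)
  have hltZ : (t : ℤ) < t' := by exact_mod_cast hlt
  refine ⟨N * t' - N * t, by nlinarith, ?_, hd, per_of_eq hη hd x0 x1⟩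
  have := (hk t' ht').2
  have := (hk t ht).1
  omega

/-- Differences of values in one residue class at bounded distance are bounded away from `0` and
`1`. -/
theorem exists_gap (N : ℕ) [OddGtThree N] (L : ℤ) : ∃ δ : ℝ, 0 < δ ∧ δ ≤ 1 / 16 ∧
    ∀ η ∈ X N, ∀ i i' : ℤ, (N : ℤ) ∣ i - i' →
    |i - i'| ≤ L → η i = η i' ∨ (4 * δ ≤ |η i - η i'| ∧ |η i - η i'| ≤ 1 - 4 * δ) := by
  set D : Set ℝ := {d | ∃ η ∈ X N, ∃ m ∈ Set.Icc (-L) L, (N : ℤ) ∣ m ∧ dev N η m = d ∧ d ≠ 0}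
  have hD : D.Finite := by
    refine ((Set.finite_Icc (-L) L).biUnion fun m _ => finite_dev (N := N) m).subset ?_
    rintro d ⟨η, hη, m, hm, -, h, -⟩
    simp only [Set.mem_iUnion]
    exact ⟨m, hm, η, hη, h⟩
  have hDr : ∀ d ∈ D, 0 < min |d| (1 - |d|) := by
    rintro d ⟨η, hη, m, hm, hd, h, h0⟩
    rw [dev_of_dvd _ hd] at h
    have d1 := hη.2 0 m (by simpa using hd)
    have d2 := hη.2 m 0 (by simpa using hd)
    have a1 := X_le hη m
    have a2 := X_ge hη m
    have a3 := X_le hη 0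
    have a4 := X_ge hη 0
    refine lt_min (abs_pos.2 h0) (sub_pos.2 ?_)
    rw [abs_lt]
    constructor
    · refine lt_of_le_of_ne (by linarith) fun h' => d1 (by linarith)
    · refine lt_of_le_of_ne (by linarith) fun h' => d2 (by linarith)
  obtain ⟨m, hm, hmin⟩ := Set.exists_min_image
    (insert (1 / 4) ((fun d : ℝ => min |d| (1 - |d|)) '' D)) id ((hD.image _).insert _)
    (Set.insert_nonempty _ _)
  have hm0 : 0 < m := by
    rcases hm with rfl | ⟨d, hd, rfl⟩
    · norm_num
    · exact hDr d hd
  have hm1 : m ≤ 1 / 4 := hmin _ (Set.mem_insert _ _)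
  refine ⟨m / 4, by positivity, by linarith, ?_⟩
  intro η hη i i' hd hL
  by_cases h0 : η i = η i'
  · exact Or.inl h0
  · right
    have h1 := dev_of_dvd (N := N) (shift i' η) hd
    simp only [shift_apply, sub_add_cancel, zero_add] at h1
    have hmem : η i - η i' ∈ D :=
      ⟨_, shift_mem_X hη i', i - i', abs_le.1 hL, hd, h1, sub_ne_zero.2 h0⟩
    have := hmin _ (Set.mem_insert_of_mem _ (Set.mem_image_of_mem _ hmem))
    simp only [id] at this
    rw [le_min_iff] at this
    constructor <;> linarith [this.1, this.2]

/-- A nonempty compact shift-invariant set contains a minimal one. -/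
theorem exists_minimal_set {Z : Set (ℤ → ℝ)} (hZ : IsCompact Z) (hne : Z.Nonempty)
    (hinv : ∀ k, ∀ η ∈ Z, shift k η ∈ Z) : ∃ M ⊆ Z, IsCompact M ∧ M.Nonempty ∧
      (∀ k, ∀ η ∈ M, shift k η ∈ M) ∧ ∀ M' ⊆ M, IsCompact M' → M'.Nonempty →
      (∀ k, ∀ η ∈ M', shift k η ∈ M') → M' = M := by
  obtain ⟨M, hMZ, hM⟩ := zorn_superset_nonempty
    {M : Set (ℤ → ℝ) | IsCompact M ∧ M.Nonempty ∧ ∀ k, ∀ η ∈ M, shift k η ∈ M} (by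
      intro c hc hchain hcne
      have : Nonempty c := hcne.to_subtype
      have hdir : DirectedOn (· ⊇ ·) c := by
        intro a ha b hb
        rcases hchain.total ha hb with h | h
        · exact ⟨a, ha, subset_rfl, h⟩
        · exact ⟨b, hb, h, subset_rfl⟩
      refine ⟨⋂₀ c, ⟨?_, ?_, ?_⟩, fun s hs => Set.sInter_subset_of_mem hs⟩
      · exact (hc hcne.some_mem).1.of_isClosed_subset
          (isClosed_sInter fun s hs => (hc hs).1.isClosed)
          (Set.sInter_subset_of_mem hcne.some_mem)
      · exact IsCompact.nonempty_sInter_of_directed_nonempty_isCompact_isClosed hdir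
          (fun s hs => (hc hs).2.1) (fun s hs => (hc hs).1) fun s hs => (hc hs).1.isClosed
      · intro k η hη s hs
        exact (hc hs).2.2 k η (hη s hs)) Z ⟨hZ, hne, hinv⟩
  refine ⟨M, hMZ, hM.1.1, hM.1.2.1, hM.1.2.2, fun M' hsub h1 h2 h3 => ?_⟩
  exact hsub.antisymm (hM.2 ⟨h1, h2, h3⟩ hsub)

/-- In a minimal set all of whose members take an extremal value, extremal values are
syndetic. -/
theorem exists_syndetic_hits {M : Set (ℤ → ℝ)} (hM : IsCompact M) (hne : M.Nonempty)
    (hinv : ∀ k, ∀ η ∈ M, shift k η ∈ M)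
    (hmin : ∀ M' ⊆ M, IsCompact M' → M'.Nonempty → (∀ k, ∀ η ∈ M', shift k η ∈ M') → M' = M)
    (hhit : ∀ η ∈ M, ∃ n, |η n| = 1 / 2) :
    ∃ L : ℤ, ∀ η ∈ M, ∀ k, ∃ i, k < i ∧ i ≤ k + L ∧ |η i| = 1 / 2 := by
  have : CompactSpace M := isCompact_iff_compactSpace.1 hM
  have : Nonempty M := hne.to_subtype
  obtain ⟨n, hn⟩ := nonempty_interior_of_iUnion_of_closed
    (f := fun n : ℤ => {η : M | |η.1 n| = 1 / 2})
    (fun n => isClosed_eq ((continuous_apply n).comp continuous_subtype_val).abs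
      continuous_const) (by
      ext η
      simpa using hhit η.1 η.2)
  obtain ⟨V, hV, hVM⟩ := isOpen_induced_iff.1 (isOpen_interior (s := {η : M | |η.1 n| = 1 / 2}))
  obtain ⟨η0, hη0⟩ := hn
  rw [← hVM] at hη0
  have hVhit : ∀ η ∈ M, η ∈ V → |η n| = 1 / 2 := by
    intro η hη hηV
    have : (⟨η, hη⟩ : M) ∈ interior {η : M | |η.1 n| = 1 / 2} := by
      rw [← hVM]
      exact hηV
    exact (interior_subset this : (⟨η, hη⟩ : M) ∈ {η : M | |η.1 n| = 1 / 2})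
  have hcover : M ⊆ ⋃ k : ℤ, shift k ⁻¹' V := by
    by_contra hcon
    obtain ⟨η1, hη1, hη1'⟩ := Set.not_subset.1 hcon
    have hopen : IsOpen (⋃ k : ℤ, shift k ⁻¹' V) :=
      isOpen_iUnion fun k => hV.preimage (continuous_shift k)
    have h := hmin (M \ ⋃ k : ℤ, shift k ⁻¹' V) Set.sdiff_subset (hM.diff hopen) ⟨η1, hη1, hη1'⟩
      (by
        rintro k η ⟨h1, h2⟩
        refine ⟨hinv k η h1, fun h3 => h2 ?_⟩
        simp only [Set.mem_iUnion, Set.mem_preimage, shift_shift] at h3 ⊢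
        obtain ⟨l, hl⟩ := h3
        exact ⟨_, hl⟩)
    have h4 : η0.1 ∈ M \ ⋃ k : ℤ, shift k ⁻¹' V := by
      rw [h]
      exact η0.2
    apply h4.2
    simp only [Set.mem_iUnion]
    exact ⟨0, by simpa using hη0⟩
  obtain ⟨t, ht⟩ := hM.elim_finite_subcover (fun k : ℤ => shift k ⁻¹' V)
    (fun k => hV.preimage (continuous_shift k)) hcover
  obtain ⟨K, hK⟩ : ∃ K : ℤ, ∀ k ∈ t, |k| ≤ K := by
    obtain ⟨K, hK⟩ := (t.image fun k => |k|).bddAbove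
    exact ⟨K, fun k hk => hK (by simpa using ⟨k, hk, rfl⟩)⟩
  refine ⟨2 * K + 1, fun η hη k => ?_⟩
  have h := ht (hinv (k + K + 1 - n) η hη)
  simp only [Set.mem_iUnion, Set.mem_preimage, shift_shift] at h
  obtain ⟨l, hl, hl'⟩ := h
  have h2 := hVhit _ (hinv _ η hη) hl'
  have := abs_le.1 (hK l hl)
  refine ⟨n + (l + (k + K + 1 - n)), by omega, by omega, h2⟩

/-- The hypothesis to be refuted: every aperiodic sequence takes an extremal value. -/
def AllHit (N : ℕ) : Prop := ∀ η ∈ Xinf N, ∃ n, |η n| = 1 / 2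

theorem exists_rec_of_recv {η : ℤ → ℝ} {L j : ℤ} {c : ℝ} (h : Recv N L j c η) :
    ∃ k, η k = c ∧ (N : ℤ) ∣ k - j ∧ Rec N L (shift k η) := by
  obtain ⟨i, -, -, h3, h4⟩ := h 0
  refine ⟨i, h4, h3, ?_⟩
  rw [rec_iff_recv, recv_shift]
  simp only [shift_apply, zero_add]
  rw [h4]
  exact h.congr (by rw [← neg_sub]; exact dvd_neg.2 h3)

theorem exists_recurrent_hit (H : AllHit N) {Z : Set (ℤ → ℝ)} (hZX : Z ⊆ Xinf N)
    (hZ : IsClosed Z) (hne : Z.Nonempty) (hinv : ∀ k, ∀ η ∈ Z, shift k η ∈ Z) :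
    ∃ μ ∈ Z, ∃ L : ℤ, |μ 0| = 1 / 2 ∧ Rec N L μ := by
  obtain ⟨M, hMZ, hM, hMne, hMinv, hmin⟩ :=
    exists_minimal_set (isCompact_Xinf.of_isClosed_subset hZ hZX) hne hinv
  obtain ⟨L, hL⟩ := exists_syndetic_hits hM hMne hMinv hmin fun η hη => H η (hZX (hMZ hη))
  suffices h : ∃ η ∈ M, ∃ L j : ℤ, ∃ c : ℝ, |c| = 1 / 2 ∧ Recv N L j c η by
    obtain ⟨η, hη, L, j, c, hc, hrec⟩ := h
    obtain ⟨k, hk, -, hk'⟩ := exists_rec_of_recv hrec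
    refine ⟨shift k η, hMZ (hMinv k η hη), L, ?_, hk'⟩
    simp [hk, hc]
  obtain ⟨η, hη⟩ := hMne
  have hηX : η ∈ X N := (hZX (hMZ hη)).1
  have hsame : ∀ i j : ℤ, (N : ℤ) ∣ i - j → |η i| = 1 / 2 → |η j| = 1 / 2 → η i = η j := by
    intro i j hd hi' hj'
    have d1 := hηX.2 j i hd
    have d2 := hηX.2 i j (by rw [← neg_sub]; exact dvd_neg.2 hd)
    rcases eq_or_eq_neg_of_abs_eq hi' with e | e <;>
      rcases eq_or_eq_neg_of_abs_eq hj' with e' | e'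
    · rw [e, e']
    · exact absurd (by rw [e, e']; norm_num) d2
    · exact absurd (by rw [e, e']; norm_num) d1
    · rw [e, e']
  obtain ⟨j₁, -, -, hj₁⟩ := hL η hη 0
  obtain ⟨j₂, c₂, hc₂, hj₂⟩ : ∃ (j₂ : ℤ) (c₂ : ℝ), |c₂| = 1 / 2 ∧ ∀ i, |η i| = 1 / 2 →
      ((N : ℤ) ∣ i - j₁ ∧ η i = η j₁) ∨ ((N : ℤ) ∣ i - j₂ ∧ η i = c₂) := by
    by_cases h : ∃ j : ℤ, ¬ (N : ℤ) ∣ j - j₁ ∧ |η j| = 1 / 2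
    · obtain ⟨j, hj, hj'⟩ := h
      refine ⟨j, η j, hj', fun i hi => ?_⟩
      by_cases h1 : (N : ℤ) ∣ i - j₁
      · exact Or.inl ⟨h1, hsame _ _ h1 hi hj₁⟩
      · have h2 : (N : ℤ) ∣ i - j := by
          by_contra h2
          exact not_three_hits hηX h1 hj h2 hj₁ hi hj'
        exact Or.inr ⟨h2, hsame _ _ h2 hi hj'⟩
    · push Not at h
      refine ⟨0, 1 / 2, by norm_num [abs_of_pos], fun i hi => Or.inl ?_⟩
      have h1 : (N : ℤ) ∣ i - j₁ := by
        by_contra h1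
        exact h i h1 hi
      exact ⟨h1, hsame _ _ h1 hi hj₁⟩
  by_cases hcase : ∃ L', Recv N L' j₁ (η j₁) η
  · obtain ⟨L', hL'⟩ := hcase
    exact ⟨η, hη, L', j₁, η j₁, hj₁, hL'⟩
  · push Not at hcase
    have hNpos : (0 : ℤ) < N := by have := hN.gt; omega
    have hq : ∀ m : ℕ, ∃ q : ℤ, (N : ℤ) ∣ q ∧ ∀ k : ℤ, |k| ≤ m →
        ∃ i, k < i ∧ i ≤ k + L ∧ (N : ℤ) ∣ i - j₂ ∧ shift q η i = c₂ := by
      intro m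
      have h := hcase (2 * m + N + |L|)
      unfold Recv at h
      push Not at h
      obtain ⟨k0, hk0⟩ := h
      have hLabs := le_abs_self L
      have hmod1 := Int.emod_nonneg (k0 + m + N) hNpos.ne'
      have hmod2 := Int.emod_lt_of_pos (k0 + m + N) hNpos
      have hdm := Int.emod_add_mul_ediv (k0 + m + N) N
      refine ⟨N * ((k0 + m + N) / N), Dvd.intro _ rfl, fun k hk => ?_⟩
      have hk' := abs_le.1 hk
      obtain ⟨i, h1, h2, h3⟩ := hL η hη (k + N * ((k0 + m + N) / N))
      rcases hj₂ i h3 with h4 | h4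
      · exact absurd h4.2 (hk0 i (by omega) (by omega) h4.1)
      · refine ⟨i - N * ((k0 + m + N) / N), by omega, by omega, ?_, ?_⟩
        · have := dvd_sub h4.1 (Dvd.intro ((k0 + m + N) / N : ℤ) (rfl : (N : ℤ) * _ = _))
          rwa [sub_right_comm] at this
        · simpa using h4.2
    choose q hq1 hq2 using hq
    obtain ⟨w, hw, φ, hφ, hlim⟩ := hM.tendsto_subseq (x := fun m => shift (q m) η)
      fun m => hMinv _ η hη
    refine ⟨w, hw, L, j₂, c₂, hc₂, fun k => ?_⟩
    refine (isClosed_window k L j₂ c₂).mem_of_tendsto hlim ?_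
    filter_upwards [eventually_ge_atTop k.natAbs] with m hm
    refine hq2 (φ m) k ?_
    have := hφ.le_apply (x := m)
    rw [Int.abs_eq_natAbs]
    exact_mod_cast hm.trans this

theorem orbitClosure_subset {g : ℤ → ℝ} (hg : g ∈ Xinf N) :
    closure (Set.range fun k => shift k g) ⊆ Xinf N := by
  refine closure_minimal ?_ isClosed_Xinf
  rintro _ ⟨k, rfl⟩
  exact ⟨shift_mem_X hg.1 k, (aper_shift_iff k).2 hg.2⟩

theorem orbitClosure_invariant (g : ℤ → ℝ) (k : ℤ) :
    ∀ η ∈ closure (Set.range fun k => shift k g),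
      shift k η ∈ closure (Set.range fun k => shift k g) := by
  intro η hη
  refine map_mem_closure (continuous_shift k) hη ?_
  rintro _ ⟨l, rfl⟩
  exact ⟨k + l, (shift_shift _ _ _).symm⟩

/-- A value close to `±1 / 2` that recurs syndetically in an aperiodic sequence is `±1 / 2`. -/
theorem abs_eq_half_of_recv (H : AllHit N) {L : ℤ} {δ : ℝ} (hδ : 0 < δ)
    (hgap : ∀ η ∈ X N, ∀ i i' : ℤ, (N : ℤ) ∣ i - i' →
      |i - i'| ≤ L → η i = η i' ∨ (4 * δ ≤ |η i - η i'| ∧ |η i - η i'| ≤ 1 - 4 * δ))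
    {g : ℤ → ℝ} (hg : g ∈ Xinf N) {j : ℤ} {c : ℝ} (hc : 1 / 2 - δ ≤ |c|)
    (hrec : Recv N L j c g) : |c| = 1 / 2 := by
  obtain ⟨μ, hμ, L₁, hμ0, hμrec⟩ := exists_recurrent_hit H (orbitClosure_subset hg)
    isClosed_closure ((Set.range_nonempty _).closure) (orbitClosure_invariant g)
  have hNpos : (0 : ℤ) < N := by have := hN.gt; omega
  have hμX := orbitClosure_subset hg hμ
  have hcl : closure (Set.range fun k => shift k g) ⊆
      ⋃ r ∈ Set.Ico (0 : ℤ) N, {η | Recv N L r c η} := by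
    refine closure_minimal ?_ (Set.Finite.isClosed_biUnion (Set.finite_Ico _ _)
      fun r _ => isClosed_recv L r c)
    rintro _ ⟨k, rfl⟩
    simp only [Set.mem_iUnion]
    refine ⟨(j - k) % N, ⟨Int.emod_nonneg _ hNpos.ne', Int.emod_lt_of_pos _ hNpos⟩, ?_⟩
    refine recv_shift.2 (hrec.congr ?_)
    have := Int.dvd_self_sub_emod (x := j - k) (m := N)
    rwa [show j - ((j - k) % ↑N + k) = j - k - (j - k) % ↑N by ring]
  have hr := hcl hμ
  simp only [Set.mem_iUnion] at hr
  obtain ⟨r, -, hr⟩ := hr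
  have hr : Recv N L r c μ := hr
  by_cases hd : (N : ℤ) ∣ r
  · have hr0 : Recv N L 0 c μ := hr.congr (by simpa using hd)
    obtain ⟨i, h1, h2, h3, h4⟩ := hr0 0
    have hcle := hr.abs_le hμX.1
    rcases hgap μ hμX.1 i 0 h3 (by rw [abs_of_pos (by omega)]; omega) with h | h
    · rw [← h4, h, hμ0]
    · rw [h4] at h
      rcases eq_or_eq_neg_of_abs_eq hμ0 with e | e <;> rw [e] at h <;>
        rcases abs_cases c with ⟨a1, a2⟩ | ⟨a1, a2⟩ <;> rw [a1] at hc hcle ⊢ <;>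
        rcases h with ⟨h5, h6⟩ <;> rw [le_abs'] at h5 <;> rw [abs_le] at h6 <;>
        rcases h5 with h5 | h5 <;> linarith [h6.1, h6.2]
  · obtain ⟨T, hT, hT'⟩ := exists_period_of_two N (max L L₁)
    obtain ⟨p, hp, -, hp2, hp3⟩ := hT' μ hμX.1 0 r (μ 0) c (by simpa using hd)
      (fun k _ _ => (rec_iff_recv.1 hμrec).mono (le_max_right _ _) k)
      (fun k _ _ => hr.mono (le_max_left _ _) k)
    exact absurd hp3 (hμX.2 p hp hp2)

theorem exists_rec_shift (H : AllHit N) {g : ℤ → ℝ} (hg : g ∈ Xinf N) :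
    ∃ k L : ℤ, |g k| = 1 / 2 ∧ Rec N L (shift k g) := by
  obtain ⟨μ, hμ, L, hμ0, hμrec⟩ := exists_recurrent_hit H (orbitClosure_subset hg)
    isClosed_closure ((Set.range_nonempty _).closure) (orbitClosure_invariant g)
  obtain ⟨δ, hδ, -, hgap⟩ := exists_gap N L
  have ev1 := eventually_nhdsWithin_iff.1 (rec_eventually (N := N) hμ0 hμrec)
  have ev2 : ∀ᶠ η in 𝓝 μ, 1 / 2 - δ < |η 0| :=
    ((continuous_apply (0 : ℤ)).abs.tendsto μ).eventually (lt_mem_nhds (by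
      show 1 / 2 - δ < |μ 0|
      rw [hμ0]; linarith))
  obtain ⟨η, ⟨k, rfl⟩, h1, h2⟩ :=
    ((mem_closure_iff_frequently.1 hμ).and_eventually (ev1.and ev2)).exists
  have h3 := h1 (shift_mem_X hg.1 k)
  have h4 := abs_eq_half_of_recv H hδ hgap (g := shift k g)
    ⟨shift_mem_X hg.1 k, (aper_shift_iff k).2 hg.2⟩ h2.le (rec_iff_recv.1 h3)
  exact ⟨k, L, by simpa using h4, h3⟩

theorem rec_shift_eventually {g : ℤ → ℝ} {k L : ℤ} (hk : |g k| = 1 / 2)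
    (hrec : Rec N L (shift k g)) {δ : ℝ} (hδ : 0 < δ) :
    ∀ᶠ η in 𝓝[X N] g, Rec N L (shift k η) ∧ 1 / 2 - δ < |η k| := by
  have h1 := rec_eventually (N := N) (g := shift k g) (by simpa using hk) hrec
  have ht : Tendsto (shift k) (𝓝[X N] g) (𝓝[X N] (shift k g)) := by
    refine tendsto_nhdsWithin_iff.2
      ⟨((continuous_shift k).tendsto g).mono_left nhdsWithin_le_nhds, ?_⟩
    filter_upwards [self_mem_nhdsWithin] with η hη using shift_mem_X hη k
  have h2 : ∀ᶠ η in 𝓝 g, 1 / 2 - δ < |η k| :=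
    ((continuous_apply k).abs.tendsto g).eventually (lt_mem_nhds (by
      show 1 / 2 - δ < |g k|
      rw [hk]; linarith))
  exact (ht.eventually h1).and (eventually_nhdsWithin_of_eventually_nhds h2)

theorem exists_uniform_rec (H : AllHit N) :
    ∃ L : ℤ, 0 < L ∧ ∀ g ∈ Xinf N, ∃ k, |g k| = 1 / 2 ∧ Rec N L (shift k g) := by
  have h := isCompact_Xinf.induction_on (s := Xinf N)
    (p := fun t => ∃ L : ℤ, 0 < L ∧ ∀ g ∈ t, g ∈ Xinf N → ∃ k, |g k| = 1 / 2 ∧ Rec N L (shift k g))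
    ⟨1, one_pos, by simp⟩
    (by
      rintro s t hst ⟨L, hL, h⟩
      exact ⟨L, hL, fun g hg => h g (hst hg)⟩)
    (by
      rintro s t ⟨L, hL, h⟩ ⟨L', hL', h'⟩
      refine ⟨max L L', lt_max_of_lt_left hL, ?_⟩
      rintro g (hg | hg) hg'
      · obtain ⟨k, h1, h2⟩ := h g hg hg'
        exact ⟨k, h1, h2.mono (le_max_left _ _)⟩
      · obtain ⟨k, h1, h2⟩ := h' g hg hg'
        exact ⟨k, h1, h2.mono (le_max_right _ _)⟩)
    (by
      intro g hg
      obtain ⟨k, L, h1, h2⟩ := exists_rec_shift H hg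
      obtain ⟨δ, hδ, -, hgap⟩ := exists_gap N L
      have ev := rec_shift_eventually h1 h2 hδ
      refine ⟨_, nhdsWithin_mono _ (fun _ h => h.1) ev, L, (rec_iff_recv.1 h2).pos, ?_⟩
      intro η hη hη'
      have hη1 : Rec N L (shift k η) ∧ 1 / 2 - δ < |η k| := hη
      refine ⟨k, ?_, hη1.1⟩
      have h4 := abs_eq_half_of_recv H hδ hgap (g := shift k η)
        ⟨shift_mem_X hη'.1 k, (aper_shift_iff k).2 hη'.2⟩ (by simpa using hη1.2.le)
        (rec_iff_recv.1 hη1.1)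
      simpa using h4)
  obtain ⟨L, hL, h⟩ := h
  exact ⟨L, hL, fun g hg => h g hg hg⟩

/-- Constants describing the structure of the symbolic space under the hypothesis `AllHit`. -/
structure StructData (N : ℕ) (P L T : ℤ) (δ : ℝ) : Prop where
  P_pos : 0 < P
  dvd_P : (N : ℤ) ∣ P
  L_pos : 0 < L
  T_pos : 0 < T
  δ_pos : 0 < δ
  δ_le : δ ≤ 1 / 16
  gap : ∀ η ∈ X N, ∀ i i' : ℤ, (N : ℤ) ∣ i - i' → |i - i'| ≤ L →
    η i = η i' ∨ (4 * δ ≤ |η i - η i'| ∧ |η i - η i'| ≤ 1 - 4 * δ)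
  two : ∀ η ∈ X N, ∀ j₁ j₂ : ℤ, ∀ c₁ c₂ : ℝ, ¬ (N : ℤ) ∣ j₂ - j₁ →
    (∀ k, 0 ≤ k → k ≤ T → ∃ i, k < i ∧ i ≤ k + L ∧ (N : ℤ) ∣ i - j₁ ∧ η i = c₁) →
    (∀ k, 0 ≤ k → k ≤ T → ∃ i, k < i ∧ i ≤ k + L ∧ (N : ℤ) ∣ i - j₂ ∧ η i = c₂) → Per P η
  exists_recv : ∀ η ∈ X N, ¬ Per P η → ∃ j c, 1 / 2 - δ ≤ |c| ∧ Recv N L j c η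
  extremal : ∀ η ∈ Xinf N, ∀ j c, 1 / 2 - δ ≤ |c| → Recv N L j c η → |c| = 1 / 2

theorem exists_structData (H : AllHit N) : ∃ P L T δ, StructData N P L T δ := by
  obtain ⟨L, hL, hrec⟩ := exists_uniform_rec H
  obtain ⟨δ, hδ, hδ1, hgap⟩ := exists_gap N L
  obtain ⟨T, hT, htwo⟩ := exists_period_of_two N L
  have hNpos : (0 : ℤ) < N := by have := hN.gt; omega
  have h := isCompact_X.induction_on (s := X N)
    (p := fun t => ∃ P : ℤ, 0 < P ∧ ∀ η ∈ t, η ∈ X N → ¬ Per P η →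
      ∃ j c, 1 / 2 - δ ≤ |c| ∧ Recv N L j c η)
    ⟨1, one_pos, by simp⟩
    (by
      rintro s t hst ⟨P, hP, h⟩
      exact ⟨P, hP, fun g hg => h g (hst hg)⟩)
    (by
      rintro s t ⟨P, hP, h⟩ ⟨P', hP', h'⟩
      refine ⟨P * P', mul_pos hP hP', ?_⟩
      rintro g (hg | hg) hg' hper
      · exact h g hg hg' fun hh => hper (hh.of_dvd (dvd_mul_right _ _))
      · exact h' g hg hg' fun hh => hper (hh.of_dvd (dvd_mul_left _ _)))
    (by
      intro g hg
      by_cases hinf : Aper N g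
      · obtain ⟨k, h1, h2⟩ := hrec g ⟨hg, hinf⟩
        refine ⟨_, rec_shift_eventually h1 h2 hδ, 1, one_pos, ?_⟩
        intro η hη _ _
        have hη1 : Rec N L (shift k η) ∧ 1 / 2 - δ < |η k| := hη
        refine ⟨k, η k, hη1.2.le, ?_⟩
        have := recv_shift.1 (rec_iff_recv.1 hη1.1)
        simpa using this
      · unfold Aper at hinf
        push Not at hinf
        obtain ⟨p, hp, hd, hper⟩ := hinf
        refine ⟨_, per_eventually_iff hg hd, p, hp, ?_⟩
        intro η hη _ hno
        have hη1 : Per p η ↔ Per p g := hη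
        exact absurd (hη1.2 hper) hno)
  obtain ⟨P, hP, h⟩ := h
  have hfac : (0 : ℤ) < (T.toNat.factorial : ℤ) := by exact_mod_cast Nat.factorial_pos _
  refine ⟨P * (N * (T.toNat.factorial : ℤ)), L, T, δ, mul_pos hP (mul_pos hNpos hfac),
    (dvd_mul_right _ _).mul_left _, hL, hT, hδ, hδ1, hgap, ?_, ?_, ?_⟩
  · intro η hη j₁ j₂ c₁ c₂ hj h1 h2
    obtain ⟨p, hp1, hp2, hp3, hp4⟩ := htwo η hη j₁ j₂ c₁ c₂ hj h1 h2
    refine hp4.of_dvd (((?_ : p ∣ (T.toNat.factorial : ℤ)).mul_left _).mul_left _)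
    have := Nat.dvd_factorial (m := p.toNat) (n := T.toNat) (by omega) (by omega)
    rw [← Int.toNat_of_nonneg hp1.le]
    exact_mod_cast this
  · intro η hη hno
    exact h η hη hη fun hh => hno (hh.of_dvd (dvd_mul_right _ _))
  · intro η hη j c hc hr
    exact abs_eq_half_of_recv H hδ hgap hη hc hr

variable {P L T : ℤ} {δ : ℝ}

theorem StructData.residue_unique (hS : StructData N P L T δ) {η : ℤ → ℝ} (hη : η ∈ X N)
    (hP : ¬ Per P η) {j j' : ℤ} {c c' : ℝ} (h : Recv N L j c η) (h' : Recv N L j' c' η) :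
    (N : ℤ) ∣ j' - j := by
  by_contra hd
  exact hP (hS.two η hη j j' c c' hd (fun k _ _ => h k) (fun k _ _ => h' k))

/-- Values near `±1 / 2` in one residue class at distance at most `L` coincide. -/
theorem StructData.eq_of_near (hS : StructData N P L T δ) {η : ℤ → ℝ} (hη : η ∈ X N) {i i' : ℤ}
    (hd : (N : ℤ) ∣ i - i') (hL : |i - i'| ≤ L) (hi : 1 / 2 - δ ≤ |η i|)
    (hi' : 1 / 2 - δ ≤ |η i'|) : η i = η i' := by
  rcases hS.gap η hη i i' hd hL with h | h
  · exact h
  · exfalso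
    have hδ := hS.δ_pos
    have a1 := X_le hη i
    have a2 := X_ge hη i
    have a3 := X_le hη i'
    have a4 := X_ge hη i'
    rcases h with ⟨h5, h6⟩
    rw [abs_le] at h6
    rw [le_abs'] at h5 hi hi'
    rcases hi with hi | hi <;> rcases hi' with hi' | hi' <;> rcases h5 with h5 | h5 <;>
      linarith [h6.1, h6.2]

theorem StructData.value_unique (hS : StructData N P L T δ) {η : ℤ → ℝ} (hη : η ∈ X N)
    {j : ℤ} {c c' : ℝ} (hc : 1 / 2 - δ ≤ |c|) (hc' : 1 / 2 - δ ≤ |c'|) (h : Recv N L j c η)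
    (h' : Recv N L j c' η) : c = c' := by
  obtain ⟨i, h1, h2, h3, h4⟩ := h 0
  obtain ⟨i', h1', h2', h3', h4'⟩ := h' 0
  rw [← h4, ← h4']
  have hd : (N : ℤ) ∣ i - i' := by
    have := dvd_sub h3 h3'
    rwa [sub_sub_sub_cancel_right] at this
  exact hS.eq_of_near hη hd (abs_le.2 ⟨by omega, by omega⟩) (by rwa [h4]) (by rwa [h4'])

end

/-- The representative of `y` modulo `1` in `[-1 / 2, 1 / 2)`. -/
def rem (y : ℝ) : ℝ := Int.fract (y + 1 / 2) - 1 / 2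

theorem rem_ge (y : ℝ) : -(1 / 2) ≤ rem y := by
  have := Int.fract_nonneg (y + 1 / 2)
  unfold rem
  linarith

theorem rem_lt (y : ℝ) : rem y < 1 / 2 := by
  have := Int.fract_lt_one (y + 1 / 2)
  unfold rem
  linarith

theorem exists_rem (y : ℝ) : ∃ s : ℤ, rem y - y = s := by
  refine ⟨-⌊y + 1 / 2⌋, ?_⟩
  have := Int.floor_add_fract (y + 1 / 2)
  unfold rem
  push_cast
  linarith

theorem rem_eq_self {y : ℝ} (h1 : -(1 / 2) ≤ y) (h2 : y < 1 / 2) : rem y = y := by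
  unfold rem
  rw [Int.fract_eq_self.2 ⟨by linarith, by linarith⟩]
  ring

theorem measurable_rem : Measurable rem := by
  unfold rem
  fun_prop

/-- The first coordinate step of the two-dimensional system. -/
def stepMap (N : ℕ) (p : ℝ × ℝ) : ℝ × ℝ := (p.2, rem (tr N * p.2 - p.1))

/-- The sequence of half-open values determined by two consecutive terms. -/
def orb (N : ℕ) (p q : ℝ) : ℤ → ℝ
  | Int.ofNat n => ((stepMap N)^[n] (rem p, rem q)).1
  | Int.negSucc n => ((stepMap N)^[n + 1] (rem q, rem p)).2

/-- Sequences in `preX` with values in the half-open interval. -/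
def XH (N : ℕ) : Set (ℤ → ℝ) :=
  {η | (∀ n, -(1 / 2) ≤ η n ∧ η n < 1 / 2) ∧
    ∀ n, ∃ s : ℤ, η (n + 1) - tr N * η n + η (n - 1) = s}

/-- The first positive return time, or `0` if there is none. -/
def tau (N : ℕ) (η : ℤ → ℝ) : ℕ := sInf {n : ℕ | 0 < n ∧ Ret N η n}

section

variable {N : ℕ} [hN : OddGtThree N]

theorem XH_subset_X : XH N ⊆ X N := by
  intro η hη
  refine ⟨⟨fun n => abs_le.2 ⟨(hη.1 n).1, (hη.1 n).2.le⟩, hη.2⟩, fun m n _ h => ?_⟩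
  have h1 := (hη.1 m).2
  have h2 := (hη.1 n).1
  linarith

theorem shift_mem_XH {η : ℤ → ℝ} (h : η ∈ XH N) (k : ℤ) : shift k η ∈ XH N := by
  refine ⟨fun n => h.1 _, fun n => ?_⟩
  obtain ⟨s, hs⟩ := h.2 (n + k)
  refine ⟨s, ?_⟩
  rw [← hs]
  simp only [shift_apply]
  rw [show n + 1 + k = n + k + 1 by ring, show n - 1 + k = n + k - 1 by ring]

theorem eq_of_sub_int {x y : ℝ} (hx : -(1 / 2) ≤ x ∧ x < 1 / 2) (hy : -(1 / 2) ≤ y ∧ y < 1 / 2)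
    {s : ℤ} (h : x - y = s) : x = y := by
  have h1 : (s : ℝ) < 1 := by linarith [hx.2, hy.1]
  have h2 : (-1 : ℝ) < s := by linarith [hx.1, hy.2]
  have h3 : s < 1 := by exact_mod_cast h1
  have h4 : -1 < s := by exact_mod_cast h2
  have h5 : s = 0 := by omega
  rw [h5] at h
  push_cast at h
  linarith

theorem XH_ext {η μ : ℤ → ℝ} (hη : η ∈ XH N) (hμ : μ ∈ XH N) (k : ℤ) (h0 : η k = μ k)
    (h1 : η (k + 1) = μ (k + 1)) : η = μ := by
  suffices h : ∀ n, η (k + n) = μ (k + n) by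
    ext n
    have := h (n - k)
    rwa [add_sub_cancel] at this
  intro n
  induction n using int_pair_induction with
  | h0 => simpa using h0
  | h1 => exact h1
  | hs n h h' =>
    obtain ⟨s, hs⟩ := hη.2 (k + n + 1)
    obtain ⟨t, ht⟩ := hμ.2 (k + n + 1)
    rw [← add_assoc] at h'
    rw [add_sub_cancel_right, h, h'] at hs
    rw [add_sub_cancel_right] at ht
    rw [show k + (n + 2) = k + n + 1 + 1 by ring]
    refine eq_of_sub_int (hη.1 _) (hμ.1 _) (s := s - t) ?_
    push_cast
    linarith
  | hp n h h' =>
    obtain ⟨s, hs⟩ := hη.2 (k + n)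
    obtain ⟨t, ht⟩ := hμ.2 (k + n)
    rw [← add_assoc] at h'
    rw [h, h'] at hs
    rw [show k + (n - 1) = k + n - 1 by ring]
    refine eq_of_sub_int (hη.1 _) (hμ.1 _) (s := s - t) ?_
    push_cast
    linarith

theorem orb_zero (p q : ℝ) : orb N p q 0 = rem p := rfl

theorem orb_one (p q : ℝ) : orb N p q 1 = rem q := rfl

theorem orb_mem_XH (p q : ℝ) : orb N p q ∈ XH N := by
  have hval : ∀ (p q : ℝ) (n : ℕ), (-(1 / 2) ≤ ((stepMap N)^[n] (rem p, rem q)).1 ∧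
      ((stepMap N)^[n] (rem p, rem q)).1 < 1 / 2) ∧
      (-(1 / 2) ≤ ((stepMap N)^[n] (rem p, rem q)).2 ∧
      ((stepMap N)^[n] (rem p, rem q)).2 < 1 / 2) := by
    intro p q n
    induction n with
    | zero => exact ⟨⟨rem_ge p, rem_lt p⟩, ⟨rem_ge q, rem_lt q⟩⟩
    | succ n ih =>
      rw [Function.iterate_succ_apply']
      exact ⟨ih.2, rem_ge _, rem_lt _⟩
  have hrec : ∀ (x : ℝ × ℝ) (n : ℕ), ∃ s : ℤ, ((stepMap N)^[n + 1] x).2 -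
      tr N * ((stepMap N)^[n + 1] x).1 + ((stepMap N)^[n] x).1 = s := by
    intro x n
    rw [Function.iterate_succ_apply']
    obtain ⟨s, hs⟩ := exists_rem (tr N * ((stepMap N)^[n] x).2 - ((stepMap N)^[n] x).1)
    refine ⟨s, ?_⟩
    rw [← hs]
    simp only [stepMap]
    ring
  have hfst : ∀ (x : ℝ × ℝ) (n : ℕ), ((stepMap N)^[n + 1] x).1 = ((stepMap N)^[n] x).2 := by
    intro x n
    rw [Function.iterate_succ_apply']
    rfl
  refine ⟨?_, ?_⟩
  · rintro (n | n)
    · exact (hval p q n).1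
    · exact (hval q p (n + 1)).2
  · rintro (n | n)
    · cases n with
      | zero =>
        obtain ⟨s, hs⟩ := hrec (rem q, rem p) 0
        refine ⟨s, ?_⟩
        rw [← hs]
        change rem q - tr N * rem p + ((stepMap N)^[0 + 1] (rem q, rem p)).2 = _
        simp only [zero_add, Function.iterate_one, Function.iterate_zero, id, stepMap]
        ring
      | succ n =>
        obtain ⟨s, hs⟩ := hrec (rem p, rem q) n
        refine ⟨s, ?_⟩
        rw [← hs, show Int.ofNat (n + 1) - 1 = Int.ofNat n by simp]
        change ((stepMap N)^[n + 1 + 1] (rem p, rem q)).1 -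
          tr N * ((stepMap N)^[n + 1] (rem p, rem q)).1 + ((stepMap N)^[n] (rem p, rem q)).1 = _
        rw [hfst _ (n + 1)]
    · cases n with
      | zero =>
        obtain ⟨s, hs⟩ := hrec (rem q, rem p) 1
        refine ⟨s, ?_⟩
        rw [← hs]
        change rem p - tr N * ((stepMap N)^[0 + 1] (rem q, rem p)).2 +
          ((stepMap N)^[1 + 1] (rem q, rem p)).2 = _
        rw [hfst _ 1]
        simp only [zero_add, Function.iterate_one, stepMap]
        ring
      | succ n =>
        obtain ⟨s, hs⟩ := hrec (rem q, rem p) (n + 1 + 1)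
        refine ⟨s, ?_⟩
        rw [← hs]
        change ((stepMap N)^[n + 1] (rem q, rem p)).2 -
          tr N * ((stepMap N)^[n + 1 + 1] (rem q, rem p)).2 +
          ((stepMap N)^[n + 1 + 1 + 1] (rem q, rem p)).2 = _
        rw [hfst _ (n + 1 + 1), hfst _ (n + 1)]
        ring

theorem orb_mem_X (p q : ℝ) : orb N p q ∈ X N := XH_subset_X (orb_mem_XH p q)

theorem eq_orb {η : ℤ → ℝ} (hη : η ∈ XH N) : η = orb N (η 0) (η 1) := by
  refine XH_ext hη (orb_mem_XH _ _) 0 ?_ ?_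
  · rw [orb_zero, rem_eq_self (hη.1 0).1 (hη.1 0).2]
  · rw [zero_add, orb_one, rem_eq_self (hη.1 1).1 (hη.1 1).2]

theorem measurable_orb (p : ℝ) : Measurable (orb N p) := by
  have hstep : Measurable (stepMap N) := by
    unfold stepMap
    exact measurable_snd.prodMk (measurable_rem.comp (by fun_prop))
  refine measurable_pi_lambda _ ?_
  rintro (n | n)
  · exact ((hstep.iterate n).comp (measurable_const.prodMk measurable_rem)).fst
  · exact ((hstep.iterate (n + 1)).comp (measurable_rem.prodMk measurable_const)).snd

theorem measurable_ret (i : ℤ) : Measurable fun η : ℤ → ℝ => Ret N η i :=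
  measurable_const.and (measurableSet_setOfPred.1
    (measurableSet_eq_fun (measurable_pi_apply i) (measurable_pi_apply 0)))

theorem tau_eq_zero {η : ℤ → ℝ} (h : tau N η = 0) : ∀ n : ℕ, 0 < n → ¬ Ret N η n := by
  intro n hn hr
  have := Nat.sInf_mem (s := {n : ℕ | 0 < n ∧ Ret N η n}) ⟨n, hn, hr⟩
  have h' : sInf {n : ℕ | 0 < n ∧ Ret N η n} = 0 := h
  rw [h'] at this
  exact absurd this.1 (lt_irrefl 0)

theorem tau_ret (η : ℤ → ℝ) : Ret N η (tau N η) := by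
  rcases Nat.eq_zero_or_pos (tau N η) with h | h
  · rw [h]; exact ret_zero η
  · exact (Nat.sInf_mem (s := {n : ℕ | 0 < n ∧ Ret N η n}) (Nat.nonempty_of_pos_sInf h)).2

theorem tau_le {η : ℤ → ℝ} {n : ℕ} (hn : 0 < n) (h : Ret N η n) : tau N η ≤ n :=
  Nat.sInf_le ⟨hn, h⟩

theorem tau_pos {η : ℤ → ℝ} {n : ℕ} (hn : 0 < n) (h : Ret N η n) : 0 < tau N η := by
  by_contra h0
  exact tau_eq_zero (by omega) n hn h

theorem tau_eq {η : ℤ → ℝ} {n : ℕ} (hn : 0 < n) (h : Ret N η n)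
    (h' : ∀ m : ℕ, 0 < m → m < n → ¬ Ret N η m) : tau N η = n := by
  refine le_antisymm (tau_le hn h) ?_
  by_contra hlt
  exact h' _ (tau_pos hn h) (by omega) (tau_ret η)

theorem measurable_tau : Measurable (tau N) := by
  refine measurable_to_countable' fun n => ?_
  have : tau N ⁻¹' {n} = {η | (n = 0 ∧ ∀ m : ℕ, 0 < m → ¬ Ret N η m) ∨
      (0 < n ∧ Ret N η n ∧ ∀ m : ℕ, 0 < m → m < n → ¬ Ret N η m)} := by
    ext η
    constructor
    · rintro rfl
      rcases Nat.eq_zero_or_pos (tau N η) with h | h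
      · exact Or.inl ⟨h, tau_eq_zero h⟩
      · exact Or.inr ⟨h, tau_ret η, fun m hm hlt hr => absurd (tau_le hm hr) (by omega)⟩
    · rintro (⟨rfl, h⟩ | ⟨h0, h1, h2⟩)
      · by_contra hne
        exact h _ (Nat.pos_of_ne_zero hne) (tau_ret η)
      · exact tau_eq h0 h1 h2
  rw [this]
  refine measurableSet_setOfPred.2 ((measurable_const.and (Measurable.forall fun m : ℕ =>
    measurable_const.imp (measurable_ret (m : ℤ)).not)).or (measurable_const.and
      ((measurable_ret _).and (Measurable.forall fun m : ℕ => measurable_const.imp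
        (measurable_const.imp (measurable_ret (m : ℤ)).not)))))

/-- The displacement of the first return map. -/
def disp (N : ℕ) (η : ℤ → ℝ) : ℝ := η (tau N η + 1) - η 1

theorem disp_eq_dev (η : ℤ → ℝ) : disp N η = dev N η (tau N η + 1) :=
  (dev_add_one_of_dvd η (tau_ret η).1).symm

theorem measurable_disp : Measurable (disp N) := by
  have h : Measurable fun p : (ℤ → ℝ) × ℕ => p.1 ((p.2 : ℤ) + 1) :=
    measurable_from_prod_countable_left fun n =>
      (measurable_pi_apply ((n : ℤ) + 1) : Measurable fun f : ℤ → ℝ => f _)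
  exact (h.comp (measurable_id.prodMk measurable_tau)).sub (measurable_pi_apply 1)

/-- A countable set containing all displacements. -/
def dispSet (N : ℕ) : Set ℝ := ⋃ n : ℤ, (fun η => dev N η n) '' X N

theorem countable_dispSet : (dispSet N).Countable :=
  Set.countable_iUnion fun n => (finite_dev n).countable

theorem dev_mem_dispSet {η : ℤ → ℝ} (hη : η ∈ X N) (n : ℤ) : dev N η n ∈ dispSet N :=
  Set.mem_iUnion.2 ⟨n, η, hη, rfl⟩

theorem disp_mem_dispSet {η : ℤ → ℝ} (hη : η ∈ X N) : disp N η ∈ dispSet N := by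
  rw [disp_eq_dev]
  exact dev_mem_dispSet hη _

theorem measurable_comp_of_countable_range {g : ℝ → ℝ} (hg : Measurable g) {D : Set ℝ}
    (hD : D.Countable) (hgD : ∀ x, g x ∈ D) (l : ℝ → ℝ) : Measurable fun x => l (g x) := by
  have : Countable D := hD.to_subtype
  have h1 : Measurable fun x => (⟨g x, hgD x⟩ : D) := hg.subtype_mk
  have h2 : Measurable fun d : D => l d := Measurable.of_discrete
  exact h2.comp h1

theorem measurable_lam_disp (lam : ℝ →+ ℝ) (p : ℝ) :
    Measurable fun x => lam (disp N (orb N p x)) :=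
  measurable_comp_of_countable_range (measurable_disp.comp (measurable_orb p)) countable_dispSet
    (fun _ => disp_mem_dispSet (orb_mem_X _ _)) lam

theorem exists_lam_bound (N : ℕ) [OddGtThree N] (lam : ℝ →+ ℝ) (m : ℕ) :
    ∃ C : ℝ, 0 ≤ C ∧ ∀ η ∈ X N, tau N η ≤ m → |lam (disp N η)| ≤ C := by
  have hfin : (⋃ n ∈ Set.Icc 0 m, (fun η => dev N η ((n : ℤ) + 1)) '' X N).Finite :=
    (Set.finite_Icc 0 m).biUnion fun n _ => finite_dev _
  obtain ⟨C, hC⟩ := (hfin.image fun d => |lam d|).bddAbove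
  refine ⟨max C 0, le_max_right _ _, fun η hη hm => le_max_of_le_left (hC ?_)⟩
  refine ⟨disp N η, ?_, rfl⟩
  simp only [Set.mem_iUnion]
  exact ⟨tau N η, ⟨Nat.zero_le _, hm⟩, η, hη, (disp_eq_dev η).symm⟩

theorem exists_lam (N : ℕ) [OddGtThree N] : ∃ lam : ℝ →+ ℝ, lam 1 = 0 ∧ lam (tr N) = 1 := by
  have hv : tr N ∉ Submodule.span ℚ {(1 : ℝ)} := by
    intro h
    obtain ⟨a, ha⟩ := Submodule.mem_span_singleton.1 h
    refine irrational_tr N ⟨a, ?_⟩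
    rw [← ha, Rat.smul_def, mul_one]
  obtain ⟨f, hf, hp⟩ := Submodule.exists_le_ker_of_notMem hv
  have hf1 : f 1 = 0 := hp (Submodule.mem_span_singleton_self 1)
  have hf0 : (f (tr N) : ℝ) ≠ 0 := by exact_mod_cast hf
  refine ⟨(AddMonoidHom.mulRight ((f (tr N) : ℝ)⁻¹)).comp
    ((Rat.castHom ℝ).toAddMonoidHom.comp f.toAddMonoidHom), ?_, ?_⟩
  · simp [hf1]
  · simp [hf0]

end

theorem measurePreserving_of_countable_translation {R : ℝ → ℝ} (hR : Measurable R)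
    (hbij : Function.Bijective R) {D : Set ℝ} (hD : D.Countable) (h : ∀ x, R x - x ∈ D) :
    MeasurePreserving R volume volume := by
  have : Countable D := hD.to_subtype
  refine ⟨hR, Measure.ext fun s hs => ?_⟩
  rw [Measure.map_apply hR hs]
  set A : D → Set ℝ := fun d => {x | R x - x = d ∧ x + d ∈ s} with hA
  have hAm : ∀ d, MeasurableSet (A d) := fun d =>
    (measurableSet_eq_fun (hR.sub measurable_id) measurable_const).inter
      (hs.preimage (measurable_id.add_const _))
  have h1 : R ⁻¹' s = ⋃ d, A d := by
    ext x
    simp only [Set.mem_preimage, Set.mem_iUnion, hA, Set.mem_ofPred_eq]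
    constructor
    · intro hx
      exact ⟨⟨R x - x, h x⟩, rfl, by simpa using hx⟩
    · rintro ⟨d, hd, hx⟩
      rwa [← hd, add_sub_cancel] at hx
  have h2 : s = ⋃ d : D, (fun y => y + -(d : ℝ)) ⁻¹' A d := by
    ext y
    simp only [Set.mem_preimage, Set.mem_iUnion, hA, Set.mem_ofPred_eq]
    constructor
    · intro hy
      obtain ⟨x, rfl⟩ := hbij.2 y
      refine ⟨⟨R x - x, h x⟩, ?_, by simpa using hy⟩
      simp
    · rintro ⟨d, -, hx⟩
      simpa using hx
  have h3 : volume s = volume (⋃ d : D, (fun y => y + -(d : ℝ)) ⁻¹' A d) := by rw [← h2]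
  rw [h1, h3, measure_iUnion _ hAm,
    measure_iUnion _ fun d => (hAm d).preimage (measurable_add_const (-(d : ℝ)))]
  · exact tsum_congr fun d => (measure_preimage_add_right volume _ _).symm
  · intro d d' hne
    refine Set.disjoint_left.2 fun y hy hy' => hne ?_
    have e1 : R (y + -(d : ℝ)) - (y + -(d : ℝ)) = d := hy.1
    have e2 : R (y + -(d' : ℝ)) - (y + -(d' : ℝ)) = d' := hy'.1
    have e3 : R (y + -(d : ℝ)) = R (y + -(d' : ℝ)) := by linarith
    have e4 := hbij.1 e3
    exact Subtype.ext (by linarith)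
  · intro d d' hne
    refine Set.disjoint_left.2 fun y hy hy' => hne ?_
    exact Subtype.ext (hy.1.symm.trans hy'.1)

theorem isPeriodicPt_factorial_of_orbit {α : Type*} {R : α → α} (hR : Function.Injective R)
    {x : α} {O : Finset α} {Q : ℕ} (hO : O.card ≤ Q) (h : ∀ n, R^[n] x ∈ O) :
    Function.IsPeriodicPt R Q.factorial x := by
  obtain ⟨m, hm, n, hn, hne, heq⟩ := Finset.exists_ne_map_eq_of_card_lt_of_maps_to
    (s := Finset.range (Q + 1)) (t := O) (f := fun n => R^[n] x)
    (by simp only [Finset.card_range]; omega) (fun n _ => h n)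
  wlog hlt : m < n generalizing m n
  · exact this n hn m hm hne.symm heq.symm (by omega)
  rw [Finset.mem_range] at hn
  have h1 : Function.IsPeriodicPt R (n - m) x := by
    have h2 : R^[m] (R^[n - m] x) = R^[m] x := by
      rw [← Function.iterate_add_apply, Nat.add_sub_cancel' hlt.le]
      exact heq.symm
    exact hR.iterate m h2
  exact h1.trans_dvd (Nat.dvd_factorial (by omega) (by omega))

theorem integral_cocycle_eq_zero {R : ℝ → ℝ} (hR : MeasurePreserving R volume volume) {Q : ℕ}
    (hQ : 0 < Q) (hper : ∀ x, R^[Q] x = x) (lam : ℝ →+ ℝ)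
    (hint : Integrable fun x => lam (R x - x)) : ∫ x, lam (R x - x) = 0 := by
  have h1 : ∀ t : ℕ, ∫ x, lam (R (R^[t] x) - R^[t] x) = ∫ x, lam (R x - x) := by
    intro t
    have ht := hR.iterate t
    have h2 := integral_map (μ := volume) ht.aemeasurable (f := fun x => lam (R x - x))
      (by rw [ht.map_eq]; exact hint.aestronglyMeasurable)
    rw [ht.map_eq] at h2
    exact h2.symm
  have h2 : ∀ t ∈ Finset.range Q, Integrable fun x => lam (R (R^[t] x) - R^[t] x) := by
    intro t _
    exact ((hR.iterate t).integrable_comp hint.aestronglyMeasurable).2 hint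
  have h3 := integral_finsetSum (Finset.range Q) h2
  have h4 : ∀ x, ∑ t ∈ Finset.range Q, lam (R (R^[t] x) - R^[t] x) = 0 := by
    intro x
    have := Finset.sum_range_sub (fun t => lam (R^[t] x)) Q
    simp only [Function.iterate_succ_apply', ← map_sub] at this
    rw [this, hper x]
    simp
  simp only [h4, h1, integral_zero, Finset.sum_const, Finset.card_range, nsmul_eq_mul] at h3
  have hQ' : (Q : ℝ) ≠ 0 := by exact_mod_cast hQ.ne'
  exact (mul_eq_zero.1 h3.symm).resolve_left hQ'

section

variable {N : ℕ} [hN : OddGtThree N]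

theorem orb_zero_eq {p : ℝ} (hp : -(1 / 2) ≤ p ∧ p < 1 / 2) (q : ℝ) : orb N p q 0 = p := by
  rw [orb_zero, rem_eq_self hp.1 hp.2]

theorem orb_one_eq {q : ℝ} (hq : q ∈ Set.Ico (-(1 / 2) : ℝ) (1 / 2)) (p : ℝ) :
    orb N p q 1 = q := by
  rw [orb_one, rem_eq_self hq.1 hq.2]

theorem integral_lam_disp_eq_zero (lam : ℝ →+ ℝ) {p : ℝ} (hp : -(1 / 2) ≤ p ∧ p < 1 / 2)
    {Z : Set (ℤ → ℝ)} (hZ : MeasurableSet Z) (hinv : ∀ η ∈ Z, ∀ k, Ret N η k → shift k η ∈ Z)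
    {Q : ℕ} (hQ : 0 < Q) (hNQ : (N : ℤ) ∣ Q)
    (hper : ∀ x ∈ Set.Ico (-(1 / 2) : ℝ) (1 / 2), orb N p x ∈ Z → Per Q (orb N p x)) :
    ∫ x in Set.Ico (-(1 / 2) : ℝ) (1 / 2) ∩ orb N p ⁻¹' Z, lam (disp N (orb N p x)) = 0 := by
  set S : Set ℝ := Set.Ico (-(1 / 2) : ℝ) (1 / 2) ∩ orb N p ⁻¹' Z with hS
  have hSm : MeasurableSet S := measurableSet_Ico.inter (hZ.preimage (measurable_orb p))
  have hdm : Measurable fun x => disp N (orb N p x) := measurable_disp.comp (measurable_orb p)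
  set R : ℝ → ℝ := fun x => x + S.indicator (fun x => disp N (orb N p x)) x with hR
  have hRm : Measurable R := measurable_id.add (hdm.indicator hSm)
  have hRout : ∀ x, x ∉ S → R x = x := fun x hx => by simp [hR, hx]
  have hRin : ∀ x ∈ S, R x = orb N p x (tau N (orb N p x) + 1) := by
    intro x hx
    simp only [hR, Set.indicator_of_mem hx, disp]
    rw [orb_one_eq hx.1]
    ring
  have hRorb : ∀ x ∈ S, orb N p (R x) = shift (tau N (orb N p x)) (orb N p x) := by
    intro x hx
    rw [eq_orb (shift_mem_XH (orb_mem_XH p x) (tau N (orb N p x)))]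
    simp only [shift_apply, zero_add]
    rw [(tau_ret (orb N p x)).2, orb_zero_eq hp, hRin x hx, add_comm]
  have hRS : ∀ x ∈ S, R x ∈ S := by
    intro x hx
    refine ⟨?_, ?_⟩
    · rw [hRin x hx]
      exact (orb_mem_XH p x).1 _
    · rw [Set.mem_preimage, hRorb x hx]
      exact hinv _ hx.2 _ (tau_ret _)
  have hret : ∀ x ∈ S, Ret N (orb N p x) Q := fun x hx =>
    ⟨hNQ, by simpa using hper x hx.1 hx.2 0⟩
  have hinj : Function.Injective R := by
    have key : ∀ x ∈ S, ∀ y ∈ S, R x = R y → tau N (orb N p x) ≤ tau N (orb N p y) → x = y := by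
      intro x hx y hy hxy hle
      have e : orb N p x = shift ((tau N (orb N p y) : ℤ) - tau N (orb N p x)) (orb N p y) := by
        have e1 := hRorb x hx
        rw [hxy, hRorb y hy] at e1
        have e2 := congrArg (shift (-(tau N (orb N p x) : ℤ))) e1
        rw [shift_shift, shift_shift, neg_add_cancel, shift_zero] at e2
        rw [neg_add_eq_sub] at e2
        exact e2.symm
      rcases hle.eq_or_lt with h | h
      · rw [h, sub_self, shift_zero] at e
        have := congrFun e 1
        rwa [orb_one_eq hx.1, orb_one_eq hy.1] at this
      · exfalso
        have h0 := tau_pos hQ (hret x hx)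
        have e0 := congrFun e 0
        rw [shift_apply, zero_add, orb_zero_eq hp] at e0
        have hr : Ret N (orb N p y) ((tau N (orb N p y) - tau N (orb N p x) : ℕ) : ℤ) := by
          rw [Nat.cast_sub hle]
          exact ⟨dvd_sub (tau_ret _).1 (tau_ret _).1, by rw [← e0, orb_zero_eq hp]⟩
        have := tau_le (by omega) hr
        omega
    intro x y hxy
    by_cases hx : x ∈ S <;> by_cases hy : y ∈ S
    · rcases le_total (tau N (orb N p x)) (tau N (orb N p y)) with h | h
      · exact key x hx y hy hxy h
      · exact (key y hy x hx hxy.symm h).symm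
    · exact absurd (hRout y hy ▸ hxy ▸ hRS x hx) hy
    · exact absurd (hRout x hx ▸ hxy ▸ hRS y hy) hx
    · rwa [hRout x hx, hRout y hy] at hxy
  have hiter : ∀ x ∈ S, ∀ n, R^[n] x ∈ S ∧ ∃ k, orb N p (R^[n] x) = shift k (orb N p x) := by
    intro x hx n
    induction n with
    | zero => exact ⟨hx, 0, by simp⟩
    | succ n ih =>
      obtain ⟨h1, k, h2⟩ := ih
      rw [Function.iterate_succ_apply']
      refine ⟨hRS _ h1, tau N (orb N p (R^[n] x)) + k, ?_⟩
      rw [hRorb _ h1, ← shift_shift, ← h2]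
  have hperiod : ∀ x, R^[Q.factorial] x = x := by
    intro x
    by_cases hx : x ∈ S
    · refine isPeriodicPt_factorial_of_orbit hinj
        (O := (Finset.range Q).image fun i : ℕ => orb N p x i)
        (Finset.card_image_le.trans (by simp)) fun n => ?_
      obtain ⟨h1, k, h2⟩ := hiter x hx n
      have h3 := congrFun h2 1
      rw [orb_one_eq h1.1, shift_apply] at h3
      have hQZ : (0 : ℤ) < Q := by exact_mod_cast hQ
      have hm1 := Int.emod_nonneg (1 + k) hQZ.ne'
      have hm2 := Int.emod_lt_of_pos (1 + k) hQZ
      refine Finset.mem_image.2 ⟨((1 + k) % Q).toNat, by simp; omega, ?_⟩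
      rw [h3, Int.toNat_of_nonneg hm1]
      have h4 := (hper x hx.1 hx.2).mul ((1 + k) / Q) ((1 + k) % Q)
      rw [mul_comm, Int.emod_add_mul_ediv] at h4
      exact h4.symm
    · exact Function.iterate_fixed (hRout x hx) _
  have hsurj : Function.Surjective R := by
    intro y
    obtain ⟨m, hm⟩ := Nat.exists_eq_succ_of_ne_zero (Nat.factorial_pos Q).ne'
    have := hperiod y
    rw [hm, Function.iterate_succ_apply'] at this
    exact ⟨_, this⟩
  have hD : ∀ x, R x - x ∈ insert 0 (dispSet N) := by
    intro x
    simp only [hR, add_sub_cancel_left]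
    by_cases hx : x ∈ S
    · rw [Set.indicator_of_mem hx]
      exact Or.inr (disp_mem_dispSet (orb_mem_X _ _))
    · rw [Set.indicator_of_notMem hx]
      exact Or.inl rfl
  have hmp := measurePreserving_of_countable_translation hRm ⟨hinj, hsurj⟩
    (countable_dispSet.insert 0) hD
  have hF : (fun x => lam (R x - x)) = S.indicator fun x => lam (disp N (orb N p x)) := by
    ext x
    by_cases hx : x ∈ S <;> simp [hR, hx]
  obtain ⟨C, hC0, hC⟩ := exists_lam_bound N lam Q
  have hint : Integrable fun x => lam (R x - x) := by
    rw [hF, integrable_indicator_iff hSm]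
    refine Measure.integrableOn_of_bounded (M := C) ?_
      (measurable_lam_disp lam p).aestronglyMeasurable ?_
    · exact ((measure_mono Set.inter_subset_left).trans_lt (by simp)).ne
    · filter_upwards [ae_restrict_mem hSm] with x hx
      exact hC _ (orb_mem_X _ _) (tau_le hQ (hret x hx))
  have h := integral_cocycle_eq_zero hmp (Nat.factorial_pos Q) hperiod lam hint
  rwa [hF, integral_indicator hSm] at h

end

/-- The orbit starting at the lower extremal value. -/
def base (N : ℕ) (x : ℝ) : ℤ → ℝ := orb N (-(1 / 2)) x

/-- No extremal value occurs outside the residue class of `0`. -/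
def Good (N : ℕ) (x : ℝ) : Prop := ∀ n : ℤ, ¬ (N : ℤ) ∣ n → |base N x n| ≠ 1 / 2

section

variable {N : ℕ} [hN : OddGtThree N]

theorem half_mem : -(1 / 2 : ℝ) ≤ -(1 / 2) ∧ -(1 / 2 : ℝ) < 1 / 2 := by norm_num

theorem base_zero (x : ℝ) : base N x 0 = -(1 / 2) := orb_zero_eq half_mem x

theorem abs_base_zero (x : ℝ) : |base N x 0| = 1 / 2 := by
  rw [base_zero, abs_neg, abs_of_pos (by norm_num)]

theorem base_one {x : ℝ} (hx : x ∈ Set.Ico (-(1 / 2) : ℝ) (1 / 2)) : base N x 1 = x :=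
  orb_one_eq hx _

theorem base_mem_XH (x : ℝ) : base N x ∈ XH N := orb_mem_XH _ _

theorem base_mem_X (x : ℝ) : base N x ∈ X N := orb_mem_X _ _

theorem measurable_base : Measurable (base N) := measurable_orb _

theorem countable_not_good :
    {x | x ∈ Set.Ico (-(1 / 2) : ℝ) (1 / 2) ∧ ¬ Good N x}.Countable := by
  have h : {x | x ∈ Set.Ico (-(1 / 2) : ℝ) (1 / 2) ∧ ¬ Good N x} ⊆
      ⋃ n : ℤ, (fun p : ℝ × ℝ => (p.1 - U N (n - 1) / 2 - p.2) / U N n) ''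
        (({1 / 2, -(1 / 2)} : Set ℝ) ×ˢ dispSet N) := by
    rintro x ⟨hx, hg⟩
    unfold Good at hg
    push Not at hg
    obtain ⟨n, hn, hn'⟩ := hg
    have hU : U N n ≠ 0 := fun h => hn ((U_eq_zero_iff N n).1 h)
    refine Set.mem_iUnion.2 ⟨n, (base N x n, dev N (base N x) n),
      ⟨?_, dev_mem_dispSet (base_mem_X x) n⟩, ?_⟩
    · rcases eq_or_eq_neg_of_abs_eq hn' with h | h
      · exact Or.inl h
      · exact Or.inr h
    · have := eq_dev (N := N) (base N x) n
      rw [base_one hx, base_zero] at this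
      simp only
      rw [div_eq_iff hU]
      linarith
  refine (Set.countable_iUnion fun n => ?_).mono h
  exact (((Set.toFinite _).countable).prod countable_dispSet).image _

theorem ae_good : ∀ᵐ x : ℝ, x ∈ Set.Ico (-(1 / 2) : ℝ) (1 / 2) → Good N x := by
  rw [ae_iff]
  simp only [Classical.not_imp]
  exact countable_not_good.measure_zero volume

theorem tendsto_orb {x : ℝ} (hx : Good N x) :
    Tendsto (fun h => orb N (-(1 / 2) + h) x) (𝓝[>] 0) (𝓝[X N] (base N x)) := by
  have hbr : ∀ n : ℤ, ∀ᶠ h in 𝓝[>] (0 : ℝ), -(1 / 2) ≤ base N x n - U N (n - 1) * h ∧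
      base N x n - U N (n - 1) * h < 1 / 2 := by
    intro n
    have hlim : Tendsto (fun h : ℝ => base N x n - U N (n - 1) * h) (𝓝[>] 0)
        (𝓝 (base N x n)) := by
      have : Continuous fun h : ℝ => base N x n - U N (n - 1) * h := by fun_prop
      have := this.tendsto 0
      rw [mul_zero, sub_zero] at this
      exact this.mono_left nhdsWithin_le_nhds
    have hup := hlim.eventually (gt_mem_nhds ((base_mem_XH (N := N) x).1 n).2)
    by_cases hd : (N : ℤ) ∣ n
    · filter_upwards [hup, self_mem_nhdsWithin] with h h1 h2
      refine ⟨?_, h1⟩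
      rw [U_sub_one_of_dvd hd]
      have := ((base_mem_XH (N := N) x).1 n).1
      have h2 : 0 < h := h2
      linarith
    · have hne : base N x n ≠ -(1 / 2) := by
        intro h
        apply hx n hd
        rw [h, abs_neg, abs_of_pos (by norm_num)]
      have hlo := hlim.eventually (lt_mem_nhds
        (lt_of_le_of_ne ((base_mem_XH (N := N) x).1 n).1 hne.symm))
      filter_upwards [hup, hlo] with h h1 h2 using ⟨h2.le, h1⟩
  have hform : ∀ n : ℤ, ∀ᶠ h in 𝓝[>] (0 : ℝ),
      orb N (-(1 / 2) + h) x n = base N x n - U N (n - 1) * h := by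
    intro n
    induction n using int_pair_induction with
    | h0 =>
      have : ∀ᶠ h in 𝓝[>] (0 : ℝ), h < 1 :=
        (gt_mem_nhds one_pos).filter_mono nhdsWithin_le_nhds
      filter_upwards [this, self_mem_nhdsWithin] with h h1 h2
      have h2 : 0 < h := h2
      rw [orb_zero_eq ⟨by linarith, by linarith⟩, base_zero, zero_sub, U_neg, U_one]
      ring
    | h1 =>
      refine Eventually.of_forall fun h => ?_
      rw [orb_one, base, orb_one, sub_self, U_zero, zero_mul, sub_zero]
    | hs n h h' =>
      filter_upwards [h, h', hbr (n + 2)] with ε h1 h2 h3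
      obtain ⟨s, hs⟩ := (orb_mem_XH (N := N) (-(1 / 2) + ε) x).2 (n + 1)
      obtain ⟨t, ht⟩ := (base_mem_XH (N := N) x).2 (n + 1)
      have hU := U_add_one N n
      refine eq_of_sub_int ((orb_mem_XH _ _).1 _) h3 (s := s - t) ?_
      rw [show n + 1 + 1 = n + 2 by ring, add_sub_cancel_right] at hs ht
      rw [add_sub_cancel_right] at h2
      rw [show n + 2 - 1 = n + 1 by ring]
      rw [h1, h2] at hs
      push_cast
      rw [← hs, ← ht, hU]
      ring
    | hp n h h' =>
      filter_upwards [h, h', hbr (n - 1)] with ε h1 h2 h3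
      obtain ⟨s, hs⟩ := (orb_mem_XH (N := N) (-(1 / 2) + ε) x).2 n
      obtain ⟨t, ht⟩ := (base_mem_XH (N := N) x).2 n
      have hU := U_add_one N (n - 1)
      refine eq_of_sub_int ((orb_mem_XH _ _).1 _) h3 (s := s - t) ?_
      rw [add_sub_cancel_right] at h2
      rw [sub_add_cancel] at hU
      rw [h1, h2] at hs
      push_cast
      rw [← hs, ← ht, hU]
      ring
  refine tendsto_nhdsWithin_iff.2 ⟨tendsto_pi_nhds.2 fun n => ?_,
    Eventually.of_forall fun h => orb_mem_X _ _⟩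
  have : Continuous fun h : ℝ => base N x n - U N (n - 1) * h := by fun_prop
  have := this.tendsto 0
  rw [mul_zero, sub_zero] at this
  refine (this.mono_left nhdsWithin_le_nhds).congr' ?_
  filter_upwards [hform n] with h hh using hh.symm

theorem exists_uniform_period {K : Set (ℤ → ℝ)} (hK : IsCompact K) (hKX : K ⊆ X N)
    (hper : ∀ η ∈ K, ¬ Aper N η) :
    ∃ Q : ℕ, 0 < Q ∧ (N : ℤ) ∣ Q ∧ ∀ η ∈ K, Per Q η := by
  have hNpos : 0 < N := by have := hN.gt; omega
  have h := hK.induction_on (s := K)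
    (p := fun t => ∃ Q : ℕ, 0 < Q ∧ (N : ℤ) ∣ Q ∧ ∀ η ∈ t, η ∈ X N → Per Q η)
    ⟨N, hNpos, dvd_rfl, by simp⟩
    (by
      rintro s t hst ⟨Q, hQ, hd, h⟩
      exact ⟨Q, hQ, hd, fun g hg => h g (hst hg)⟩)
    (by
      rintro s t ⟨Q, hQ, hd, h⟩ ⟨Q', hQ', -, h'⟩
      refine ⟨Q * Q', mul_pos hQ hQ', by push_cast; exact hd.mul_right _, ?_⟩
      push_cast
      rintro g (hg | hg) hg'
      · exact (h g hg hg').of_dvd (dvd_mul_right _ _)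
      · exact (h' g hg hg').of_dvd (dvd_mul_left _ _))
    (by
      intro g hg
      have hinf := hper g hg
      unfold Aper at hinf
      push Not at hinf
      obtain ⟨p, hp, hd, hper⟩ := hinf
      refine ⟨_, nhdsWithin_mono _ hKX (per_eventually_iff (hKX hg) hd), p.toNat, by omega, ?_⟩
      rw [Int.toNat_of_nonneg hp.le]
      refine ⟨hd, fun η hη _ => ?_⟩
      have hη1 : Per p η ↔ Per p g := hη
      exact hη1.2 hper)
  obtain ⟨Q, hQ, hd, h⟩ := h
  exact ⟨Q, hQ, hd, fun η hη => h η hη (hKX hη)⟩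

theorem isClosed_recv_self (N : ℕ) [OddGtThree N] (L i : ℤ) :
    IsClosed {η : ℤ → ℝ | Recv N L i (η i) η} := by
  have : {η : ℤ → ℝ | Recv N L i (η i) η} = ⋂ k : ℤ,
      ⋃ i' ∈ {i' : ℤ | (k < i' ∧ i' ≤ k + L) ∧ (N : ℤ) ∣ i' - i},
        {η : ℤ → ℝ | η i' = η i} := by
    ext η
    simp [Recv, and_assoc]
  rw [this]
  refine isClosed_iInter fun k => Set.Finite.isClosed_biUnion
    ((Set.finite_Ioc k (k + L)).subset fun i hi => hi.1) fun i' _ => ?_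
  exact isClosed_eq (continuous_apply i') (continuous_apply i)

theorem isClosed_rec (N : ℕ) [OddGtThree N] (L : ℤ) : IsClosed {η : ℤ → ℝ | Rec N L η} := by
  have : {η : ℤ → ℝ | Rec N L η} = {η : ℤ → ℝ | Recv N L 0 (η 0) η} := by
    ext η
    exact rec_iff_recv
  rw [this]
  exact isClosed_recv_self N L 0

theorem rec_shift {L : ℤ} {η : ℤ → ℝ} {k : ℤ} (hk : Ret N η k) :
    Rec N L (shift k η) ↔ Rec N L η := by
  have : k = 0 + k := (zero_add k).symm
  rw [rec_iff_recv, rec_iff_recv, recv_shift, shift_apply, zero_add, hk.2]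
  exact ⟨fun h => h.congr (by simpa using hk.1), fun h => h.congr (by simpa using hk.1)⟩

theorem Rec.tau_le {L : ℤ} {η : ℤ → ℝ} (h : Rec N L η) :
    0 < tau N η ∧ (tau N η : ℤ) ≤ L := by
  obtain ⟨i, h1, h2, h3⟩ := h 0
  have hi : Ret N η (i.toNat : ℤ) := by rwa [Int.toNat_of_nonneg h1.le]
  have := DualBilliard.tau_le (by omega) hi
  exact ⟨tau_pos (by omega) hi, by omega⟩

variable {P L T : ℤ} {δ : ℝ}

theorem integral_rec_eq_zero (hS : StructData N P L T δ) (lam : ℝ →+ ℝ) :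
    ∫ x in Set.Ico (-(1 / 2) : ℝ) (1 / 2) ∩ base N ⁻¹' {η | Rec N L η},
      lam (disp N (base N x)) = 0 := by
  set I := Set.Ico (-(1 / 2) : ℝ) (1 / 2) with hI
  set Z : Set (ℤ → ℝ) := {η | Rec N L η} with hZ
  have hZm : MeasurableSet Z := (isClosed_rec N L).measurableSet
  set F : ℝ → ℝ → ℝ := fun h => (orb N (-(1 / 2) + h) ⁻¹' Z).indicator
    fun x => lam (disp N (orb N (-(1 / 2) + h) x)) with hF
  have hmeas : ∀ p, MeasurableSet (orb N p ⁻¹' Z) := fun p => hZm.preimage (measurable_orb p)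
  have hzero : ∀ᶠ h in 𝓝[>] (0 : ℝ), ∫ x in I, F h x = 0 := by
    have hδ : ∀ᶠ h in 𝓝[>] (0 : ℝ), h < δ :=
      (gt_mem_nhds hS.δ_pos).filter_mono nhdsWithin_le_nhds
    filter_upwards [hδ, self_mem_nhdsWithin] with h h1 h2
    have h2 : 0 < h := h2
    have h3 := hS.δ_le
    have hp : -(1 / 2) ≤ -(1 / 2) + h ∧ -(1 / 2) + h < 1 / 2 := ⟨by linarith, by linarith⟩
    have hK : IsCompact (X N ∩ (Z ∩ {η | η 0 = -(1 / 2) + h})) :=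
      isCompact_X.inter_right ((isClosed_rec N L).inter
        (isClosed_eq (continuous_apply 0) continuous_const))
    have habs : |-(1 / 2) + h| = 1 / 2 - h := by
      rw [abs_of_neg (by linarith)]; ring
    obtain ⟨Q, hQ, hNQ, hper⟩ := exists_uniform_period hK Set.inter_subset_left (by
      rintro η ⟨hη, hrec, h0⟩ hap
      have h0 : η 0 = -(1 / 2) + h := h0
      have := hS.extremal η ⟨hη, hap⟩ 0 (η 0) (by rw [h0, habs]; linarith) (rec_iff_recv.1 hrec)
      rw [h0, habs] at this
      linarith)
    have := integral_lam_disp_eq_zero lam hp hZm (fun η hη k hk => (rec_shift hk).2 hη) hQ hNQ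
      fun x _ hx => hper _ ⟨orb_mem_X _ _, hx, orb_zero_eq hp x⟩
    rw [hF, setIntegral_indicator (hmeas _)]
    exact this
  obtain ⟨C, hC0, hC⟩ := exists_lam_bound N lam L.toNat
  have hlim : Tendsto (fun h => ∫ x in I, F h x) (𝓝[>] 0) (𝓝 (∫ x in I,
      (base N ⁻¹' Z).indicator (fun x => lam (disp N (base N x))) x)) := by
    refine tendsto_integral_filter_of_dominated_convergence (fun _ => C) ?_ ?_ ?_ ?_
    · exact Eventually.of_forall fun h =>
        ((measurable_lam_disp lam _).indicator (hmeas _)).aestronglyMeasurable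
    · refine Eventually.of_forall fun h => Eventually.of_forall fun x => ?_
      by_cases hx : x ∈ orb N (-(1 / 2) + h) ⁻¹' Z
      · rw [hF]
        simp only [Set.indicator_of_mem hx]
        have := Rec.tau_le (show Rec N L (orb N (-(1 / 2) + h) x) from hx)
        exact hC _ (orb_mem_X _ _) (by omega)
      · rw [hF]
        simp only [Set.indicator_of_notMem hx]
        simpa using hC0
    · exact (integrable_const C)
    · filter_upwards [ae_restrict_mem measurableSet_Ico, ae_restrict_of_ae (ae_good (N := N))]
        with x hxI hgood
      have hgood := hgood hxI
      have hto := tendsto_orb hgood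
      by_cases hx : Rec N L (base N x)
      · refine tendsto_const_nhds.congr' ?_
        have e1 := hto.eventually (rec_eventually (abs_base_zero x) hx)
        have e2 := hto.eventually (ret_eventually_iff (base N x) 0 L)
        have e3 := hto.eventually (dev_eventually_eq (η := base N x) (tau N (base N x) + 1))
        filter_upwards [e1, e2, e3] with h h1 h2 h3
        have hτ := Rec.tau_le hx
        have ht : tau N (orb N (-(1 / 2) + h) x) = tau N (base N x) := by
          refine tau_eq hτ.1 ((h2 _ (by omega) hτ.2).2 (tau_ret _)) fun m hm hlt hr => ?_
          have := DualBilliard.tau_le hm ((h2 m (by omega) (by omega)).1 hr)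
          omega
        rw [hF]
        rw [Set.indicator_of_mem (show x ∈ base N ⁻¹' Z from hx)]
        simp only [Set.indicator_of_mem (show x ∈ orb N (-(1 / 2) + h) ⁻¹' Z from h1)]
        rw [disp_eq_dev, disp_eq_dev, ht, h3]
      · refine tendsto_const_nhds.congr' ?_
        have hopen : ∀ᶠ η in 𝓝 (base N x), ¬ Rec N L η :=
          (isClosed_rec N L).isOpen_compl.mem_nhds hx
        have e1 := hto.eventually (hopen.filter_mono nhdsWithin_le_nhds)
        filter_upwards [e1] with h h1
        rw [hF]
        rw [Set.indicator_of_notMem (show x ∉ base N ⁻¹' Z from hx)]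
        simp only [Set.indicator_of_notMem (show x ∉ orb N (-(1 / 2) + h) ⁻¹' Z from h1)]
  have h0 : Tendsto (fun h => ∫ x in I, F h x) (𝓝[>] 0) (𝓝 0) :=
    tendsto_const_nhds.congr' (by filter_upwards [hzero] with h hh using hh.symm)
  have := tendsto_nhds_unique hlim h0
  have hb : MeasurableSet (base N ⁻¹' Z) := hZm.preimage measurable_base
  rwa [setIntegral_indicator hb] at this

end

/-- A value of modulus larger than `e` recurs in a nonzero residue class. -/
def Off (N : ℕ) (L : ℤ) (e : ℝ) (η : ℤ → ℝ) : Prop :=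
  ∃ i, 0 < i ∧ i ≤ L ∧ ¬ (N : ℤ) ∣ i ∧ e < |η i| ∧ Recv N L i (η i) η

section

variable {N : ℕ} [hN : OddGtThree N]

theorem Off.shift {L : ℤ} {e : ℝ} {η : ℤ → ℝ} (h : Off N L e η) {k : ℤ} (hk : (N : ℤ) ∣ k) :
    Off N L e (shift k η) := by
  obtain ⟨i, h1, h2, h3, h4, h5⟩ := h
  obtain ⟨i', h6, h7, h8, h9⟩ := h5 k
  have hd : ¬ (N : ℤ) ∣ i' := fun h => h3 (by have := dvd_sub h h8; rwa [sub_sub_cancel] at this)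
  refine ⟨i' - k, by omega, by omega, fun h => hd (by simpa using dvd_add h hk), ?_, ?_⟩
  · rwa [shift_apply, sub_add_cancel, h9]
  · rw [recv_shift, shift_apply, sub_add_cancel, h9]
    exact h5.congr (by rw [← dvd_neg, neg_sub]; exact h8)

theorem off_shift_iff {L : ℤ} {e : ℝ} {η : ℤ → ℝ} {k : ℤ} (hk : (N : ℤ) ∣ k) :
    Off N L e (DualBilliard.shift k η) ↔ Off N L e η := by
  refine ⟨fun h => ?_, fun h => h.shift hk⟩
  have := h.shift (dvd_neg.2 hk)
  rwa [shift_shift, neg_add_cancel, shift_zero] at this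

theorem Off.mono {L : ℤ} {e e' : ℝ} {η : ℤ → ℝ} (h : Off N L e η) (he : e' ≤ e) :
    Off N L e' η := by
  obtain ⟨i, h1, h2, h3, h4, h5⟩ := h
  exact ⟨i, h1, h2, h3, he.trans_lt h4, h5⟩

theorem measurableSet_off (N : ℕ) [OddGtThree N] (L : ℤ) (e : ℝ) :
    MeasurableSet {η : ℤ → ℝ | Off N L e η} := by
  have : {η : ℤ → ℝ | Off N L e η} = ⋃ i ∈ {i : ℤ | 0 < i ∧ i ≤ L ∧ ¬ (N : ℤ) ∣ i},
      ({η : ℤ → ℝ | e < |η i|} ∩ {η : ℤ → ℝ | Recv N L i (η i) η}) := by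
    ext η
    simp only [Off, Set.mem_iUnion, Set.mem_inter_iff, Set.mem_ofPred_eq, exists_prop]
    exact exists_congr fun i => by tauto
  rw [this]
  refine MeasurableSet.biUnion (Set.to_countable _) fun i _ => ?_
  exact (isOpen_lt continuous_const (continuous_abs.comp (continuous_apply i))).measurableSet.inter
    (isClosed_recv_self N L i).measurableSet

theorem isClosed_per (p : ℤ) : IsClosed {η : ℤ → ℝ | Per p η} := by
  have : {η : ℤ → ℝ | Per p η} = ⋂ k : ℤ, {η : ℤ → ℝ | η (k + p) = η k} := by
    ext η
    simp [Per]
  rw [this]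
  exact isClosed_iInter fun k => isClosed_eq (continuous_apply _) (continuous_apply _)

variable {P L T : ℤ} {δ : ℝ}

theorem StructData.exists_off (hS : StructData N P L T δ) {η : ℤ → ℝ} (hη : η ∈ X N)
    (h0 : |η 0| = 1 / 2) (hP : ¬ Per P η) (hr : ¬ Rec N L η) :
    ∃ i, 0 < i ∧ i ≤ L ∧ ¬ (N : ℤ) ∣ i ∧ 1 / 2 - δ ≤ |η i| ∧ Recv N L i (η i) η := by
  obtain ⟨j, c, hc, hrec⟩ := hS.exists_recv η hη hP
  obtain ⟨i, h1, h2, h3, rfl⟩ := hrec 0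
  have hi := hrec.congr (j' := i) (by rw [← dvd_neg, neg_sub]; exact h3)
  refine ⟨i, h1, by omega, fun hd => hr ?_, hc, hi⟩
  have hδ := hS.δ_pos
  have := hS.eq_of_near hη (i := i) (i' := 0) (by simpa using hd)
    (abs_le.2 ⟨by omega, by omega⟩) hc (by rw [h0]; linarith)
  rw [rec_iff_recv, ← this]
  exact hi.congr (by simpa using hd)

theorem StructData.not_off_of_rec (hS : StructData N P L T δ) {η : ℤ → ℝ} (hη : η ∈ X N)
    (hP : ¬ Per P η) (hr : Rec N L η) (e : ℝ) : ¬ Off N L e η := by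
  rintro ⟨i, -, -, h3, -, h5⟩
  have := hS.residue_unique hη hP (rec_iff_recv.1 hr) h5
  rw [sub_zero] at this
  exact h3 this

/-- The points whose orbit has an almost extremal value recurring in a nonzero residue class. -/
def exceptional (N : ℕ) (P L : ℤ) (ε : ℝ) : Set ℝ :=
  {x | ¬ Per P (base N x) ∧ Off N L (1 / 2 - ε) (base N x)}

theorem measurableSet_exceptional (ε : ℝ) : MeasurableSet (exceptional N P L ε) := by
  have h1 : MeasurableSet (base N ⁻¹' {η | Per P η}) :=
    (isClosed_per P).measurableSet.preimage measurable_base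
  have h2 : MeasurableSet (base N ⁻¹' {η | Off N L (1 / 2 - ε) η}) :=
    (measurableSet_off N L _).preimage measurable_base
  exact h1.compl.inter h2

theorem add_base_neg_aux {x : ℝ} (hx : x ∈ Set.Ioo (-(1 / 2) : ℝ) (1 / 2)) (hg : Good N x)
    {n : ℕ} (hn : ∀ m : ℕ, 0 < m → m < n → ¬ Ret N (base N x) m) (m : ℕ) (hm : 0 < m)
    (hmn : m ≤ n) : (∃ s : ℤ, base N (-x) m + base N x m = s) ∧
      (m < n → base N (-x) m + base N x m = 0) := by
  have hx' : -x ∈ Set.Ico (-(1 / 2) : ℝ) (1 / 2) := ⟨by linarith [hx.2], by linarith [hx.1]⟩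
  have hint : ∀ m : ℕ, 0 < m → m < n → (∃ s : ℤ, base N (-x) m + base N x m = s) →
      base N (-x) m + base N x m = 0 := by
    rintro m hm hmn ⟨s, hs⟩
    have a1 := (base_mem_XH (N := N) x).1 m
    have a2 := (base_mem_XH (N := N) (-x)).1 m
    have hlt : s < 1 := by
      have : (s : ℝ) < 1 := by linarith
      exact_mod_cast this
    have hge : -1 ≤ s := by
      have : (-1 : ℝ) ≤ s := by linarith
      exact_mod_cast this
    rcases (by omega : s = 0 ∨ s = -1) with rfl | rfl
    · simpa using hs
    · exfalso
      push_cast at hs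
      have h1 : base N x m = -(1 / 2) := by linarith
      have hd : (N : ℤ) ∣ m := by
        by_contra hd
        exact hg m hd (by rw [h1, abs_neg, abs_of_pos (by norm_num)])
      exact hn m hm hmn ⟨hd, by rw [h1, base_zero]⟩
  induction m using Nat.strong_induction_on with
  | _ m ih =>
    suffices h : ∃ s : ℤ, base N (-x) m + base N x m = s from ⟨h, fun hlt => hint m hm hlt h⟩
    have hcase : m = 1 ∨ ∃ k, m = k + 2 :=
      (eq_or_ne m 1).imp_right fun h => ⟨m - 2, by omega⟩
    rcases hcase with rfl | ⟨k, rfl⟩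
    · refine ⟨0, ?_⟩
      rw [Nat.cast_one, base_one hx', base_one ⟨hx.1.le, hx.2⟩]
      simp
    · have h1 := (ih (k + 1) (by omega) (by omega) (by omega)).2 (by omega)
      have h0 : ∃ s : ℤ, base N (-x) k + base N x k = s := by
        rcases Nat.eq_zero_or_pos k with rfl | hk
        · refine ⟨-1, ?_⟩
          rw [Nat.cast_zero, base_zero, base_zero]
          norm_num
        · exact (ih k (by omega) hk (by omega)).1
      obtain ⟨s, hs⟩ := h0
      obtain ⟨t, ht⟩ := (base_mem_XH (N := N) x).2 (k + 1)
      obtain ⟨u, hu⟩ := (base_mem_XH (N := N) (-x)).2 (k + 1)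
      refine ⟨t + u - s, ?_⟩
      rw [add_sub_cancel_right, show (k : ℤ) + 1 + 1 = k + 2 by ring] at ht hu
      push_cast at h1 ⊢
      rw [← ht, ← hu, ← hs]
      linear_combination (tr N) * h1

theorem base_neg_eq {x : ℝ} (hx : x ∈ Set.Ioo (-(1 / 2) : ℝ) (1 / 2)) (hg : Good N x)
    {n : ℕ} (hn : ∀ m : ℕ, 0 < m → m < n → ¬ Ret N (base N x) m) (m : ℤ) (hm : 0 < m)
    (hmn : m < n) : base N (-x) m = -base N x m := by
  lift m to ℕ using hm.le
  have := (add_base_neg_aux hx hg hn m (by omega) (by omega)).2 (by omega)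
  linarith

theorem lam_disp_add_lam_disp_neg {lam : ℝ →+ ℝ} (h1 : lam 1 = 0) (h2 : lam (tr N) = 1) {x : ℝ}
    (hx : x ∈ Set.Ioo (-(1 / 2) : ℝ) (1 / 2)) (hg : Good N x) (hτ : 0 < tau N (base N x)) :
    lam (disp N (base N x)) + lam (disp N (base N (-x))) = -1 := by
  have hx' : -x ∈ Set.Ico (-(1 / 2) : ℝ) (1 / 2) := ⟨by linarith [hx.2], by linarith [hx.1]⟩
  set τ := tau N (base N x) with hτdef
  have hno : ∀ m : ℕ, 0 < m → m < τ → ¬ Ret N (base N x) m := fun m hm hlt hr => by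
    have := tau_le hm hr
    omega
  have hret := tau_ret (N := N) (base N x)
  rw [← hτdef] at hret
  have hτN : N ≤ τ := Nat.le_of_dvd hτ (by exact_mod_cast hret.1)
  have h3 := hN.gt
  have hτ' : base N (-x) τ = -(1 / 2) := by
    obtain ⟨s, hs⟩ := (add_base_neg_aux hx hg hno τ hτ le_rfl).1
    rw [hret.2, base_zero] at hs
    have := (base_mem_XH (N := N) (-x)).1 τ
    have hlt : s < 0 := by
      have : (s : ℝ) < 0 := by linarith
      exact_mod_cast this
    have hge : -1 ≤ s := by
      have : (-1 : ℝ) ≤ s := by linarith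
      exact_mod_cast this
    obtain rfl : s = -1 := by omega
    push_cast at hs
    linarith
  have htau : tau N (base N (-x)) = τ := by
    refine tau_eq hτ ⟨hret.1, by rw [hτ', base_zero]⟩ fun m hm hlt hr => ?_
    have e1 := base_neg_eq hx hg hno m (by omega) (by omega)
    have e2 := ((base_mem_XH (N := N) x).1 m).2
    rw [hr.2, base_zero] at e1
    linarith
  obtain ⟨t, ht⟩ := (base_mem_XH (N := N) x).2 τ
  obtain ⟨u, hu⟩ := (base_mem_XH (N := N) (-x)).2 τ
  have hpre := base_neg_eq hx hg hno ((τ : ℤ) - 1) (by omega) (by omega)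
  have hsum : disp N (base N x) + disp N (base N (-x)) = (t + u : ℤ) - tr N := by
    unfold disp
    rw [htau, ← hτdef, base_one hx', base_one ⟨hx.1.le, hx.2⟩]
    rw [hret.2, base_zero] at ht
    rw [hτ'] at hu
    push_cast
    rw [← ht, ← hu, hpre]
    ring
  have hz : ∀ s : ℤ, lam (s : ℝ) = 0 := by
    intro s
    have := map_zsmul lam s 1
    rwa [h1, smul_zero, zsmul_one] at this
  rw [← map_add, hsum, map_sub, hz, h2]
  norm_num

theorem StructData.tau_le_of_mismatch (hS : StructData N P L T δ) {ε : ℝ}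
    (hε : ε ≤ δ) {x : ℝ} (hx : x ∈ Set.Ioo (-(1 / 2) : ℝ) (1 / 2)) (hg : Good N x)
    (h1 : x ∉ exceptional N P L ε) (h2 : -x ∈ exceptional N P L ε) :
    tau N (base N x) ≤ (P + T + L).toNat := by
  by_contra hcon
  obtain ⟨hP', i, hi0, hiL, hid, hie, hirec⟩ := h2
  have hp := hS.P_pos
  have hl := hS.L_pos
  have ht := hS.T_pos
  have hno : ∀ m : ℕ, 0 < m → m < (P + T + L + 1).toNat → ¬ Ret N (base N x) m := by
    intro m hm hlt hr
    have := tau_le hm hr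
    omega
  have heq : ∀ m : ℤ, 0 < m → m ≤ P + T + L → base N (-x) m = -base N x m :=
    fun m hm hm' => base_neg_eq hx hg hno m hm (by omega)
  have hP : ¬ Per P (base N x) := by
    intro h
    refine hno P.toNat (by omega) (by omega) ?_
    rw [Int.toNat_of_nonneg hp.le]
    exact ⟨hS.dvd_P, by simpa using h 0⟩
  have hr : ¬ Rec N L (base N x) := by
    intro h
    obtain ⟨m, hm1, hm2, hm3⟩ := h 0
    refine hno m.toNat (by omega) (by omega) ?_
    rwa [Int.toNat_of_nonneg hm1.le]
  have hoff : ¬ Off N L (1 / 2 - ε) (base N x) := fun h => h1 ⟨hP, h⟩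
  obtain ⟨i', hi0', hiL', hid', hie', hirec'⟩ :=
    hS.exists_off (base_mem_X x) (abs_base_zero x) hP hr
  have hsmall : |base N x i'| ≤ 1 / 2 - ε := by
    by_contra h
    exact hoff ⟨i', hi0', hiL', hid', not_le.1 h, hirec'⟩
  have hi'eq := heq i' hi0' (by omega)
  by_cases hd : (N : ℤ) ∣ i' - i
  · have := hS.eq_of_near (base_mem_X (N := N) (-x)) hd (abs_le.2 ⟨by omega, by omega⟩)
      (by rw [hi'eq, abs_neg]; exact hie') (by linarith)
    rw [← this, hi'eq, abs_neg] at hie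
    linarith
  · refine hP' (hS.two _ (base_mem_X (-x)) i i' _ (-base N x i') hd (fun k _ _ => hirec k) ?_)
    intro k hk0 hkT
    obtain ⟨m, m1, m2, m3, m4⟩ := hirec' k
    exact ⟨m, m1, m2, m3, by rw [heq m (by omega) (by omega), m4]⟩

end

section

variable {N : ℕ} [hN : OddGtThree N] {P L T : ℤ} {δ : ℝ}

theorem StructData.exists_tau_bound (hS : StructData N P L T δ) (lam : ℝ →+ ℝ) {ε : ℝ}
    (hε : 0 < ε) :
    (∃ m : ℕ, ∀ x ∈ Set.Ico (-(1 / 2) : ℝ) (1 / 2) \ exceptional N P L ε,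
      0 < tau N (base N x) ∧ tau N (base N x) ≤ m) ∧
    ∫ x in Set.Ico (-(1 / 2) : ℝ) (1 / 2) \ exceptional N P L ε, lam (disp N (base N x)) = 0 := by
  set I := Set.Ico (-(1 / 2) : ℝ) (1 / 2) with hI
  set R : Set (ℤ → ℝ) := {η | Rec N L η} with hR
  set Z : Set (ℤ → ℝ) := {η | η ∈ X N ∧ |η 0| = 1 / 2 ∧ ¬ Rec N L η ∧
    (Per P η ∨ ¬ Off N L (1 / 2 - ε) η)} with hZ
  have hp := hS.P_pos
  have hRm : MeasurableSet R := (isClosed_rec N L).measurableSet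
  have hZm : MeasurableSet Z := by
    have h0 : IsClosed {η : ℤ → ℝ | |η 0| = 1 / 2} :=
      isClosed_eq (continuous_abs.comp (continuous_apply 0)) continuous_const
    exact isClosed_X.measurableSet.inter (h0.measurableSet.inter (hRm.compl.inter
      ((isClosed_per P).measurableSet.union (measurableSet_off N L _).compl)))
  have hinv : ∀ η ∈ Z, ∀ k, Ret N η k → shift k η ∈ Z := by
    rintro η ⟨h1, h2, h3, h4⟩ k hk
    refine ⟨shift_mem_X h1 k, by rwa [shift_apply, zero_add, hk.2], ?_, ?_⟩
    · rwa [rec_shift hk]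
    · rwa [per_shift_iff, off_shift_iff hk.1]
  set K : Set (ℤ → ℝ) := X N ∩ ⋃ i ∈ Set.Ioc 0 L, ({η | 1 / 2 - δ ≤ |η i|} ∩
    ({η | |η i| ≤ 1 / 2 - ε} ∩ {η | Recv N L i (η i) η})) with hK
  have hKc : IsCompact K := by
    refine isCompact_X.inter_right ((Set.finite_Ioc 0 L).isClosed_biUnion fun i _ => ?_)
    have hc : Continuous fun η : ℤ → ℝ => |η i| := continuous_abs.comp (continuous_apply i)
    exact (isClosed_le continuous_const hc).inter
      ((isClosed_le hc continuous_const).inter (isClosed_recv_self N L i))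
  obtain ⟨Q, hQ, hNQ, hper⟩ := exists_uniform_period hKc Set.inter_subset_left (by
    rintro η ⟨hη, hK⟩ hap
    simp only [Set.mem_iUnion] at hK
    obtain ⟨i, -, h1, h2, h3⟩ := hK
    have h1 : 1 / 2 - δ ≤ |η i| := h1
    have h2 : |η i| ≤ 1 / 2 - ε := h2
    have := hS.extremal η ⟨hη, hap⟩ i (η i) h1 h3
    linarith)
  have hperZ : ∀ η ∈ Z, Per ((P.toNat * Q : ℕ) : ℤ) η := by
    rintro η ⟨h1, h2, h3, h4⟩
    rw [Nat.cast_mul, Int.toNat_of_nonneg hp.le]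
    by_cases hP : Per P η
    · exact hP.of_dvd (dvd_mul_right _ _)
    · have hoff := h4.resolve_left hP
      obtain ⟨i, hi0, hiL, hid, hi, hrec⟩ := hS.exists_off h1 h2 hP h3
      refine (hper η ⟨h1, ?_⟩).of_dvd (dvd_mul_left _ _)
      simp only [Set.mem_iUnion]
      refine ⟨i, ⟨hi0, hiL⟩, hi, ?_, hrec⟩
      by_contra h
      exact hoff ⟨i, hi0, hiL, hid, not_le.1 h, hrec⟩
  have hPQ : 0 < P.toNat * Q := Nat.mul_pos (by omega) hQ
  have hNPQ : (N : ℤ) ∣ (P.toNat * Q : ℕ) := by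
    rw [Nat.cast_mul]
    exact hNQ.mul_left _
  have hτZ : ∀ x, base N x ∈ Z → 0 < tau N (base N x) ∧ tau N (base N x) ≤ P.toNat * Q := by
    intro x hx
    have hr : Ret N (base N x) ((P.toNat * Q : ℕ) : ℤ) :=
      ⟨hNPQ, by simpa using hperZ _ hx 0⟩
    exact ⟨tau_pos hPQ hr, tau_le hPQ hr⟩
  have hτR : ∀ x, base N x ∈ R → 0 < tau N (base N x) ∧ tau N (base N x) ≤ L.toNat := by
    intro x hx
    have := Rec.tau_le (show Rec N L (base N x) from hx)
    exact ⟨this.1, by omega⟩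
  have hsplit : I \ exceptional N P L ε = (I ∩ base N ⁻¹' R) ∪ (I ∩ base N ⁻¹' Z) := by
    ext x
    constructor
    · rintro ⟨hx, hE⟩
      by_cases hr : Rec N L (base N x)
      · exact Or.inl ⟨hx, hr⟩
      · refine Or.inr ⟨hx, base_mem_X x, abs_base_zero x, hr, ?_⟩
        by_contra hcon
        rw [not_or, not_not] at hcon
        exact hE hcon
    · rintro (⟨hx, hr⟩ | ⟨hx, -, -, -, h⟩)
      · exact ⟨hx, fun hE => hS.not_off_of_rec (base_mem_X x) hE.1 hr _ hE.2⟩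
      · exact ⟨hx, fun hE => h.elim hE.1 fun h => h hE.2⟩
  refine ⟨⟨max L.toNat (P.toNat * Q), fun x hx => ?_⟩, ?_⟩
  · rw [hsplit] at hx
    rcases hx with hx | hx
    · exact ⟨(hτR x hx.2).1, (hτR x hx.2).2.trans (le_max_left _ _)⟩
    · exact ⟨(hτZ x hx.2).1, (hτZ x hx.2).2.trans (le_max_right _ _)⟩
  · have hZm' : MeasurableSet (base N ⁻¹' Z) := hZm.preimage measurable_base
    have hRm' : MeasurableSet (base N ⁻¹' R) := hRm.preimage measurable_base
    have hint : ∀ (S : Set ℝ) (m : ℕ), MeasurableSet S → (∀ x ∈ S, tau N (base N x) ≤ m) →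
        IntegrableOn (fun x => lam (disp N (base N x))) (I ∩ S) := by
      intro S m hSm hS
      obtain ⟨C, hC0, hC⟩ := exists_lam_bound N lam m
      refine Measure.integrableOn_of_bounded (M := C) ?_
        (measurable_lam_disp lam _).aestronglyMeasurable ?_
      · exact ((measure_mono Set.inter_subset_left).trans_lt (by simp [hI])).ne
      · filter_upwards [ae_restrict_mem (measurableSet_Ico.inter hSm)] with x hx
        exact hC _ (base_mem_X _) (hS x hx.2)
    have hdis : Disjoint (I ∩ base N ⁻¹' R) (I ∩ base N ⁻¹' Z) := by
      rw [Set.disjoint_left]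
      rintro x ⟨-, h⟩ ⟨-, -, -, h', -⟩
      exact h' h
    rw [hsplit, setIntegral_union hdis (measurableSet_Ico.inter hZm')
      (hint _ _ hRm' fun x hx => (hτR x hx).2) (hint _ _ hZm' fun x hx => (hτZ x hx).2)]
    have e1 : ∫ x in I ∩ base N ⁻¹' R, lam (disp N (base N x)) = 0 := integral_rec_eq_zero hS lam
    have e2 : ∫ x in I ∩ base N ⁻¹' Z, lam (disp N (base N x)) = 0 :=
      integral_lam_disp_eq_zero lam half_mem hZm hinv hPQ hNPQ fun x _ hx => hperZ _ hx
    rw [e1, e2, add_zero]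

theorem StructData.exists_exceptional_small (hS : StructData N P L T δ) {v : ℝ} (hv : 0 < v) :
    ∃ ε, 0 < ε ∧ ε ≤ δ ∧
      volume.real (Set.Ico (-(1 / 2) : ℝ) (1 / 2) ∩ exceptional N P L ε) < v := by
  set I := Set.Ico (-(1 / 2) : ℝ) (1 / 2) with hI
  have hδ := hS.δ_pos
  set S : ℕ → Set ℝ := fun k => I ∩ exceptional N P L (δ / (k + 1)) with hSdef
  have hpos : ∀ k : ℕ, 0 < δ / ((k : ℝ) + 1) := fun k => by positivity
  have hle : ∀ k : ℕ, δ / ((k : ℝ) + 1) ≤ δ := fun k =>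
    div_le_self hδ.le (by have := Nat.cast_nonneg (α := ℝ) k; linarith)
  have hanti : Antitone S := by
    intro k l hkl x hx
    refine ⟨hx.1, hx.2.1, hx.2.2.mono ?_⟩
    have : δ / ((l : ℝ) + 1) ≤ δ / ((k : ℝ) + 1) := by gcongr
    linarith
  have hnull : volume (⋂ k, S k) = 0 := by
    refine measure_mono_null (t := {x | x ∈ I ∧ ¬ Good N x}) ?_
      (countable_not_good.measure_zero volume)
    intro x hx
    rw [Set.mem_iInter] at hx
    refine ⟨(hx 0).1, fun hg => ?_⟩
    have hP := (hx 0).2.1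
    obtain ⟨i, hi0, hiL, hid, hie, hrec⟩ := (hx 0).2.2
    have hi : ∀ k : ℕ, 1 / 2 - δ / ((k : ℝ) + 1) < |base N x i| := by
      intro k
      obtain ⟨j, hj0, hjL, hjd, hje, hrec'⟩ := (hx k).2.2
      have hd := hS.residue_unique (base_mem_X x) hP hrec hrec'
      have hk := hle k
      have h0 := hle 0
      have := hS.value_unique (base_mem_X x) (by linarith) (by linarith) hrec (hrec'.congr hd)
      rwa [this]
    have hge : 1 / 2 ≤ |base N x i| := by
      refine le_of_forall_pos_sub_le fun e he => ?_
      obtain ⟨k, hk⟩ := exists_nat_gt (δ / e)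
      refine le_trans ?_ (hi k).le
      have : δ / ((k : ℝ) + 1) ≤ e := by
        rw [div_le_iff₀ (by positivity)]
        rw [div_lt_iff₀ he] at hk
        nlinarith
      linarith
    exact hg i hid (le_antisymm (X_abs_le (base_mem_X x) i) hge)
  have hfin : ∀ k, volume (S k) ≠ ⊤ := fun k =>
    ((measure_mono Set.inter_subset_left).trans_lt (by simp [hI])).ne
  have hlim := tendsto_measure_iInter_atTop (μ := volume) (s := S)
    (fun k => (measurableSet_Ico.inter (measurableSet_exceptional _)).nullMeasurableSet)
    hanti ⟨0, hfin 0⟩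
  rw [hnull] at hlim
  obtain ⟨k, hk⟩ := (hlim.eventually (gt_mem_nhds (ENNReal.ofReal_pos.2 hv))).exists
  refine ⟨_, hpos k, hle k, ?_⟩
  have := (ENNReal.lt_ofReal_iff_toReal_lt (hfin k)).1 hk
  exact this

theorem not_structData (hS : StructData N P L T δ) : False := by
  obtain ⟨lam, hlam1, hlam2⟩ := exists_lam N
  obtain ⟨C, hC0, hC⟩ := exists_lam_bound N lam (P + T + L).toNat
  obtain ⟨ε, hε, hεδ, hv⟩ := hS.exists_exceptional_small (v := 1 / (2 * (1 + C))) (by positivity)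
  obtain ⟨⟨m, hm⟩, hint⟩ := hS.exists_tau_bound lam hε
  set f : ℝ → ℝ := fun x => lam (disp N (base N x)) with hf
  set I := Set.Ico (-(1 / 2) : ℝ) (1 / 2) with hI
  set J := Set.Ioo (-(1 / 2) : ℝ) (1 / 2) with hJ
  set E := exceptional N P L ε with hE
  have hEm : MeasurableSet E := measurableSet_exceptional ε
  have hEm' : MeasurableSet ((fun x : ℝ => -x) ⁻¹' E) := hEm.preimage measurable_neg
  have hfm : Measurable f := measurable_lam_disp lam _
  have hJI : J ⊆ I := Set.Ioo_subset_Ico_self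
  have hJneg : ∀ x, x ∈ J → -x ∈ J := fun x hx => ⟨by linarith [hx.2], by linarith [hx.1]⟩
  have hJI' : J =ᵐ[volume] I := Ioo_ae_eq_Ico
  set G₁ := (J \ E) \ ((fun x : ℝ => -x) ⁻¹' E) with hG₁
  set G₂ := (J \ E) ∩ ((fun x : ℝ => -x) ⁻¹' E) with hG₂
  have hJm : MeasurableSet (J \ E) := measurableSet_Ioo.diff hEm
  have hG₁m : MeasurableSet G₁ := hJm.diff hEm'
  have hG₂m : MeasurableSet G₂ := hJm.inter hEm'
  have hvolJ : ∀ S ⊆ J, volume S ≠ ⊤ := fun S hS =>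
    ((measure_mono hS).trans_lt (by simp [hJ])).ne
  have hintf : IntegrableOn f (J \ E) := by
    obtain ⟨C', hC0', hC'⟩ := exists_lam_bound N lam m
    refine Measure.integrableOn_of_bounded (M := C') (hvolJ _ Set.sdiff_subset)
      hfm.aestronglyMeasurable ?_
    filter_upwards [ae_restrict_mem hJm] with x hx
    exact hC' _ (base_mem_X _) (hm x ⟨hJI hx.1, hx.2⟩).2
  have h0 : ∫ x in J \ E, f x = 0 := by
    rw [← hint]
    exact setIntegral_congr_set (hJI'.diff (ae_eq_refl E))
  have hsum : (∫ x in G₂, f x) + ∫ x in G₁, f x = 0 := by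
    rw [← h0]
    exact integral_inter_add_sdiff hEm' hintf
  have hneg : ∫ x in G₁, f (-x) = ∫ x in G₁, f x := by
    have h := (Measure.measurePreserving_neg (volume : Measure ℝ)).setIntegral_preimage_emb
      (MeasurableEquiv.neg ℝ).measurableEmbedding f G₁
    have hpre : (fun x : ℝ => -x) ⁻¹' G₁ = G₁ := by
      ext x
      simp only [hG₁, Set.mem_preimage, Set.mem_sdiff, neg_neg]
      have : -x ∈ J ↔ x ∈ J := ⟨fun h => by simpa using hJneg _ h, hJneg x⟩
      tauto
    rw [← h]
    congr 2
    exact hpre.symm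
  have hintf₁ : IntegrableOn f G₁ := hintf.mono_set Set.sdiff_subset
  have hintf₁' : IntegrableOn (fun x => f (-x)) G₁ := by
    obtain ⟨C', hC0', hC'⟩ := exists_lam_bound N lam m
    refine Measure.integrableOn_of_bounded (M := C')
      (hvolJ _ (Set.sdiff_subset.trans Set.sdiff_subset))
      (hfm.comp measurable_neg).aestronglyMeasurable ?_
    filter_upwards [ae_restrict_mem hG₁m] with x hx
    exact hC' _ (base_mem_X _) (hm _ ⟨hJI (hJneg x hx.1.1), hx.2⟩).2
  have hG₁int : 2 * ∫ x in G₁, f x = -volume.real G₁ := by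
    have : ∫ x in G₁, (f x + f (-x)) = ∫ x in G₁, (-1 : ℝ) := by
      refine setIntegral_congr_ae hG₁m ?_
      filter_upwards [ae_good (N := N)] with x hg hx
      exact lam_disp_add_lam_disp_neg hlam1 hlam2 hx.1.1 (hg (hJI hx.1.1))
        (hm x ⟨hJI hx.1.1, hx.1.2⟩).1
    rw [integral_add hintf₁ hintf₁', hneg, setIntegral_const, smul_eq_mul] at this
    linarith
  have hvE : volume.real (J ∩ E) ≤ volume.real (I ∩ E) :=
    measureReal_mono (Set.inter_subset_inter_left _ hJI)
      ((measure_mono Set.inter_subset_left).trans_lt (by simp [hI])).ne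
  have hvE' : volume.real (J ∩ (fun x : ℝ => -x) ⁻¹' E) = volume.real (J ∩ E) := by
    have h := (Measure.measurePreserving_neg (volume : Measure ℝ)).measure_preimage
      (measurableSet_Ioo.inter hEm).nullMeasurableSet (s := J ∩ E)
    have hpre : (fun x : ℝ => -x) ⁻¹' (J ∩ E) = J ∩ (fun x : ℝ => -x) ⁻¹' E := by
      ext x
      simp only [Set.mem_preimage, Set.mem_inter_iff]
      have : -x ∈ J ↔ x ∈ J := ⟨fun h => by simpa using hJneg _ h, hJneg x⟩
      tauto
    rw [← hpre]
    exact congrArg ENNReal.toReal h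
  have hG₂int : |∫ x in G₂, f x| ≤ C * volume.real (J ∩ E) := by
    have h1 : ‖∫ x in G₂, f x‖ ≤ C * volume.real G₂ := by
      refine norm_setIntegral_le_of_norm_le_const_ae'
        (hvolJ _ (Set.inter_subset_left.trans Set.sdiff_subset)).lt_top ?_
      filter_upwards [ae_good (N := N)] with x hg hx
      exact hC _ (base_mem_X _)
        (hS.tau_le_of_mismatch hεδ hx.1.1 (hg (hJI hx.1.1)) hx.1.2 hx.2)
    refine h1.trans (mul_le_mul_of_nonneg_left ?_ hC0)
    rw [← hvE']
    exact measureReal_mono (Set.inter_subset_inter_left _ Set.sdiff_subset)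
      (hvolJ _ Set.inter_subset_left)
  have hG₁vol : 1 - 2 * volume.real (J ∩ E) ≤ volume.real G₁ := by
    have hsub : J ⊆ G₁ ∪ ((J ∩ E) ∪ (J ∩ (fun x : ℝ => -x) ⁻¹' E)) := by
      intro x hx
      simp only [hG₁, Set.mem_union, Set.mem_sdiff, Set.mem_inter_iff]
      tauto
    have h1 := measureReal_mono (μ := volume) hsub (hvolJ _ (by
      refine Set.union_subset (Set.sdiff_subset.trans Set.sdiff_subset)
        (Set.union_subset Set.inter_subset_left Set.inter_subset_left)))
    have h2 := h1.trans ((measureReal_union_le _ _).trans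
      (add_le_add_right (measureReal_union_le _ _) _))
    rw [hvE'] at h2
    have h3 : volume.real J = 1 := by
      rw [hJ, Real.volume_real_Ioo_of_le (by norm_num)]
      norm_num
    linarith
  have hvv : volume.real (J ∩ E) < 1 / (2 * (1 + C)) := hvE.trans_lt hv
  rw [lt_div_iff₀ (by positivity)] at hvv
  have := (abs_le.1 hG₂int).2
  linarith

/-- There is a bounded aperiodic sequence avoiding the extremal values. -/
theorem exists_aper (N : ℕ) [OddGtThree N] : ∃ η ∈ X N, Aper N η ∧ ∀ n, |η n| < 1 / 2 := by
  by_contra hcon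
  push Not at hcon
  obtain ⟨P, L, T, δ, hS⟩ := exists_structData (N := N) fun η hη => by
    obtain ⟨n, hn⟩ := hcon η hη.1 hη.2
    exact ⟨n, le_antisymm (X_abs_le hη.1 n) hn⟩
  exact not_structData hS

end

/-- On an interval, a homogeneous solution with angle `θ` is a combination of sine and cosine. -/
theorem homogeneous_eq {θ : ℝ} (hθ : Real.sin θ ≠ 0) {u : ℤ → ℝ} {a : ℤ} {d : ℕ}
    (hu : ∀ m, a < m → m < a + d → u (m + 1) = 2 * Real.cos θ * u m - u (m - 1)) (j : ℕ)
    (hj : j ≤ d) : u (a + j) = u a * Real.cos (j * θ) +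
      (u (a + 1) - u a * Real.cos θ) / Real.sin θ * Real.sin (j * θ) := by
  induction j using Nat.strong_induction_on with
  | _ j ih =>
    rcases (by omega : j = 0 ∨ j = 1 ∨ 2 ≤ j) with rfl | rfl | h2
    · simp
    · simp only [Nat.cast_one, one_mul]
      field_simp
      ring
    · obtain ⟨k, rfl⟩ := Nat.exists_eq_add_of_le' h2
      have h := hu (a + (k + 1 : ℕ)) (by omega) (by omega)
      have h0 := ih k (by omega) (by omega)
      have h1 := ih (k + 1) (by omega) (by omega)
      rw [show a + ((k + 1 : ℕ) : ℤ) + 1 = a + ((k + 2 : ℕ) : ℤ) by push_cast; ring,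
        show a + ((k + 1 : ℕ) : ℤ) - 1 = a + (k : ℤ) by push_cast; ring, h0, h1] at h
      rw [h]
      have e2 : ((k + 2 : ℕ) : ℝ) * θ = ((k + 1 : ℕ) : ℝ) * θ + θ := by push_cast; ring
      have e0 : (k : ℝ) * θ = ((k + 1 : ℕ) : ℝ) * θ - θ := by push_cast; ring
      rw [e2, e0, Real.cos_add, Real.sin_add, Real.cos_sub, Real.sin_sub]
      ring

/-- A homogeneous solution which is small inside an interval cannot be very negative at both of
its endpoints. -/
theorem homogeneous_not_dip {N : ℕ} (hN : 3 < N) {u : ℤ → ℝ} {a : ℤ} {d : ℕ} (hd : 2 ≤ d)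
    (hu : ∀ m, a < m → m < a + d →
      u (m + 1) = 2 * Real.cos (Real.pi / N) * u m - u (m - 1))
    (hin : ∀ m, a < m → m < a + d → |u m| < 1 / 2) (h0 : u a < -(1 / 2))
    (h1 : u (a + d) < -(1 / 2)) : False := by
  have hNp : (0 : ℝ) < N := by exact_mod_cast (by omega : 0 < N)
  have hN1 : (1 : ℝ) < N := by exact_mod_cast (by omega : 1 < N)
  have hpi := Real.pi_pos
  set θ := Real.pi / N with hθ
  have hθpos : 0 < θ := by positivity
  have hNθ : (N : ℝ) * θ = Real.pi := by rw [hθ]; field_simp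
  have hs : Real.sin θ ≠ 0 :=
    (Real.sin_pos_of_pos_of_lt_pi hθpos (by nlinarith)).ne'
  have key := homogeneous_eq hs hu
  set β := (u (a + 1) - u a * Real.cos θ) / Real.sin θ
  rcases le_or_gt N d with hNd | hNd
  · have h := key N hNd
    rw [hNθ, Real.cos_pi, Real.sin_pi] at h
    rcases eq_or_lt_of_le hNd with rfl | hlt
    · linarith
    · have := (abs_lt.1 (hin (a + N) (by omega) (by omega))).2
      linarith
  · have e0 := key d le_rfl
    have e1 := key 1 (by omega)
    have e2 := key (d - 1) (by omega)
    have b1 := (abs_lt.1 (hin (a + 1) (by omega) (by omega))).1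
    have b2 := (abs_lt.1 (hin (a + (d - 1 : ℕ)) (by omega) (by omega))).1
    set ψ := (d : ℝ) * θ / 2 with hψ
    have hdθ : (d : ℝ) * θ = 2 * ψ := by rw [hψ]; ring
    have hd1 : ((d - 1 : ℕ) : ℝ) * θ = ψ + (ψ - θ) := by
      rw [Nat.cast_sub (by omega)]
      push_cast
      linarith
    have h1θ : ((1 : ℕ) : ℝ) * θ = ψ - (ψ - θ) := by push_cast; ring
    have hd2 : (2 : ℝ) ≤ d := by exact_mod_cast hd
    have hdN : (d : ℝ) < N := by exact_mod_cast hNd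
    have hψlt : ψ < Real.pi / 2 := by nlinarith
    have hψge : θ ≤ ψ := by nlinarith
    have hcos : 0 < Real.cos ψ := Real.cos_pos_of_mem_Ioo ⟨by linarith, hψlt⟩
    have hcos' : Real.cos ψ ≤ Real.cos (ψ - θ) :=
      Real.cos_le_cos_of_nonneg_of_le_pi (by linarith) (by linarith) (by linarith)
    set W := u a * Real.cos ψ + β * Real.sin ψ
    have hS0 : u a + u (a + d) = 2 * Real.cos ψ * W := by
      rw [e0, hdθ, Real.cos_two_mul, Real.sin_two_mul]
      ring
    have hS1 : u (a + (1 : ℕ)) + u (a + (d - 1 : ℕ)) = 2 * Real.cos (ψ - θ) * W := by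
      rw [e1, e2, hd1, h1θ, Real.cos_add, Real.cos_sub ψ (ψ - θ), Real.sin_add,
        Real.sin_sub ψ (ψ - θ)]
      ring
    rw [Nat.cast_one] at hS1
    have hW : W < 0 := by
      by_contra h
      have := mul_nonneg hcos.le (not_lt.1 h)
      linarith
    nlinarith

/-- Integer sequences whose nonzero terms are alternating signs have bounded primitives. -/
theorem exists_primitive {s : ℤ → ℤ} (hs : ∀ k, s k = 0 ∨ s k = 1 ∨ s k = -1)
    (halt : ∀ j k, j < k → (∀ i, j < i → i < k → s i = 0) → s j ≠ 0 → s j ≠ s k) :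
    ∃ n : ℤ → ℕ, ∀ k, (n k : ℤ) - n (k - 1) = s k := by
  classical
  set A : ℤ → Prop := fun k => (∃ j ≤ k, s j = 1 ∧ ∀ i, j < i → i ≤ k → s i = 0) ∨
    ∃ j, k < j ∧ s j = -1 ∧ ∀ i, k < i → i < j → s i = 0 with hA
  refine ⟨fun k => if A k then 1 else 0, fun k => ?_⟩
  rcases hs k with h | h | h
  · have : A k ↔ A (k - 1) := by
      constructor
      · rintro (⟨j, hj, h1, h2⟩ | ⟨j, hj, h1, h2⟩)
        · have : j ≠ k := by rintro rfl; omega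
          exact Or.inl ⟨j, by omega, h1, fun i hi hik => h2 i hi (by omega)⟩
        · refine Or.inr ⟨j, by omega, h1, fun i hi hij => ?_⟩
          rcases eq_or_ne i k with rfl | hne
          · exact h
          · exact h2 i (by omega) hij
      · rintro (⟨j, hj, h1, h2⟩ | ⟨j, hj, h1, h2⟩)
        · refine Or.inl ⟨j, by omega, h1, fun i hi hij => ?_⟩
          rcases eq_or_ne i k with rfl | hne
          · exact h
          · exact h2 i hi (by omega)
        · have : j ≠ k := by rintro rfl; omega
          exact Or.inr ⟨j, by omega, h1, fun i hi hik => h2 i (by omega) hik⟩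
    simp [this, h]
  · have h1 : A k := Or.inl ⟨k, le_rfl, h, fun i _ _ => by omega⟩
    have h2 : ¬ A (k - 1) := by
      rintro (⟨j, hj, h1, h2⟩ | ⟨j, hj, h1, h2⟩)
      · exact halt j k (by omega) (fun i hi hik => h2 i hi (by omega)) (by omega) (by omega)
      · rcases eq_or_ne j k with rfl | hne
        · omega
        · have := h2 k (by omega) (by omega)
          omega
    simp [h1, h2, h]
  · have h1 : A (k - 1) := Or.inr ⟨k, by omega, h, fun i _ _ => by omega⟩
    have h2 : ¬ A k := by
      rintro (⟨j, hj, h1, h2⟩ | ⟨j, hj, h1, h2⟩)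
      · rcases eq_or_ne j k with rfl | hne
        · omega
        · have := h2 k (by omega) le_rfl
          omega
      · exact halt k j hj (fun i hi hik => h2 i hi hik) (by omega) (by omega)
    simp [h1, h2, h]

/-- The symbolic data from which aperiodic billiard orbits are built. -/
structure LiftData (N : ℕ) (ξ : ℤ → ℝ) (n : ℤ → ℕ) : Prop where
  abs_lt : ∀ k, |ξ k| < 1 / 2
  step : ∀ k, ξ (k + 1) - 2 * Real.cos (Real.pi / N) * ξ k + ξ (k - 1) = (n k : ℝ) - n (k - 1)
  not_per : ∀ p, p ≠ 0 → ¬ Per p ξ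

theorem LiftData.per_of_eq {N : ℕ} {ξ : ℤ → ℝ} {n : ℤ → ℕ} (h : LiftData N ξ n) {p : ℤ} {k : ℤ}
    (h0 : ξ (k + p) = ξ k) (h1 : ξ (k + 1 + p) = ξ (k + 1)) : Per p ξ := by
  have key : ∀ x y : ℤ, ∀ s : ℤ, ξ x - ξ y = s → ξ x = ξ y := by
    intro x y s hs
    have a1 := _root_.abs_lt.1 (h.abs_lt x)
    have a2 := _root_.abs_lt.1 (h.abs_lt y)
    have h1 : s < 1 := by
      have : (s : ℝ) < 1 := by linarith [a1.2, a2.1]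
      exact_mod_cast this
    have h2 : -1 < s := by
      have : (-1 : ℝ) < s := by linarith [a1.1, a2.2]
      exact_mod_cast this
    obtain rfl : s = 0 := by omega
    push_cast at hs
    linarith
  have main : ∀ m, ξ (k + m + p) = ξ (k + m) := by
    intro m
    induction m using int_pair_induction with
    | h0 => simpa using h0
    | h1 => exact h1
    | hs m ha hb =>
      have e1 := h.step (k + (m + 1) + p)
      have e2 := h.step (k + (m + 1))
      rw [show k + (m + 1) + p + 1 = k + (m + 2) + p by ring,
        show k + (m + 1) + p - 1 = k + m + p by ring, ha, hb] at e1
      rw [show k + (m + 1) + 1 = k + (m + 2) by ring,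
        show k + (m + 1) - 1 = k + m by ring] at e2
      refine key _ _ ((n (k + (m + 1) + p) : ℤ) - n (k + m + p) -
        (n (k + (m + 1)) - n (k + m))) ?_
      push_cast
      linarith
    | hp m ha hb =>
      have e1 := h.step (k + m + p)
      have e2 := h.step (k + m)
      rw [show k + m + p + 1 = k + (m + 1) + p by ring,
        show k + m + p - 1 = k + (m - 1) + p by ring, ha, hb] at e1
      rw [show k + m + 1 = k + (m + 1) by ring, show k + m - 1 = k + (m - 1) by ring] at e2
      refine key _ _ ((n (k + m + p) : ℤ) - n (k + (m - 1) + p) - (n (k + m) - n (k + (m - 1)))) ?_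
      push_cast
      linarith
  intro q
  have := main (q - k)
  rwa [add_sub_cancel] at this

theorem LiftData.eq_of_eq {N : ℕ} {ξ : ℤ → ℝ} {n : ℤ → ℕ} (h : LiftData N ξ n) {k k' : ℤ}
    (h0 : ξ k = ξ k') (h1 : (n k : ℝ) - ξ (k + 1) = n k' - ξ (k' + 1)) : k = k' := by
  by_contra hne
  refine h.not_per (k - k') (sub_ne_zero.2 hne) (h.per_of_eq (k := k') (by simpa using h0) ?_)
  rw [show k' + 1 + (k - k') = k + 1 by ring]
  have a1 := _root_.abs_lt.1 (h.abs_lt (k + 1))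
  have a2 := _root_.abs_lt.1 (h.abs_lt (k' + 1))
  have h2 : (n k : ℤ) < n k' + 1 := by
    have : (n k : ℝ) < n k' + 1 := by linarith [a1.2, a2.1]
    exact_mod_cast this
  have h3 : (n k' : ℤ) < n k + 1 := by
    have : (n k' : ℝ) < n k + 1 := by linarith [a1.1, a2.2]
    exact_mod_cast this
  have h4 : n k = n k' := by omega
  rw [h4] at h1
  linarith

theorem exists_liftData (N : ℕ) [hN : OddGtThree N] : ∃ ξ n, LiftData N ξ n := by
  obtain ⟨η, hη, hap, hlt⟩ := exists_aper N
  have hNp := natCast_pos N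
  have hN3 := hN.gt
  set c := Real.cos (Real.pi / N) with hc
  have htr : tr N = -(2 * c) := by
    rw [tr, phi, show Real.pi * ((N : ℝ) - 1) / N = Real.pi - Real.pi / N by field_simp,
      Real.cos_pi_sub]
    ring
  set ξ : ℤ → ℝ := fun k => (-1) ^ k * η k with hξ
  have hsgn : ∀ k : ℤ, ((-1 : ℝ)) ^ (k + 1) = -(-1) ^ k := fun k => by
    rw [zpow_add₀ (by norm_num), zpow_one]; ring
  have hsgn' : ∀ k : ℤ, ((-1 : ℝ)) ^ (k - 1) = -(-1) ^ k := fun k => by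
    have := hsgn (k - 1)
    rw [sub_add_cancel] at this
    linarith
  have habs : ∀ k, |ξ k| < 1 / 2 := fun k => by
    rw [hξ]
    simp only [abs_mul, abs_zpow, abs_neg, abs_one, one_zpow, one_mul]
    exact hlt k
  have hint : ∀ k, ∃ s : ℤ, ξ (k + 1) - 2 * c * ξ k + ξ (k - 1) = s := by
    intro k
    obtain ⟨s, hs⟩ := hη.1.2 k
    rw [htr] at hs
    simp only [hξ, hsgn, hsgn']
    rcases Int.even_or_odd k with hk | hk
    · refine ⟨-s, ?_⟩
      rw [hk.neg_one_zpow]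
      push_cast
      linear_combination -hs
    · refine ⟨s, ?_⟩
      rw [hk.neg_one_zpow]
      linear_combination hs
  choose s hs using hint
  have hc2 : |c| ≤ 1 := Real.abs_cos_le_one _
  have hsmall : ∀ k, s k = 0 ∨ s k = 1 ∨ s k = -1 := by
    intro k
    have a1 := abs_lt.1 (habs (k + 1))
    have a2 := abs_lt.1 (habs (k - 1))
    have a3 : |c * ξ k| ≤ 1 / 2 := by
      rw [abs_mul]
      nlinarith [habs k, abs_nonneg c, abs_nonneg (ξ k)]
    have a3 := abs_le.1 a3
    have h1 : s k < 2 := by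
      have : (s k : ℝ) < 2 := by rw [← hs k]; linarith [a1.2, a2.2, a3.1]
      exact_mod_cast this
    have h2 : -2 < s k := by
      have : (-2 : ℝ) < s k := by rw [← hs k]; linarith [a1.1, a2.1, a3.2]
      exact_mod_cast this
    omega
  have hdip : ∀ e : ℤ, (e = 1 ∨ e = -1) → ∀ j k, j < k →
      (∀ i, j < i → i < k → s i = 0) → s j = e → s k = e → False := by
    intro e he j k hjk hz hj hk
    have he2 : (e : ℝ) * e = 1 := by rcases he with rfl | rfl <;> norm_num
    have heabs : |(e : ℝ)| = 1 := by rcases he with rfl | rfl <;> norm_num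
    set u : ℤ → ℝ := fun m => e * ξ m - (if m = j - 1 ∨ m = k + 1 then 1 else 0) with hu
    have hupper : ∀ m, (e : ℝ) * ξ m < 1 / 2 := fun m => by
      refine (le_abs_self _).trans_lt ?_
      rw [abs_mul, heabs, one_mul]
      exact habs m
    have hd : ((k - j + 2).toNat : ℤ) = k - j + 2 := Int.toNat_of_nonneg (by omega)
    refine homogeneous_not_dip hN3 (u := u) (a := j - 1) (d := (k - j + 2).toNat) (by omega)
      ?_ ?_ ?_ ?_
    · intro m h1 h2
      rw [hd] at h2
      have hm := hs m
      simp only [hu]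
      rw [if_neg (show ¬(m = j - 1 ∨ m = k + 1) by omega)]
      have hval : (if m + 1 = j - 1 ∨ m + 1 = k + 1 then (1 : ℝ) else 0) +
          (if m - 1 = j - 1 ∨ m - 1 = k + 1 then (1 : ℝ) else 0) = e * s m := by
        rcases eq_or_ne m j with rfl | hmj
        · rw [if_neg (by omega), if_pos (by omega), hj, he2, zero_add]
        · rcases eq_or_ne m k with rfl | hmk
          · rw [if_pos (by omega), if_neg (by omega), hk, he2, add_zero]
          · rw [if_neg (by omega), if_neg (by omega), hz m (by omega) (by omega)]
            simp
      rw [← hc]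
      linear_combination (e : ℝ) * hm - hval
    · intro m h1 h2
      rw [hd] at h2
      simp only [hu]
      rw [if_neg (by omega), sub_zero, abs_mul, heabs, one_mul]
      exact habs m
    · simp only [hu]
      rw [if_pos (Or.inl trivial)]
      linarith [hupper (j - 1)]
    · rw [hd]
      simp only [hu]
      rw [if_pos (Or.inr (by ring))]
      linarith [hupper (j - 1 + (k - j + 2))]
  obtain ⟨n, hn⟩ := exists_primitive hsmall fun j k hjk hz hj heq => by
    rcases hsmall j with h | h | h
    · exact hj h
    · exact hdip 1 (Or.inl rfl) j k hjk hz h (by omega)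
    · exact hdip (-1) (Or.inr rfl) j k hjk hz h (by omega)
  refine ⟨ξ, n, habs, fun k => ?_, fun p hp hper => ?_⟩
  · rw [← hc, hs k, ← hn k]
    push_cast
    rfl
  · refine hap (2 * N * |p|) (by positivity) ⟨2 * |p|, by ring⟩ fun k => ?_
    have hper' : Per (2 * N * |p|) ξ := by
      refine hper.of_dvd ?_
      exact (self_dvd_abs p).mul_left _
    have h := hper' k
    simp only [hξ] at h
    have heven : ((-1 : ℝ)) ^ (2 * (N : ℤ) * |p|) = 1 :=
      Even.neg_one_zpow ⟨N * |p|, by ring⟩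
    rw [zpow_add₀ (by norm_num), heven, mul_one] at h
    exact mul_left_cancel₀ (zpow_ne_zero _ (by norm_num)) h

/-- A relation that is total in both directions has two-sided paths. -/
theorem exists_two_sided {S : Type*} {R : S → S → Prop} (hnext : ∀ s, ∃ s', R s s')
    (hprev : ∀ s', ∃ s, R s s') (s₀ : S) : ∃ g : ℤ → S, ∀ t, R (g t) (g (t + 1)) := by
  choose nxt hnxt using hnext
  choose prv hprv using hprev
  refine ⟨fun t => match t with
    | Int.ofNat n => nxt^[n] s₀
    | Int.negSucc n => prv^[n + 1] s₀, fun t => ?_⟩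
  rcases t with n | n
  · change R (nxt^[n] s₀) (nxt^[n + 1] s₀)
    rw [Function.iterate_succ_apply']
    exact hnxt _
  · rcases n with _ | n
    · exact hprv _
    · change R (prv^[n + 1 + 1] s₀) (prv^[n + 1] s₀)
      rw [Function.iterate_succ_apply' _ (n + 1)]
      exact hprv _

theorem not_strictlyRight_swap {z a b : ℂ} (h : StrictlyRight z a b) : ¬ StrictlyRight z b a := by
  unfold StrictlyRight at *
  simp only [mul_im, conj_re, conj_im, sub_re, sub_im] at *
  linarith

/-- The rotation by the angle `t`. -/
def cis (t : ℝ) : ℂ := exp (t * I)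

theorem cis_re (t : ℝ) : (cis t).re = Real.cos t := exp_ofReal_mul_I_re t

theorem cis_im (t : ℝ) : (cis t).im = Real.sin t := exp_ofReal_mul_I_im t

theorem cis_add (s t : ℝ) : cis (s + t) = cis s * cis t := by
  rw [cis, cis, cis, ← exp_add]
  push_cast
  ring_nf

theorem cis_ne_zero (t : ℝ) : cis t ≠ 0 := exp_ne_zero _

theorem cis_zpow (t : ℝ) (r : ℤ) : cis t ^ r = cis (r * t) := by
  rw [cis, cis, ← exp_int_mul]
  push_cast
  ring_nf

theorem cis_pow (t : ℝ) (r : ℕ) : cis t ^ r = cis (r * t) := by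
  have := cis_zpow t r
  simpa using this

theorem cis_zero : cis 0 = 1 := by simp [cis]

theorem cis_pi : cis Real.pi = -1 := by simp [cis, exp_pi_mul_I]

theorem cis_mul_im (t : ℝ) (z : ℂ) :
    (z * cis t).im = z.im * Real.cos t + z.re * Real.sin t := by
  rw [mul_im, cis_re, cis_im]
  ring

/-- A point of the wedge between two adjacent side lines is below the lines through `0` in all
the directions of the other diagonals. -/
theorem wedge_neg {M m : ℕ} (hM : 3 ≤ M) (hm : 0 < m) (hmM : m < M) {x y : ℝ}
    (hq : 0 < y * Real.cos (Real.pi / M) + x * Real.sin (Real.pi / M))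
    (hp : y * Real.cos (Real.pi / M) - x * Real.sin (Real.pi / M) < 0) :
    x * (Real.cos (m * (2 * Real.pi / M)) - 1) + y * Real.sin (m * (2 * Real.pi / M)) < 0 := by
  have hpi := Real.pi_pos
  have hM0 : (3 : ℝ) ≤ M := by exact_mod_cast hM
  have hm1 : (1 : ℝ) ≤ m := by exact_mod_cast hm
  have hm2 : (m : ℝ) + 1 ≤ M := by exact_mod_cast hmM
  set α := Real.pi / M with hα
  have hMα : M * α = Real.pi := by rw [hα]; field_simp
  have hα0 : 0 < α := by positivity
  have hα2 : α < Real.pi / 2 := by nlinarith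
  have hs : 0 < Real.sin α := Real.sin_pos_of_pos_of_lt_pi hα0 (by linarith)
  have hc : 0 < Real.cos α := Real.cos_pos_of_mem_Ioo ⟨by linarith, hα2⟩
  have hsm : 0 < Real.sin (m * α) :=
    Real.sin_pos_of_pos_of_lt_pi (by positivity) (by nlinarith)
  have h1 : 0 ≤ Real.sin (m * α + α) :=
    Real.sin_nonneg_of_nonneg_of_le_pi (by positivity) (by nlinarith)
  have h2 : 0 ≤ Real.sin (m * α - α) :=
    Real.sin_nonneg_of_nonneg_of_le_pi (by nlinarith) (by nlinarith)
  have h3 : 0 < Real.sin (m * α + α) ∨ 0 < Real.sin (m * α - α) := by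
    rcases Nat.lt_or_ge 1 m with h | h
    · right
      have : (2 : ℝ) ≤ m := by exact_mod_cast h
      exact Real.sin_pos_of_pos_of_lt_pi (by nlinarith) (by nlinarith)
    · left
      have : (m : ℝ) = 1 := by exact_mod_cast le_antisymm h hm
      exact Real.sin_pos_of_pos_of_lt_pi (by positivity) (by nlinarith)
  have key : (y * Real.cos (m * α) - x * Real.sin (m * α)) * (2 * Real.sin α * Real.cos α) < 0 := by
    have : (y * Real.cos (m * α) - x * Real.sin (m * α)) * (2 * Real.sin α * Real.cos α) =
        (y * Real.cos α - x * Real.sin α) * Real.sin (m * α + α) -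
        (y * Real.cos α + x * Real.sin α) * Real.sin (m * α - α) := by
      rw [Real.sin_add, Real.sin_sub]
      ring
    rw [this]
    rcases h3 with h3 | h3 <;> nlinarith
  have key2 : y * Real.cos (m * α) - x * Real.sin (m * α) < 0 := by
    by_contra hcon
    push Not at hcon
    have : 0 ≤ (y * Real.cos (m * α) - x * Real.sin (m * α)) * (2 * Real.sin α * Real.cos α) := by
      positivity
    linarith
  have h2α : (m : ℝ) * (2 * Real.pi / M) = 2 * (m * α) := by rw [hα]; ring
  rw [h2α, Real.cos_two_mul, Real.sin_two_mul]
  have := mul_neg_of_pos_of_neg hsm key2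
  nlinarith [Real.sin_sq_add_cos_sq (m * α)]

/-- The vertices lie to the right of the line from `a (1 + i E)` to the vertex `a`. -/
theorem strictlyRight_of_wedge {M : ℕ} (hM : 3 ≤ M) {E a b : ℂ}
    (hq : 0 < (E * cis (Real.pi / M)).im) (hp : (E * cis (-(Real.pi / M))).im < 0)
    (ha : a ^ M = 1) (hb : b ^ M = 1) (hab : b ≠ a) : StrictlyRight (a * (1 + I * E)) a b := by
  have hM0 : M ≠ 0 := by omega
  have ha0 : a ≠ 0 := by rintro rfl; simp [hM0] at ha
  have : NeZero M := ⟨hM0⟩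
  obtain ⟨m, hmM, hm⟩ := (isPrimitiveRoot_exp M hM0).eq_pow_of_pow_eq_one
    (ξ := b / a) (by rw [div_pow, ha, hb, div_one])
  have hζ : exp (2 * Real.pi * I / M) = cis (2 * Real.pi / M) := by
    rw [cis]; push_cast; ring_nf
  rw [hζ, cis_pow] at hm
  have hm0 : 0 < m := by
    rcases Nat.eq_zero_or_pos m with rfl | h
    · rw [Nat.cast_zero, zero_mul, cis_zero] at hm
      exact absurd ((div_eq_one_iff_eq ha0).1 hm.symm) hab
    · exact h
  have hb' : b = a * cis (m * (2 * Real.pi / M)) := by rw [hm]; field_simp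
  rw [cis_mul_im] at hq hp
  rw [Real.cos_neg, Real.sin_neg] at hp
  have hw := wedge_neg hM hm0 hmM hq (by linarith)
  have hna : a.re * a.re + a.im * a.im = 1 := by
    have := Complex.norm_eq_one_of_pow_eq_one ha hM0
    have h2 := Complex.normSq_eq_norm_sq a
    rw [this, normSq_apply] at h2
    linarith
  have hcalc : (starRingEnd ℂ) (a - a * (1 + I * E)) * (b - a * (1 + I * E)) =
      ((starRingEnd ℂ) a * a) * ((starRingEnd ℂ) (-(I * E)) *
        (cis (m * (2 * Real.pi / M)) - 1 - I * E)) := by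
    rw [hb', show a - a * (1 + I * E) = a * (-(I * E)) by ring, map_mul]
    ring
  have hone : (starRingEnd ℂ) a * a = 1 := by
    apply Complex.ext <;> simp <;> linarith
  rw [StrictlyRight, hcalc, hone, one_mul]
  simp only [mul_im, conj_re, conj_im, sub_re, sub_im, neg_re, neg_im, mul_re, I_re, I_im, cis_re,
    cis_im, one_re, one_im]
  linarith

/-- A symbolic model of an orbit of the dual billiard map, in coordinates attached to the current
vertex, produces an aperiodic point. -/
theorem exists_isAperiodicPt {M : ℕ} (hM : 3 ≤ M) {S β : Type*} [Preorder β] (ρ : S → β)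
    (E : S → ℂ) (hinj : Function.Injective E) (hq : ∀ s, 0 < (E s * cis (Real.pi / M)).im)
    (hp : ∀ s, (E s * cis (-(Real.pi / M))).im < 0)
    (hnext : ∀ s, ∃ s', ρ s < ρ s' ∧ ∃ r : ℤ, cis (2 * Real.pi / M) ^ r * (E s' - I) = -(E s + I))
    (hprev : ∀ s', ∃ s, ρ s < ρ s' ∧ ∃ r : ℤ, cis (2 * Real.pi / M) ^ r * (E s' - I) = -(E s + I))
    (s₀ : S) : ∃ z, IsAperiodicPt M z := by
  have hM0 : (M : ℝ) ≠ 0 := by positivity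
  set ζ := cis (2 * Real.pi / M) with hζ
  have hζ0 : ζ ≠ 0 := cis_ne_zero _
  obtain ⟨g, hg⟩ := exists_two_sided
    (R := fun s s' : S × ℤ => ρ s.1 < ρ s'.1 ∧ ζ ^ (s'.2 - s.2) * (E s'.1 - I) = -(E s.1 + I))
    (fun s => by
      obtain ⟨s', h, r, hr⟩ := hnext s.1
      exact ⟨(s', s.2 + r), h, by simpa using hr⟩)
    (fun s' => by
      obtain ⟨s, h, r, hr⟩ := hprev s'.1
      exact ⟨(s, s'.2 - r), h, by simpa using hr⟩) (s₀, 0)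
  have hmono : StrictMono fun t => ρ (g t).1 := strictMono_int_of_lt_succ fun t => (hg t).1
  have hvert : ∀ κ : ℤ, (ζ ^ κ) ^ M = 1 := fun κ => by
    rw [hζ, ← zpow_natCast, ← zpow_mul, mul_comm κ, zpow_mul, zpow_natCast, cis_pow,
      mul_div_cancel₀ _ hM0, cis]
    push_cast
    rw [exp_two_pi_mul_I, one_zpow]
  have hright : ∀ t, ∀ b : ℂ, b ^ M = 1 → b ≠ ζ ^ (g t).2 →
      StrictlyRight (ζ ^ (g t).2 * (1 + I * E (g t).1)) (ζ ^ (g t).2) b := fun t b hb hne =>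
    strictlyRight_of_wedge hM (hq _) (hp _) (hvert _) hb hne
  refine ⟨_, fun t => ζ ^ (g t).2 * (1 + I * E (g t).1), fun t t' htt => ?_, rfl, fun t =>
    ⟨ζ ^ (g t).2, hvert _, hright t, ?_⟩⟩
  · have hv : ζ ^ (g t).2 = ζ ^ (g t').2 := by
      by_contra hne
      have h1 := hright t _ (hvert (g t').2) (Ne.symm hne)
      have h2 := hright t' _ (hvert (g t).2) hne
      simp only at htt
      rw [← htt] at h2
      exact not_strictlyRight_swap h1 h2
    simp only [hv] at htt
    have h1 := mul_left_cancel₀ (zpow_ne_zero _ hζ0) htt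
    have h2 := hinj (mul_left_cancel₀ I_ne_zero (add_left_cancel h1))
    exact hmono.injective (congrArg ρ h2)
  · have h := (hg t).2
    rw [zpow_sub₀ hζ0] at h
    field_simp at h
    linear_combination I * h + ζ ^ (g (t + 1)).2 * I_sq - ζ ^ (g t).2 * I_sq

/-- The symbolic model with states arranged in finite columns indexed by `ℤ`. -/
theorem exists_isAperiodicPt_of_columns {M : ℕ} (hM : 3 ≤ M) (len : ℤ → ℕ) (E : ℤ → ℕ → ℂ)
    (hinj : ∀ k j k' j', j ≤ len k → j' ≤ len k' → E k j = E k' j' → k = k' ∧ j = j')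
    (hq : ∀ k j, j ≤ len k → 0 < (E k j * cis (Real.pi / M)).im)
    (hp : ∀ k j, j ≤ len k → (E k j * cis (-(Real.pi / M))).im < 0)
    (hin : ∀ k j, j < len k →
      ∃ r : ℤ, cis (2 * Real.pi / M) ^ r * (E k (j + 1) - I) = -(E k j + I))
    (hout : ∀ k, ∃ r : ℤ, cis (2 * Real.pi / M) ^ r * (E (k + 1) 0 - I) = -(E k (len k) + I)) :
    ∃ z, IsAperiodicPt M z := by
  refine exists_isAperiodicPt hM (S := {p : ℤ × ℕ // p.2 ≤ len p.1}) (fun s => toLex s.1)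
    (fun s => E s.1.1 s.1.2) ?_ (fun s => hq _ _ s.2) (fun s => hp _ _ s.2) ?_ ?_ ⟨(0, 0), by simp⟩
  · rintro ⟨⟨k, j⟩, h⟩ ⟨⟨k', j'⟩, h'⟩ heq
    obtain ⟨rfl, rfl⟩ := hinj k j k' j' h h' heq
    rfl
  · rintro ⟨⟨k, j⟩, h⟩
    rcases Nat.lt_or_eq_of_le h with h | h
    · exact ⟨⟨(k, j + 1), h⟩, by simp [Prod.Lex.toLex_lt_toLex], hin k j h⟩
    · simp only at h
      subst h
      exact ⟨⟨(k + 1, 0), by simp⟩, by simp [Prod.Lex.toLex_lt_toLex], hout k⟩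
  · rintro ⟨⟨k, j⟩, h⟩
    rcases j with _ | j
    · refine ⟨⟨(k - 1, len (k - 1)), le_rfl⟩, by simp [Prod.Lex.toLex_lt_toLex], ?_⟩
      have := hout (k - 1)
      rwa [sub_add_cancel] at this
    · exact ⟨⟨(k, j), (Nat.le_succ j).trans h⟩, by simp [Prod.Lex.toLex_lt_toLex],
        hin k j h⟩

section

variable {N : ℕ} {ξ : ℤ → ℝ} {n : ℤ → ℕ}

theorem LiftData.eq_and_eq (h : LiftData N ξ n) {k k' : ℤ} {j j' : ℕ}
    (h0 : ξ k + j = ξ k' + j') (h1 : ξ (k + 1) - n k + j = ξ (k' + 1) - n k' + j') :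
    k = k' ∧ j = j' := by
  have a1 := _root_.abs_lt.1 (h.abs_lt k)
  have a2 := _root_.abs_lt.1 (h.abs_lt k')
  have h2 : j < j' + 1 := by
    have : (j : ℝ) < j' + 1 := by linarith [a1.1, a2.2]
    exact_mod_cast this
  have h3 : j' < j + 1 := by
    have : (j' : ℝ) < j + 1 := by linarith [a1.2, a2.1]
    exact_mod_cast this
  obtain rfl : j = j' := by omega
  exact ⟨h.eq_of_eq (by linarith) (by linarith), rfl⟩

theorem LiftData.exists_isAperiodicPt_two_mul (h : LiftData N ξ n) (hN : 3 < N) :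
    ∃ z, IsAperiodicPt (2 * N) z := by
  have hNp : (3 : ℝ) < N := by exact_mod_cast hN
  have hpi := Real.pi_pos
  set θ := Real.pi / N with hθ
  set α := Real.pi / (2 * N) with hα
  have hNθ : N * θ = Real.pi := by rw [hθ]; field_simp
  have hθα : θ = 2 * α := by rw [hθ, hα]; field_simp
  have hθ0 : 0 < θ := by positivity
  have hθ1 : θ < Real.pi / 2 := by nlinarith
  have hs : 0 < Real.sin θ := Real.sin_pos_of_pos_of_lt_pi hθ0 (by linarith)
  have hcα : 0 < Real.cos α := Real.cos_pos_of_mem_Ioo ⟨by linarith, by linarith⟩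
  set c := 2 * Real.cos α with hc
  have hc0 : 0 < c := by positivity
  have hcs : 2 * Real.sin α * Real.sin θ = c * (1 - Real.cos θ) := by
    rw [hθα, Real.sin_two_mul, Real.cos_two_mul, hc]
    linear_combination (4 * Real.cos α) * Real.sin_sq_add_cos_sq α
  have hss := Real.sin_sq_add_cos_sq θ
  set Y : ℤ → ℝ := fun k => c * (ξ k + 1 / 2) with hY
  set x : ℤ → ℝ := fun k => (Real.cos θ * Y k + n k * c + c - Y (k + 1)) / Real.sin θ with hx
  have hxs : ∀ k, x k * Real.sin θ = Real.cos θ * Y k + n k * c + c - Y (k + 1) := fun k =>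
    div_mul_cancel₀ _ hs.ne'
  clear_value x c
  set B : ℤ → ℂ := fun k => ⟨x k, Y k⟩ with hB
  have hrec : ∀ k, B (k + 1) = cis (-θ) * B k + 2 * I * n k * cis (-α) + I * (c : ℝ) := by
    intro k
    apply Complex.ext
    · simp only [hB, add_re, mul_re, mul_im, cis_re, cis_im, I_re, I_im, natCast_re, natCast_im,
        ofReal_re, ofReal_im, re_ofNat, im_ofNat, Real.cos_neg, Real.sin_neg]
      apply mul_right_cancel₀ hs.ne'
      have e1 := hxs k
      have e2 := hxs (k + 1)
      have e3 := h.step (k + 1)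
      rw [add_sub_cancel_right] at e3
      simp only [hY] at e1 e2 ⊢
      linear_combination e2 - Real.cos θ * e1 - c * e3 - n k * hcs - (c * (ξ k + 1 / 2)) * hss
    · simp only [hB, add_im, mul_re, mul_im, cis_re, cis_im, I_re, I_im, natCast_re, natCast_im,
        ofReal_re, ofReal_im, re_ofNat, im_ofNat, Real.cos_neg, Real.sin_neg]
      linear_combination hxs k + n k * hc
  have hcis : cis α * cis (-α) = 1 := by rw [← cis_add, add_neg_cancel, cis_zero]
  have hcisθ : cis θ = cis α * cis α := by rw [← cis_add, hθα, two_mul]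
  have hcisθ' : cis (-θ) = cis (-α) * cis (-α) := by rw [← cis_add, hθα]; ring_nf
  have hcc : ((c : ℝ) : ℂ) = cis α + cis (-α) := by
    apply Complex.ext
    · rw [add_re, cis_re, cis_re, ofReal_re, Real.cos_neg, hc, two_mul]
    · rw [add_im, cis_im, cis_im, ofReal_im, Real.sin_neg, add_neg_cancel]
  set E : ℤ → ℕ → ℂ := fun k j => B k * cis (-α) + 2 * I * j with hE
  have hup : ∀ k j, (E k j * cis α).im = c * (ξ k + 1 / 2 + j) := fun k j => by
    have : E k j * cis α = B k + 2 * I * j * cis α := by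
      simp only [hE]
      linear_combination B k * hcis
    rw [this]
    simp [hB, hY, cis_re, cis_im]
    rw [hc]
    ring
  have hdn : ∀ k j, (E k j * cis (-α)).im = c * (ξ (k + 1) - n k + j - 1 / 2) := fun k j => by
    have : E k j * cis (-α) = B (k + 1) - 2 * I * n k * cis (-α) - I * (c : ℝ)
        + 2 * I * j * cis (-α) := by
      simp only [hE]
      rw [hrec k, hcisθ']
      ring
    rw [this]
    simp [hB, hY, cis_re, cis_im]
    rw [hc]
    ring
  have hbd : ∀ k, -(1 / 2) < ξ k ∧ ξ k < 1 / 2 := fun k => _root_.abs_lt.1 (h.abs_lt k)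
  have hαM : Real.pi / ((2 * N : ℕ) : ℝ) = α := by push_cast; rfl
  have hζM : 2 * Real.pi / ((2 * N : ℕ) : ℝ) = θ := by push_cast; rw [hθ]; field_simp
  refine exists_isAperiodicPt_of_columns (by omega) n E ?_ ?_ ?_ ?_ ?_
  · intro k j k' j' _ _ heq
    have e1 := hup k j
    have e2 := hdn k j
    rw [heq, hup k' j'] at e1
    rw [heq, hdn k' j'] at e2
    exact h.eq_and_eq (by linarith [mul_left_cancel₀ hc0.ne' e1])
      (by linarith [mul_left_cancel₀ hc0.ne' e2])
  · intro k j _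
    rw [hαM, hup]
    have := (hbd k).1
    have : (0 : ℝ) ≤ j := by positivity
    exact mul_pos hc0 (by linarith)
  · intro k j hj
    rw [hαM, hdn]
    have := (hbd (k + 1)).2
    have : (j : ℝ) ≤ n k := by exact_mod_cast hj
    exact mul_neg_of_pos_of_neg hc0 (by linarith)
  · intro k j _
    refine ⟨N, ?_⟩
    rw [hζM, cis_zpow, Int.cast_natCast, hNθ, cis_pi]
    simp only [hE]
    push_cast
    ring
  · intro k
    refine ⟨N + 1, ?_⟩
    rw [hζM, cis_zpow]
    push_cast
    rw [add_mul, one_mul, hNθ, cis_add, cis_pi]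
    simp only [hE]
    rw [hrec k, hcc, hcisθ, hcisθ']
    push_cast
    linear_combination (-(B k) * cis (-α) * (cis α * cis (-α) + 1)
      - 2 * I * n k * (cis α * cis (-α) + 1) - I * (cis α * cis α)
      - I * (cis α * cis (-α) + 1)) * hcis

theorem LiftData.exists_isAperiodicPt (h : LiftData N ξ n) (hN : 3 < N) (hodd : Odd N) :
    ∃ z, IsAperiodicPt N z := by
  have hNp : (4 : ℝ) ≤ N := by exact_mod_cast hN
  have hpi := Real.pi_pos
  set θ := Real.pi / N with hθ
  have hNθ : N * θ = Real.pi := by rw [hθ]; field_simp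
  have hθ0 : 0 < θ := by positivity
  have hθ1 : θ ≤ Real.pi / 4 := by nlinarith
  have hs : 0 < Real.sin θ := Real.sin_pos_of_pos_of_lt_pi hθ0 (by linarith)
  have hcθ : 0 < Real.cos θ := Real.cos_pos_of_mem_Ioo ⟨by linarith, by linarith⟩
  have hcc : 0 < Real.cos θ + Real.cos (2 * θ) :=
    add_pos_of_pos_of_nonneg hcθ (Real.cos_nonneg_of_mem_Icc ⟨by linarith, by linarith⟩)
  have hcc' : Real.cos θ + (Real.cos θ * Real.cos θ - Real.sin θ * Real.sin θ) =
      Real.cos θ + Real.cos (2 * θ) := by rw [two_mul, Real.cos_add]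
  set D := Real.cos θ + Real.cos (2 * θ) with hD
  set c := 2 + 2 * Real.cos θ with hc
  have hc0 : 0 < c := by positivity
  have hss := Real.sin_sq_add_cos_sq θ
  set Y : ℤ → ℝ := fun k => c * (ξ k + 1 / 2) with hY
  set x : ℤ → ℝ := fun k => (Real.cos θ * Y k + n k * c + c / 2 - Y (k + 1)) / Real.sin θ with hx
  have hxs : ∀ k, x k * Real.sin θ = Real.cos θ * Y k + n k * c + c / 2 - Y (k + 1) := fun k =>
    div_mul_cancel₀ _ hs.ne'
  clear_value x c
  set B : ℤ → ℂ := fun k => ⟨x k, Y k⟩ with hB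
  have hrec : ∀ k, B (k + 1) =
      cis (-θ) * B k + 2 * I * n k * (1 + cis (-θ)) + I * (1 + cis θ) := by
    intro k
    apply Complex.ext
    · simp only [hB, add_re, add_im, mul_re, mul_im, cis_re, cis_im, I_re, I_im, natCast_re,
        natCast_im, one_re, one_im, re_ofNat, im_ofNat, Real.cos_neg, Real.sin_neg]
      apply mul_right_cancel₀ hs.ne'
      have e1 := hxs k
      have e2 := hxs (k + 1)
      have e3 := h.step (k + 1)
      rw [add_sub_cancel_right] at e3
      simp only [hY] at e1 e2 ⊢
      linear_combination e2 - Real.cos θ * e1 - c * e3 + (1 - 2 * n k - c * (ξ k + 1 / 2)) * hss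
        + (n k - 1 / 2) * (1 - Real.cos θ) * hc
    · simp only [hB, add_re, add_im, mul_re, mul_im, cis_re, cis_im, I_re, I_im, natCast_re,
        natCast_im, one_re, one_im, re_ofNat, im_ofNat, Real.cos_neg, Real.sin_neg]
      linear_combination hxs k + (n k + 1 / 2) * hc
  have hcis : cis θ * cis (-θ) = 1 := by rw [← cis_add, add_neg_cancel, cis_zero]
  set V : ℤ → ℕ → ℂ := fun k j => B k * cis (-θ) + 2 * I * j * (1 + cis (-θ)) with hV
  set U : ℤ → ℕ → ℂ := fun k j => cis θ * (V k j + I) + I with hU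
  have hVup : ∀ k j, (V k j * cis θ).im = c * (ξ k + 1 / 2 + j) := fun k j => by
    have : V k j * cis θ = B k + 2 * I * j * (1 + cis θ) := by
      simp only [hV]
      linear_combination (B k + 2 * I * j) * hcis
    rw [this]
    simp [hB, hY, cis_re, cis_im]
    rw [hc]
    ring
  have hVim : ∀ k j, (V k j).im = c * (ξ (k + 1) - n k + j) := fun k j => by
    have : V k j = B (k + 1) - 2 * I * n k * (1 + cis (-θ)) - I * (1 + cis θ)
        + 2 * I * j * (1 + cis (-θ)) := by
      simp only [hV]
      rw [hrec k]
      ring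
    rw [this]
    simp [hB, hY, cis_re, cis_im]
    rw [hc]
    ring
  have hVdn : ∀ k j, (V k j * cis (-θ)).im =
      c * (ξ (k + 2) - 1 / 2 - n (k + 1)) - 2 * (n k - j) * D := fun k j => by
    have : V k j * cis (-θ) = V (k + 1) 0 - I * (1 + cis (-θ))
        - 2 * I * (n k - j) * (cis (-θ) + cis (-θ) * cis (-θ)) := by
      simp only [hV]
      rw [hrec k]
      push_cast
      linear_combination -I * hcis
    rw [this, sub_im, sub_im, hVim, ← hcc']
    simp [cis_re, cis_im]
    rw [hc]
    ring_nf
  have hUim : ∀ k j, (U k j).im = c * (ξ k + 1 + j) := fun k j => by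
    have : U k j = V k j * cis θ + I * (1 + cis θ) := by
      simp only [hU]
      ring
    rw [this, add_im, hVup]
    simp [cis_re, cis_im]
    rw [hc]
    ring
  have hUdn : ∀ k j, (U k j * cis (-θ)).im = c * (ξ (k + 1) - n k + j + 1 / 2) := fun k j => by
    have : U k j * cis (-θ) = V k j + I * (1 + cis (-θ)) := by
      simp only [hU]
      linear_combination (V k j + I) * hcis
    rw [this, add_im, hVim]
    simp [cis_re, cis_im]
    rw [hc]
    ring
  have hUup : ∀ k j, (U (k + 1) j * cis θ).im =
      c * (ξ k + 1 / 2 + n k) + (2 * j + 2) * D := fun k j => by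
    have : U (k + 1) j * cis θ = B k + 2 * I * n k * (1 + cis θ)
        + I * (2 * j + 2) * (cis θ + cis θ * cis θ) := by
      simp only [hU, hV]
      rw [hrec k]
      linear_combination ((B k + 2 * I * n k) * (cis θ * cis (-θ) + 1)
        + 2 * I * n k * cis θ + 2 * I * j * cis θ + I * (1 + cis θ) * cis θ) * hcis
    rw [this, ← hcc']
    simp [hB, hY, cis_re, cis_im]
    rw [hc]
    ring
  have hbd : ∀ k, -(1 / 2) < ξ k ∧ ξ k < 1 / 2 := fun k => _root_.abs_lt.1 (h.abs_lt k)
  have hVinj : ∀ k j k' j', V k j = V k' j' → k = k' ∧ j = j' := by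
    intro k j k' j' heq
    have e1 := hVup k j
    have e2 := hVim k j
    rw [heq, hVup k' j'] at e1
    rw [heq, hVim k' j'] at e2
    exact h.eq_and_eq (by linarith [mul_left_cancel₀ hc0.ne' e1])
      (by linarith [mul_left_cancel₀ hc0.ne' e2])
  have hUinj : ∀ k j k' j', U k j = U k' j' → k = k' ∧ j = j' := by
    intro k j k' j' heq
    exact hVinj _ _ _ _ (add_right_cancel (mul_left_cancel₀ (cis_ne_zero θ)
      (add_right_cancel heq)))
  have hUV : ∀ k j k' j', j' ≤ n k' → U k j ≠ V k' j' := by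
    intro k j k' j' hj heq
    have e := hUim k j
    rw [heq, hVim] at e
    have e := mul_left_cancel₀ hc0.ne' e
    have h1 := (hbd (k' + 1)).2
    have h2 := (hbd k).1
    have h3 : (j' : ℝ) ≤ n k' := by exact_mod_cast hj
    have h4 : (0 : ℝ) ≤ j := by positivity
    linarith
  obtain ⟨m, hm⟩ := hodd
  have hmθ : 2 * (m * θ) + θ = Real.pi := by
    rw [← hNθ, hm]
    push_cast
    ring
  have hζ : ∀ r : ℤ, cis (2 * Real.pi / N) ^ r = cis (r * (2 * θ)) := fun r => by
    rw [cis_zpow, hθ]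
    ring_nf
  have hζ1 : cis (2 * Real.pi / N) ^ (m : ℤ) = -cis (-θ) := by
    rw [hζ, Int.cast_natCast, show (m : ℝ) * (2 * θ) = Real.pi + -θ by linarith, cis_add, cis_pi]
    ring
  have hζ2 : cis (2 * Real.pi / N) ^ ((m : ℤ) + 1) = -cis θ := by
    rw [hζ, Int.cast_add, Int.cast_natCast, Int.cast_one,
      show ((m : ℝ) + 1) * (2 * θ) = Real.pi + θ by linarith, cis_add, cis_pi]
    ring
  set E : ℤ → ℕ → ℂ := fun k i => if Even i then V k (i / 2) else U k (i / 2) with hE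
  have hE0 : ∀ k j, E k (2 * j) = V k j := fun k j => by
    simp only [hE]
    rw [if_pos (even_two_mul j)]
    congr 1
    omega
  have hE1 : ∀ k j, E k (2 * j + 1) = U k j := fun k j => by
    simp only [hE]
    rw [if_neg (Nat.not_even_iff_odd.2 ⟨j, rfl⟩)]
    congr 1
    omega
  refine exists_isAperiodicPt_of_columns (by omega) (fun k => 2 * n k) E ?_ ?_ ?_ ?_ ?_
  · intro k i k' i' hi hi' heq
    rcases Nat.even_or_odd' i with ⟨j, rfl | rfl⟩ <;>
      rcases Nat.even_or_odd' i' with ⟨j', rfl | rfl⟩ <;>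
      simp only [hE0, hE1] at heq
    · obtain ⟨rfl, rfl⟩ := hVinj _ _ _ _ heq
      exact ⟨rfl, rfl⟩
    · exact absurd heq.symm (hUV _ _ _ _ (by omega))
    · exact absurd heq (hUV _ _ _ _ (by omega))
    · obtain ⟨rfl, rfl⟩ := hUinj _ _ _ _ heq
      exact ⟨rfl, rfl⟩
  · intro k i hi
    rcases Nat.even_or_odd' i with ⟨j, rfl | rfl⟩
    · rw [hE0, hVup]
      have := (hbd k).1
      have : (0 : ℝ) ≤ j := by positivity
      exact mul_pos hc0 (by linarith)
    · rw [hE1]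
      have := hUup (k - 1) j
      rw [sub_add_cancel] at this
      rw [this]
      have := (hbd (k - 1)).1
      have : (0 : ℝ) ≤ n (k - 1) := by positivity
      have := mul_pos hc0 (show 0 < ξ (k - 1) + 1 / 2 + n (k - 1) by linarith)
      positivity
  · intro k i hi
    rcases Nat.even_or_odd' i with ⟨j, rfl | rfl⟩
    · rw [hE0, hVdn]
      have := (hbd (k + 2)).2
      have : (0 : ℝ) ≤ n (k + 1) := by positivity
      have h1 := mul_neg_of_pos_of_neg hc0
        (show ξ (k + 2) - 1 / 2 - n (k + 1) < 0 by linarith)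
      have h2 : (j : ℝ) ≤ n k := by exact_mod_cast (by omega : j ≤ n k)
      have h3 : 0 ≤ 2 * (n k - j) * D := mul_nonneg (by linarith) hcc.le
      linarith
    · rw [hE1, hUdn]
      have := (hbd (k + 1)).2
      have : (j : ℝ) + 1 ≤ n k := by exact_mod_cast (by omega : j + 1 ≤ n k)
      exact mul_neg_of_pos_of_neg hc0 (by linarith)
  · intro k i hi
    rcases Nat.even_or_odd' i with ⟨j, rfl | rfl⟩
    · refine ⟨m, ?_⟩
      rw [hζ1, hE1, hE0]
      simp only [hU]
      linear_combination (-(V k j) - I) * hcis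
    · refine ⟨m + 1, ?_⟩
      rw [hζ2, hE1, show 2 * j + 1 + 1 = 2 * (j + 1) by ring, hE0]
      simp only [hU, hV]
      push_cast
      linear_combination -2 * I * hcis
  · intro k
    refine ⟨m + 1, ?_⟩
    have : E (k + 1) 0 = V (k + 1) 0 := hE0 (k + 1) 0
    rw [hζ2, hE0, this]
    simp only [hV]
    rw [hrec k]
    push_cast
    linear_combination (-(cis (-θ) * B k) - 2 * I * n k * (1 + cis (-θ)) - I * (1 + cis θ)) * hcis

end

end DualBilliard

/-- For odd `N > 3`, the dual billiard outside the regular `N`-gon has an aperiodic point,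
and so does the dual billiard outside the regular `2N`-gon. -/
theorem dual_billiard_aperiodic_point (N : ℕ) (hN : 3 < N) (hodd : Odd N) :
    (∃ z : ℂ, IsAperiodicPt N z) ∧ (∃ z : ℂ, IsAperiodicPt (2 * N) z) := by
  have : DualBilliard.OddGtThree N := ⟨hN, hodd⟩
  obtain ⟨ξ, n, h⟩ := DualBilliard.exists_liftData N
  exact ⟨h.exists_isAperiodicPt hN hodd, h.exists_isAperiodicPt_two_mul hN⟩
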